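/- Let M be a finitely generated group which is virtually non-abelian free, and let M_1, …, M_n be finitely many finitely generated subgroups of M, each of infinite index in M. Then there exists a proper subgroup V of M such that: (i) V is finitely generated, virtually non-abelian free, and almost malnormal in M; (ii) for every l ∈ {1, …, n} and every element m of M, the intersection mVm⁻¹ ∩ M_l is finite. -/

import Mathlib

/-- The conjugate subgroup `g H g⁻¹`. -/
def conjSub {G : Type*} [Group G] (g : G) (H : Subgroup G) : Subgroup G :=
  H.map (MulAut.conj g).toMonoidHom

/-- A subgroup `H` of `G` is almost malnormal if for every `g ∉ H` the
intersection `H ∩ gHg⁻¹` is finite. -/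
def AlmostMalnormal {G : Type*} [Group G] (H : Subgroup G) : Prop :=
  ∀ g : G, g ∉ H → ((H ⊓ conjSub g H : Subgroup G) : Set G).Finite

/-- A group is virtually non-abelian free if it has a finite-index subgroup
which is a non-abelian free group of finite rank. -/
def VirtuallyNonabelianFree (G : Type*) [Group G] : Prop :=
  ∃ F : Subgroup G, F.FiniteIndex ∧ ∃ n : ℕ, 2 ≤ n ∧ Nonempty (F ≃* FreeGroup (Fin n))

namespace KP

/-- The rational group ring of a free group. -/
abbrev GR (X : Type*) := MonoidAlgebra ℚ (FreeGroup X)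
/-- The free associative algebra. -/
abbrev PA (X : Type*) := MonoidAlgebra ℚ (FreeMonoid X)

variable {X : Type*}

noncomputable def el : FreeGroup X →* GR X := MonoidAlgebra.of ℚ (FreeGroup X)

noncomputable def eps (X : Type*) : GR X →ₐ[ℚ] ℚ := MonoidAlgebra.lift ℚ ℚ (FreeGroup X) 1

noncomputable def aug (X : Type*) : Submodule ℚ (GR X) := LinearMap.ker (eps X).toLinearMap

noncomputable def Fil (X : Type*) : ℕ → Submodule ℚ (GR X)
  | 0 => ⊤
  | k+1 => aug X * Fil X k

lemma eps_el (e : FreeGroup X) : eps X (el e) = 1 := by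
  simp [eps, el]

lemma mem_aug {r : GR X} : r ∈ aug X ↔ eps X r = 0 := by
  simp [aug]

lemma el_sub_one_mem (e : FreeGroup X) : el e - 1 ∈ aug X := by
  rw [mem_aug, map_sub, eps_el, map_one, sub_self]

lemma mem_Fil_zero (r : GR X) : r ∈ Fil X 0 := by
  change r ∈ (⊤ : Submodule ℚ (GR X)); trivial

lemma top_mul_Fil (k : ℕ) : (⊤ : Submodule ℚ (GR X)) * Fil X k ≤ Fil X k := by
  cases k with
  | zero => exact le_top
  | succ k =>
    change ⊤ * (aug X * Fil X k) ≤ aug X * Fil X k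
    rw [← mul_assoc]
    refine mul_le_mul' ?_ le_rfl
    rw [Submodule.mul_le]
    intro m _ n hn
    rw [mem_aug] at *
    simp [hn]

lemma Fil_mul (j k : ℕ) : Fil X j * Fil X k ≤ Fil X (j + k) := by
  induction j with
  | zero => rw [zero_add]; exact top_mul_Fil k
  | succ j ih =>
    rw [Nat.succ_add]
    change aug X * Fil X j * Fil X k ≤ aug X * Fil X (j + k)
    rw [mul_assoc]
    exact mul_le_mul' le_rfl ih

lemma mul_mem_Fil {j k : ℕ} {r s : GR X} (hr : r ∈ Fil X j) (hs : s ∈ Fil X k) :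
    r * s ∈ Fil X (j + k) := Fil_mul j k (Submodule.mul_mem_mul hr hs)

lemma Fil_one : Fil X 1 = aug X := by
  change aug X * ⊤ = aug X
  apply le_antisymm
  · rw [Submodule.mul_le]
    intro m hm n _
    rw [mem_aug] at *
    simp [hm]
  · intro r hr
    have := Submodule.mul_mem_mul hr (Submodule.mem_top (R := ℚ) (x := (1 : GR X)))
    rwa [mul_one] at this

lemma mul_mem_Fil_left {k : ℕ} (r : GR X) {s : GR X} (hs : s ∈ Fil X k) :
    r * s ∈ Fil X k := by
  have := mul_mem_Fil (mem_Fil_zero r) hs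
  rwa [zero_add] at this

lemma mul_mem_Fil_right {k : ℕ} (r : GR X) {s : GR X} (hs : s ∈ Fil X k) :
    s * r ∈ Fil X k := by
  have := mul_mem_Fil hs (mem_Fil_zero r)
  rwa [add_zero] at this

lemma Fil_anti : Antitone (Fil X) := by
  apply antitone_nat_of_succ_le
  intro n
  change aug X * Fil X n ≤ _
  rw [Submodule.mul_le]
  intro m _ s hs
  exact mul_mem_Fil_left m hs

lemma pow_mem_Fil {j : ℕ} {r : GR X} (hr : r ∈ Fil X j) (k : ℕ) : r ^ k ∈ Fil X (j * k) := by
  induction k with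
  | zero => exact mem_Fil_zero _
  | succ k ih => rw [pow_succ, Nat.mul_succ]; exact mul_mem_Fil ih hr

lemma aug_le_span : aug X ≤ Submodule.span ℚ (Set.range fun e : FreeGroup X => el e - 1) := by
  have key : ∀ r : GR X, r - algebraMap ℚ (GR X) (eps X r) ∈
      Submodule.span ℚ (Set.range fun e : FreeGroup X => el e - 1) := by
    intro r
    induction r using MonoidAlgebra.induction_linear with
    | zero => simp
    | add f g hf hg =>
      have := Submodule.add_mem _ hf hg
      convert this using 1
      simp only [map_add]; abel
    | single a b =>
      have h1 : (MonoidAlgebra.single a b : GR X) = b • el a := by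
        simp [el, MonoidAlgebra.of]
      have h2 : MonoidAlgebra.single a b - algebraMap ℚ (GR X) (eps X (MonoidAlgebra.single a b))
          = b • (el a - 1) := by
        rw [h1, map_smul, eps_el, smul_sub, Algebra.algebraMap_eq_smul_one]
        simp
      rw [h2]
      exact Submodule.smul_mem _ _ (Submodule.subset_span ⟨a, rfl⟩)
  intro r hr
  have := key r
  rw [mem_aug] at hr
  simpa [hr] using this

/-- degree one part of the free algebra -/
noncomputable def P1 (X : Type*) : Submodule ℚ (PA X) :=
  Submodule.span ℚ (Set.range fun i : X => (MonoidAlgebra.of ℚ (FreeMonoid X) (FreeMonoid.of i)))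

noncomputable def alift {A : Type*} [Ring A] [Algebra ℚ A] (f : X → A) : PA X →ₐ[ℚ] A :=
  MonoidAlgebra.lift ℚ A (FreeMonoid X) (FreeMonoid.lift f)

noncomputable def vr (i : X) : PA X := MonoidAlgebra.of ℚ (FreeMonoid X) (FreeMonoid.of i)

lemma alift_vr {A : Type*} [Ring A] [Algebra ℚ A] (f : X → A) (i : X) : alift f (vr i) = f i := by
  simp [alift, vr]

lemma vr_mem (i : X) : vr i ∈ P1 X := Submodule.subset_span ⟨i, rfl⟩

lemma alift_hom_ext {A : Type*} [Ring A] [Algebra ℚ A] {f g : PA X →ₐ[ℚ] A}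
    (h : ∀ i, f (vr i) = g (vr i)) : f = g := by
  apply (MonoidAlgebra.lift ℚ A (FreeMonoid X)).symm.injective
  apply FreeMonoid.hom_eq
  intro i
  exact h i

noncomputable def theta (X : Type*) : PA X →ₐ[ℚ] GR X := alift fun i => el (FreeGroup.of i) - 1

lemma theta_vr (i : X) : theta X (vr i) = el (FreeGroup.of i) - 1 := alift_vr _ _

lemma theta_mem {N : ℕ} {p : PA X} (hp : p ∈ P1 X ^ N) : theta X p ∈ Fil X N := by
  have h1 : (P1 X).map (theta X).toLinearMap ≤ Fil X 1 := by
    rw [P1, Submodule.map_span, Submodule.span_le, Fil_one]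
    rintro _ ⟨_, ⟨i, rfl⟩, rfl⟩
    have : theta X (vr i) ∈ aug X := by rw [theta_vr]; exact el_sub_one_mem _
    exact this
  induction N generalizing p with
  | zero => exact mem_Fil_zero _
  | succ N ih =>
    rw [pow_succ] at hp
    refine Submodule.mul_induction_on hp ?_ ?_
    · intro m hm n hn
      rw [map_mul]
      exact mul_mem_Fil (ih hm) (h1 ⟨n, hn, rfl⟩)
    · intro x y hx hy
      rw [map_add]; exact Submodule.add_mem _ hx hy

lemma aug_le : aug X ≤ (P1 X).map (theta X).toLinearMap ⊔ Fil X 2 := by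
  refine aug_le_span.trans ?_
  rw [Submodule.span_le]
  rintro _ ⟨e, rfl⟩
  simp only [SetLike.mem_coe]
  have hmm : ∀ a b : FreeGroup X, (el a - 1) * (el b - 1) ∈
      (P1 X).map (theta X).toLinearMap ⊔ Fil X 2 := by
    intro a b
    refine Submodule.mem_sup_right ?_
    have := mul_mem_Fil (j := 1) (k := 1) (by rw [Fil_one]; exact el_sub_one_mem a)
      (by rw [Fil_one]; exact el_sub_one_mem b)
    exact this
  induction e using FreeGroup.induction_on with
  | C1 => simp
  | of i => exact Submodule.mem_sup_left ⟨vr i, vr_mem i, theta_vr i⟩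
  | inv_of i hi =>
    have h : el (FreeGroup.of i)⁻¹ - 1 = -(el (FreeGroup.of i) - 1)
        - (el (FreeGroup.of i) - 1) * (el (FreeGroup.of i)⁻¹ - 1) := by
      have : el (FreeGroup.of i) * el (FreeGroup.of i)⁻¹ = 1 := by
        rw [← map_mul, mul_inv_cancel, map_one]
      rw [sub_mul, mul_sub, this]; noncomm_ring
    rw [h]
    exact Submodule.sub_mem _ (Submodule.neg_mem _ hi) (hmm _ _)
  | mul x y hx hy =>
    have h : el (x * y) - 1 = (el x - 1) + (el y - 1) + (el x - 1) * (el y - 1) := by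
      rw [map_mul]; noncomm_ring
    rw [h]
    exact Submodule.add_mem _ (Submodule.add_mem _ hx hy) (hmm _ _)

/-- M1 -/
lemma Fil_le (N : ℕ) : Fil X N ≤ (P1 X ^ N).map (theta X).toLinearMap ⊔ Fil X (N + 1) := by
  induction N with
  | zero =>
    intro r _
    have h : r = algebraMap ℚ (GR X) (eps X r) + (r - algebraMap ℚ (GR X) (eps X r)) := by abel
    rw [h]
    refine Submodule.add_mem_sup ?_ ?_
    · refine ⟨algebraMap ℚ _ (eps X r), ?_, (theta X).commutes _⟩
      rw [pow_zero]
      exact Submodule.algebraMap_mem _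
    · rw [zero_add, Fil_one, mem_aug, map_sub, AlgHom.commutes]; simp
  | succ N ih =>
    change aug X * Fil X N ≤ _
    rw [Submodule.mul_le]
    intro m hm n hn
    obtain ⟨_, ⟨p, hp, rfl⟩, b, hb, rfl⟩ := Submodule.mem_sup.1 (aug_le hm)
    obtain ⟨_, ⟨q, hq, rfl⟩, d, hd, rfl⟩ := Submodule.mem_sup.1 (ih hn)
    have e1 : ((theta X).toLinearMap p + b) * ((theta X).toLinearMap q + d) = (theta X).toLinearMap p * (theta X).toLinearMap q + ((theta X).toLinearMap p * d + b * ((theta X).toLinearMap q + d)) := by noncomm_ring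
    rw [e1]
    refine Submodule.add_mem_sup ⟨p * q, ?_, map_mul (theta X) _ _⟩ ?_
    · rw [pow_succ']; exact Submodule.mul_mem_mul hp hq
    · refine Submodule.add_mem _ ?_ ?_
      · have := mul_mem_Fil (theta_mem (N := 1) (by rwa [pow_one])) hd
        rwa [add_comm 1] at this
      · have := mul_mem_Fil hb hn
        rw [add_comm 2] at this
        exact this

lemma exists_sym {N : ℕ} {r : GR X} (hr : r ∈ Fil X N) :
    ∃ p ∈ P1 X ^ N, r - theta X p ∈ Fil X (N + 1) := by
  obtain ⟨_, ⟨p, hp, rfl⟩, b, hb, rfl⟩ := Submodule.mem_sup.1 (Fil_le N hr)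
  refine ⟨p, hp, ?_⟩
  have : (theta X).toLinearMap p = theta X p := rfl
  rw [this, add_sub_cancel_left]; exact hb

noncomputable def geo (i : X) : (PowerSeries (PA X))ˣ where
  val := 1 + PowerSeries.monomial 1 (vr i)
  inv := PowerSeries.mk fun n => (- vr i) ^ n
  val_inv := by
    have : (PowerSeries.monomial 1 (vr i) : PowerSeries (PA X)) =
      PowerSeries.C (vr i) * PowerSeries.X := by
      rw [← pow_one PowerSeries.X, ← PowerSeries.monomial_eq_C_mul_X_pow]
    rw [this, add_mul, one_mul, mul_assoc, ← (PowerSeries.commute_X _).eq, ← mul_assoc]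
    ext n
    cases n with
    | zero => simp
    | succ n => simp [PowerSeries.coeff_succ_mul_X, pow_succ']
  inv_val := by
    have : (PowerSeries.monomial 1 (vr i) : PowerSeries (PA X)) =
      PowerSeries.C (vr i) * PowerSeries.X := by
      rw [← pow_one PowerSeries.X, ← PowerSeries.monomial_eq_C_mul_X_pow]
    rw [this, mul_add, mul_one, ← mul_assoc]
    ext n
    cases n with
    | zero => simp
    | succ n => simp [PowerSeries.coeff_succ_mul_X, pow_succ]

noncomputable def mu (X : Type*) : GR X →ₐ[ℚ] PowerSeries (PA X) :=
  MonoidAlgebra.lift ℚ _ _ ((Units.coeHom _).comp (FreeGroup.lift geo))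

lemma mu_of (i : X) : mu X (el (FreeGroup.of i)) = 1 + PowerSeries.monomial 1 (vr i) := by
  simp [mu, el, geo]

lemma coeff_zero_mu {r : GR X} (hr : r ∈ aug X) : PowerSeries.coeff 0 (mu X r) = 0 := by
  have h : ((PowerSeries.constantCoeff (R := PA X)).toMonoidHom.comp
      ((mu X).toRingHom.toMonoidHom.comp el)) = 1 := by
    apply FreeGroup.ext_hom
    intro i
    have : PowerSeries.coeff 0 (mu X (el (FreeGroup.of i))) = 1 := by
      rw [mu_of, map_add, PowerSeries.coeff_monomial]; simp
    simpa using this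
  refine Submodule.span_induction ?_ ?_ ?_ ?_ (aug_le_span hr)
  · rintro _ ⟨e, rfl⟩
    have := DFunLike.congr_fun h e
    simp at this
    simp [this]
  · simp
  · intro x y _ _ hx hy; rw [map_add, map_add, hx, hy, add_zero]
  · intro a x _ hx
    rw [map_smul, Algebra.smul_def, PowerSeries.algebraMap_apply, PowerSeries.coeff_C_mul, hx, mul_zero]

lemma mu_Fil {N : ℕ} {r : GR X} (hr : r ∈ Fil X N) : ∀ k < N, PowerSeries.coeff k (mu X r) = 0 := by
  induction N generalizing r with
  | zero => intro k hk; omega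
  | succ N ih =>
    refine Submodule.mul_induction_on hr ?_ ?_
    · intro m hm n hn k hk
      rw [map_mul, PowerSeries.coeff_mul]
      refine Finset.sum_eq_zero ?_
      rintro ⟨a, b⟩ hab
      rw [Finset.HasAntidiagonal.mem_antidiagonal] at hab
      dsimp only at *
      rcases Nat.eq_zero_or_pos a with rfl | ha
      · rw [coeff_zero_mu hm, zero_mul]
      · rw [ih hn b (by omega), mul_zero]
    · intro x y hx hy k hk
      rw [map_add, map_add, hx k hk, hy k hk, add_zero]

lemma mu_theta {N : ℕ} {p : PA X} (hp : p ∈ P1 X ^ N) :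
    mu X (theta X p) = PowerSeries.monomial N p := by
  have h1 : ∀ p ∈ P1 X, mu X (theta X p) = PowerSeries.monomial 1 p := by
    intro p hp
    refine Submodule.span_induction ?_ ?_ ?_ ?_ hp
    · rintro _ ⟨i, rfl⟩
      have : mu X (theta X (vr i)) = PowerSeries.monomial 1 (vr i) := by
        rw [theta_vr, map_sub, mu_of, map_one, add_sub_cancel_left]
      exact this
    · simp
    · intro x y _ _ hx hy; simp [hx, hy]
    · intro a x _ hx
      rw [map_smul, map_smul, hx]
      rw [Algebra.smul_def, Algebra.smul_def, PowerSeries.algebraMap_apply,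
        ← PowerSeries.monomial_zero_eq_C_apply, PowerSeries.monomial_mul_monomial, zero_add]
  induction N generalizing p with
  | zero =>
    rw [pow_zero] at hp
    obtain ⟨c, rfl⟩ := Submodule.mem_one.1 hp
    rw [AlgHom.commutes, AlgHom.commutes]
    rw [PowerSeries.monomial_zero_eq_C_apply, PowerSeries.algebraMap_apply]
  | succ N ih =>
    rw [pow_succ] at hp
    refine Submodule.mul_induction_on hp ?_ ?_
    · intro m hm n hn
      rw [map_mul, map_mul, ih hm, h1 n hn, PowerSeries.monomial_mul_monomial]
    · intro x y hx hy
      rw [map_add, map_add, hx, hy, map_add]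

/-- M2 -/
lemma sym_unique {N : ℕ} {p : PA X} (hp : p ∈ P1 X ^ N) (h : theta X p ∈ Fil X (N + 1)) : p = 0 := by
  have := mu_Fil h N (Nat.lt_succ_self N)
  rw [mu_theta hp] at this
  simpa using this

end KP

namespace KP
variable {X : Type*}

open Classical in
noncomputable def TT (i : X) : Module.End ℚ (List X → ℚ) where
  toFun v w := match w with
    | [] => 0
    | a :: w' => if a = i ∧ w'.head? ≠ some i then v w' else 0
  map_add' u v := by
    funext w
    cases w with
    | nil => simp
    | cons a w => by_cases h : a = i ∧ w.head? ≠ some i <;> simp [h]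
  map_smul' c v := by
    funext w
    cases w with
    | nil => simp
    | cons a w => by_cases h : a = i ∧ w.head? ≠ some i <;> simp [h]

lemma TT_nil (i : X) (v : List X → ℚ) : TT i v [] = 0 := rfl

open Classical in
lemma TT_cons (i a : X) (v : List X → ℚ) (w : List X) :
    TT i v (a :: w) = if a = i ∧ w.head? ≠ some i then v w else 0 := rfl

lemma TT_sq (i : X) : TT i * TT i = 0 := by
  ext v w
  rw [Module.End.mul_apply]
  cases w with
  | nil => simp [TT_nil]
  | cons a w =>
    rw [TT_cons]
    split_ifs with h
    · cases w with
      | nil => simp [TT_nil]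
      | cons b w =>
        rw [TT_cons, if_neg]
        · rfl
        · rintro ⟨rfl, _⟩
          simp at h
    · rfl

noncomputable def uu (i : X) : (Module.End ℚ (List X → ℚ))ˣ where
  val := 1 + TT i
  inv := 1 - TT i
  val_inv := by have := TT_sq i; rw [add_mul, one_mul, mul_sub, mul_one, this]; simp
  inv_val := by have := TT_sq i; rw [sub_mul, one_mul, mul_add, mul_one, this]; simp

lemma uu_zpow (i : X) (n : ℤ) :
    ((uu i ^ n : (Module.End ℚ (List X → ℚ))ˣ) : Module.End ℚ (List X → ℚ)) = 1 + (n : ℚ) • TT i := by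
  have key : ∀ k : ℤ, (1 + (k : ℚ) • TT i) * (1 + TT i) = 1 + ((k + 1 : ℤ) : ℚ) • TT i := by
    intro k
    rw [add_mul, one_mul, mul_add, smul_mul_assoc, smul_mul_assoc, TT_sq, mul_one, smul_zero]
    push_cast; module
  induction n using Int.induction_on with
  | zero => simp
  | succ k ih =>
    rw [zpow_add, zpow_one, Units.val_mul, ih]
    exact key k
  | pred k ih =>
    rw [zpow_sub, zpow_one, Units.val_mul, ih, Units.mul_inv_eq_iff_eq_mul]
    have := key (-k-1)
    rw [sub_add_cancel] at this
    exact this.symm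

open scoped Pointwise in
lemma uu_lift_injective [Nontrivial X] : Function.Injective (FreeGroup.lift (uu (X := X))) := by
  have : FreeGroup.lift (uu (X := X)) =
      (Monoid.CoprodI.lift fun i => FreeGroup.lift fun _ => uu i).comp
        (@freeGroupEquivCoprodI X).toMonoidHom := by
    ext1 i
    simp
  rw [this, MonoidHom.coe_comp]
  clear this
  refine Function.Injective.comp ?_ (MulEquiv.injective freeGroupEquivCoprodI)
  let S : X → Set (List X → ℚ) := fun i => {v | ∃ d : ℕ, (∀ w, d < w.length → v w = 0) ∧
    (∃ w, w.length = d ∧ v w ≠ 0) ∧ ∀ w, w.length = d → v w ≠ 0 → w.head? = some i}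
  refine Monoid.CoprodI.lift_injective_of_ping_pong (fun i : X => FreeGroup.lift fun _ : Unit => uu i)
    ?_ S ?_ ?_ ?_
  · right
    obtain ⟨i⟩ := (inferInstance : Nonempty X)
    refine ⟨i, ?_⟩
    rw [Cardinal.mk_congr FreeGroup.freeGroupUnitEquivInt, Cardinal.mk_int]
    exact (Cardinal.natCast_le_aleph0 (n := 3))
  · classical
    intro i
    refine ⟨fun w => if w = [i] then 1 else 0, 1, ?_, ⟨[i], rfl, by simp⟩, ?_⟩
    · intro w hw
      refine if_neg ?_
      rintro rfl
      simp at hw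
    · intro w _ hw
      have : w = [i] := by
        by_contra h; simp [h] at hw
      simp [this]
  · intro i j hij
    rw [Function.onFun, Set.disjoint_left]
    rintro v ⟨d, h1, ⟨w, hw, hv⟩, h3⟩ ⟨d', h1', ⟨w', hw', hv'⟩, h3'⟩
    have e : d = d' := by
      apply le_antisymm
      · by_contra h
        exact hv (h1' w (by omega))
      · by_contra h
        exact hv' (h1 w' (by omega))
    subst e
    have a1 := h3 w hw hv
    have a2 := h3' w hw hv
    rw [a1] at a2
    exact hij (Option.some.inj a2)
  · intro i j hij
    refine FreeGroup.freeGroupUnitEquivInt.forall_congr_left.mpr ?_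
    intro n hne1
    change FreeGroup.lift (fun _ => uu i) (FreeGroup.of () ^ n) • S j ⊆ S i
    simp only [map_zpow, FreeGroup.lift_apply_of]
    have hnne0 : n ≠ 0 := by
      rintro rfl
      apply hne1
      simp [FreeGroup.freeGroupUnitEquivInt]
    rintro _ ⟨v, ⟨d, h1, ⟨w, hw, hv⟩, h3⟩, rfl⟩
    have hval : ∀ w, (uu i ^ n • v) w = v w + n * TT i v w := by
      intro w
      have : uu i ^ n • v = ((uu i ^ n : (Module.End ℚ (List X → ℚ))ˣ) :
        Module.End ℚ (List X → ℚ)) v := rfl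
      rw [this, uu_zpow]; simp
    refine ⟨d + 1, ?_, ⟨i :: w, by simp [hw], ?_⟩, ?_⟩
    · intro w hw
      change (uu i ^ n • v) w = 0
      rw [hval, h1 w (by omega)]
      cases w with
      | nil => simp [TT_nil]
      | cons a w =>
        rw [TT_cons, h1 w (by simpa using hw)]; simp
    · change (uu i ^ n • v) _ ≠ 0
      have hh := h3 w hw hv
      rw [hval, h1 (i :: w) (by simp [hw]), TT_cons, if_pos, zero_add]
      · exact mul_ne_zero (by exact_mod_cast hnne0) hv
      · refine ⟨rfl, ?_⟩
        rw [hh]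
        intro h
        exact hij (Option.some.inj h).symm
    · intro w hw hne
      change (uu i ^ n • v) w ≠ 0 at hne
      rw [hval, h1 w (by omega)] at hne
      cases w with
      | nil => simp at hw
      | cons a w =>
        rw [TT_cons] at hne
        split_ifs at hne with h
        · simp [h.1]
        · simp at hne

noncomputable def actA (X : Type*) : GR X →ₐ[ℚ] Module.End ℚ (List X → ℚ) :=
  MonoidAlgebra.lift ℚ _ _ ((Units.coeHom _).comp (FreeGroup.lift uu))

lemma actA_el (e : FreeGroup X) : actA X (el e) = (FreeGroup.lift uu e : (Module.End ℚ (List X → ℚ))ˣ) := by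
  simp [actA, el]

def Vd (X : Type*) (d : ℕ) : Submodule ℚ (List X → ℚ) where
  carrier := {v | ∀ w, w.length < d → v w = 0}
  add_mem' {a b} ha hb w hw := by simp [ha w hw, hb w hw]
  zero_mem' := by intro w _; rfl
  smul_mem' c v hv w hw := by simp [hv w hw]

lemma TT_mem (i : X) {d : ℕ} {v : List X → ℚ} (hv : v ∈ Vd X d) : TT i v ∈ Vd X (d+1) := by
  intro w hw
  cases w with
  | nil => rfl
  | cons a w =>
    rw [TT_cons, hv w (by simpa using hw)]; simp

lemma Vd_succ (d : ℕ) : Vd X (d+1) ≤ Vd X d := fun _ hv w hw => hv w (by omega)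

lemma actA_el_sub (e : FreeGroup X) : ∀ (d : ℕ) (v : List X → ℚ), v ∈ Vd X d →
    actA X (el e) v - v ∈ Vd X (d+1) := by
  induction e using FreeGroup.induction_on with
  | C1 => intro d v hv; simp
  | of i =>
    intro d v hv
    have : actA X (el (FreeGroup.of i)) v - v = TT i v := by
      rw [actA_el]; simp [uu]
    rw [this]; exact TT_mem i hv
  | inv_of i _ =>
    intro d v hv
    have : actA X (el (FreeGroup.of i)⁻¹) v - v = - TT i v := by
      rw [actA_el, map_inv]; simp [uu]
    rw [this]; exact Submodule.neg_mem _ (TT_mem i hv)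
  | mul x y hx hy =>
    intro d v hv
    have h1 := hy d v hv
    have h2 : actA X (el y) v ∈ Vd X d := by
      have := Submodule.add_mem _ (Vd_succ d h1) hv
      simpa using this
    have h3 := Submodule.add_mem _ (hx d _ h2) h1
    convert h3 using 1
    rw [map_mul, map_mul, Module.End.mul_apply]; abel

lemma actA_aug {r : GR X} (hr : r ∈ aug X) (d : ℕ) (v : List X → ℚ) (hv : v ∈ Vd X d) :
    actA X r v ∈ Vd X (d+1) := by
  refine Submodule.span_induction (p := fun r _ => actA X r v ∈ Vd X (d+1)) ?_ ?_ ?_ ?_ (aug_le_span hr)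
  · rintro _ ⟨e, rfl⟩
    have := actA_el_sub e d v hv
    simpa using this
  · simp
  · intro x y _ _ hx hy
    rw [map_add]; exact Submodule.add_mem _ hx hy
  · intro c x _ hx
    rw [map_smul]; exact Submodule.smul_mem _ _ hx

lemma actA_Fil {N : ℕ} {r : GR X} (hr : r ∈ Fil X N) (v : List X → ℚ) :
    actA X r v ∈ Vd X N := by
  induction N generalizing r v with
  | zero => intro w hw; simp at hw
  | succ N ih =>
    refine Submodule.mul_induction_on hr ?_ ?_
    · intro m hm n hn
      rw [map_mul, Module.End.mul_apply]
      exact actA_aug hm N _ (ih hn v)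
    · intro x y hx hy
      rw [map_add]; exact Submodule.add_mem _ hx hy

/-- M3 -/
lemma eq_one_of_mem_Fil [Nontrivial X] {e : FreeGroup X} (h : ∀ k, el e - 1 ∈ Fil X k) : e = 1 := by
  apply uu_lift_injective
  rw [map_one]
  apply Units.ext
  rw [← actA_el]
  ext v w
  have := actA_Fil (h (w.length + 1)) v w (Nat.lt_succ_self _)
  rw [map_sub, map_one] at this
  simpa [sub_eq_zero] using this

lemma eq_of_mem_Fil [Nontrivial X] {e f : FreeGroup X} (h : ∀ k, el e - el f ∈ Fil X k) : e = f := by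
  have : e * f⁻¹ = 1 := by
    apply eq_one_of_mem_Fil
    intro k
    have := mul_mem_Fil_right (el f⁻¹) (h k)
    rwa [sub_mul, ← map_mul, ← map_mul, mul_inv_cancel, map_one] at this
  exact mul_inv_eq_one.1 this

/-- M4 : homogeneous elements -/
lemma P1_pow_support {N : ℕ} {p : PA X} (hp : p ∈ P1 X ^ N) (w : FreeMonoid X)
    (hw : p.coeff w ≠ 0) : w.length = N := by
  classical
  have h1 : ∀ p ∈ P1 X, ∀ w : FreeMonoid X, w.length ≠ 1 → p.coeff w = 0 := by
    intro p hp w hw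
    refine Submodule.span_induction (p := fun p _ => p.coeff w = 0) ?_ ?_ ?_ ?_ hp
    · rintro _ ⟨i, rfl⟩
      simp only [MonoidAlgebra.of_apply, MonoidAlgebra.coeff_single]
      rw [Finsupp.single_eq_of_ne]
      rintro rfl
      simp at hw
    · simp
    · intro x y _ _ hx hy; simp [hx, hy]
    · intro c x _ hx; simp [hx]
  by_contra hne
  revert hw
  rw [imp_false, not_not]
  induction N generalizing p w with
  | zero =>
    rw [pow_zero] at hp
    obtain ⟨c, rfl⟩ := Submodule.mem_one.1 hp
    rw [MonoidAlgebra.coe_algebraMap]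
    simp only [Function.comp, MonoidAlgebra.coeff_single]
    rw [Finsupp.single_eq_of_ne]
    rintro rfl
    simp at hne
  | succ N ih =>
    rw [pow_succ] at hp
    refine Submodule.mul_induction_on hp ?_ ?_
    · intro m hm n hn
      rw [MonoidAlgebra.coeff_mul]
      refine Finset.sum_eq_zero fun a ha => Finset.sum_eq_zero fun b hb => ?_
      dsimp only
      rw [if_neg]
      rintro rfl
      rw [Finsupp.mem_support_iff] at ha hb
      have hb1 : b.length = 1 := by
        by_contra h; exact hb (h1 n hn b h)
      have ha1 : a.length = N := by
        by_contra h; exact ha (ih hm a h)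
      exact hne (by rw [FreeMonoid.length_mul]; omega)
    · intro x y hx hy
      simp [hx, hy]

lemma coeff_mul_hom {N : ℕ} {p q : PA X} (hp : p ∈ P1 X ^ N) (u v : FreeMonoid X)
    (hu : u.length = N) : (p * q).coeff (u * v) = p.coeff u * q.coeff v := by
  classical
  rw [MonoidAlgebra.coeff_mul]
  have key : ∀ a ∈ p.coeff.support, ∀ b : FreeMonoid X, a * b = u * v ↔ a = u ∧ b = v := by
    intro a ha b
    have hl := P1_pow_support hp a (Finsupp.mem_support_iff.1 ha)
    constructor
    · intro h
      exact List.append_inj (s₁ := a.toList) (s₂ := u.toList) (t₁ := b.toList) (t₂ := v.toList) h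
        (hl.trans hu.symm)
    · rintro ⟨rfl, rfl⟩; rfl
  simp only [Finsupp.sum]
  rw [Finset.sum_eq_single u]
  · by_cases hu' : u ∈ p.coeff.support
    · rw [Finset.sum_eq_single v]
      · simp
      · intro b _ hb
        rw [if_neg]
        rw [key u hu']
        tauto
      · intro h
        simp at h
        simp [h]
    · have : p.coeff u = 0 := by simpa using hu'
      simp [this]
  · intro a ha hau
    refine Finset.sum_eq_zero fun b _ => ?_
    rw [if_neg]
    rw [key a ha]
    tauto
  · intro h
    have : p.coeff u = 0 := by simpa using h
    simp [this]

lemma prop_of_commute {N : ℕ} {p q : PA X} (hp : p ∈ P1 X ^ N) (hq : q ∈ P1 X ^ N)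
    (hq0 : q ≠ 0) (h : p * q = q * p) : ∃ s : ℚ, p = s • q := by
  obtain ⟨w, hw⟩ : ∃ w, q.coeff w ≠ 0 := by
    by_contra! h
    exact hq0 (by ext w; simp [h w])
  have hl := P1_pow_support hq w hw
  refine ⟨p.coeff w / q.coeff w, ?_⟩
  ext u
  rw [MonoidAlgebra.coeff_smul]
  by_cases hu : u.length = N
  · have h1 := coeff_mul_hom (q := q) hp w u hl
    have h2 := coeff_mul_hom (q := p) hq w u hl
    rw [h, h2] at h1
    simp only [Finsupp.smul_apply, smul_eq_mul]
    field_simp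
    linarith
  · have h1 : p.coeff u = 0 := by by_contra h'; exact hu (P1_pow_support hp u h')
    have h2 : q.coeff u = 0 := by by_contra h'; exact hu (P1_pow_support hq u h')
    simp [h1, h2]

end KP

namespace KP
variable {X Y : Type*}

noncomputable def gmap (ψ : FreeGroup X →* FreeGroup Y) : GR X →ₐ[ℚ] GR Y :=
  MonoidAlgebra.lift ℚ _ _ (el.comp ψ)

lemma gmap_el (ψ : FreeGroup X →* FreeGroup Y) (e : FreeGroup X) : gmap ψ (el e) = el (ψ e) := by
  have := MonoidAlgebra.lift_of (R := ℚ) (el.comp ψ) e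
  exact this

lemma gmap_aug (ψ : FreeGroup X →* FreeGroup Y) {r : GR X} (hr : r ∈ aug X) :
    gmap ψ r ∈ aug Y := by
  refine Submodule.span_induction (p := fun r _ => gmap ψ r ∈ aug Y) ?_ ?_ ?_ ?_ (aug_le_span hr)
  · rintro _ ⟨e, rfl⟩
    dsimp only
    rw [map_sub, gmap_el, map_one]; exact el_sub_one_mem _
  · simp
  · intro x y _ _ hx hy; rw [map_add]; exact Submodule.add_mem _ hx hy
  · intro c x _ hx; rw [map_smul]; exact Submodule.smul_mem _ _ hx

lemma gmap_Fil (ψ : FreeGroup X →* FreeGroup Y) {N : ℕ} {r : GR X} (hr : r ∈ Fil X N) :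
    gmap ψ r ∈ Fil Y N := by
  induction N generalizing r with
  | zero => exact mem_Fil_zero _
  | succ N ih =>
    refine Submodule.mul_induction_on hr ?_ ?_
    · intro m hm n hn
      rw [map_mul]
      exact Submodule.mul_mem_mul (gmap_aug ψ hm) (ih hn)
    · intro x y hx hy; rw [map_add]; exact Submodule.add_mem _ hx hy

lemma exists_ord {r : GR X} (h : ∃ k, r ∉ Fil X k) : ∃ k, r ∈ Fil X k ∧ r ∉ Fil X (k+1) := by
  classical
  have h1 := Nat.find_spec h
  have h0 : Nat.find h ≠ 0 := by
    intro h'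
    rw [h'] at h1
    exact h1 (mem_Fil_zero _)
  refine ⟨Nat.find h - 1, ?_, ?_⟩
  · have := Nat.find_min h (m := Nat.find h - 1) (by omega)
    simpa using this
  · have : Nat.find h - 1 + 1 = Nat.find h := by omega
    rwa [this]

structure Sym (N : ℕ) (r : GR X) (p : PA X) : Prop where
  h1 : r ∈ Fil X N
  h2 : p ∈ P1 X ^ N
  h3 : r - theta X p ∈ Fil X (N + 1)

lemma exists_Sym {N : ℕ} {r : GR X} (hr : r ∈ Fil X N) : ∃ p, Sym N r p := by
  obtain ⟨p, hp, h⟩ := exists_sym hr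
  exact ⟨p, hr, hp, h⟩

lemma Sym.mul {j k : ℕ} {r s : GR X} {p q : PA X} (h : Sym j r p) (h' : Sym k s q) :
    Sym (j + k) (r * s) (p * q) := by
  refine ⟨mul_mem_Fil h.h1 h'.h1, ?_, ?_⟩
  · rw [pow_add]; exact Submodule.mul_mem_mul h.h2 h'.h2
  · have e : r * s - theta X (p * q) = (r - theta X p) * s + theta X p * (s - theta X q) := by
      rw [map_mul]; noncomm_ring
    rw [e]
    refine Submodule.add_mem _ ?_ ?_
    · have := mul_mem_Fil h.h3 h'.h1
      rwa [show j + 1 + k = j + k + 1 by omega] at this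
    · exact mul_mem_Fil (j := j) (k := k + 1) (theta_mem h.h2) h'.h3

lemma Sym.sub {j : ℕ} {r s : GR X} {p q : PA X} (h : Sym j r p) (h' : Sym j s q) :
    Sym j (r - s) (p - q) := by
  refine ⟨Submodule.sub_mem _ h.h1 h'.h1, Submodule.sub_mem _ h.h2 h'.h2, ?_⟩
  have := Submodule.sub_mem _ h.h3 h'.h3
  convert this using 1
  rw [map_sub]; abel

lemma Sym.smul {j : ℕ} {r : GR X} {p : PA X} (h : Sym j r p) (c : ℚ) :
    Sym j (c • r) (c • p) := by
  refine ⟨Submodule.smul_mem _ _ h.h1, Submodule.smul_mem _ _ h.h2, ?_⟩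
  have := Submodule.smul_mem _ c h.h3
  rwa [smul_sub, ← map_smul] at this

lemma Sym.one : Sym 0 (1 : GR X) 1 := by
  refine ⟨mem_Fil_zero _, ?_, ?_⟩
  · rw [pow_zero]; exact Submodule.one_le.1 le_rfl
  · rw [map_one, sub_self]; exact Submodule.zero_mem _

lemma Sym.pow {j : ℕ} {r : GR X} {p : PA X} (h : Sym j r p) (k : ℕ) :
    Sym (j * k) (r ^ k) (p ^ k) := by
  induction k with
  | zero => simpa using Sym.one
  | succ k ih => rw [pow_succ, pow_succ, Nat.mul_succ]; exact ih.mul h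

lemma Sym.mem_iff {j : ℕ} {r : GR X} {p : PA X} (h : Sym j r p) : r ∈ Fil X (j+1) ↔ p = 0 := by
  constructor
  · intro hr
    apply sym_unique h.h2
    have := Submodule.sub_mem _ hr h.h3
    rwa [sub_sub_cancel] at this
  · rintro rfl
    have := h.h3
    rwa [map_zero, sub_zero] at this

lemma comm_lemma (ρ : FreeGroup X →* FreeGroup X) {β γ : GR X} {k N : ℕ} (hk : 1 ≤ k)
    (hρβ : gmap ρ β = β) (hβ : β ∈ Fil X k) (hβ' : β ∉ Fil X (k+1)) (hγ : γ ∈ Fil X 1)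
    (hc : γ * β - β * γ ∈ Fil X N) (hργ : gmap ρ γ ∈ Fil X N) : γ ∈ Fil X (N - k) := by
  obtain ⟨b, hb⟩ := exists_Sym hβ
  have hb0 : b ≠ 0 := fun h => hβ' (hb.mem_iff.2 h)
  have key : ∀ j, j + 1 ≤ N - k → γ ∈ Fil X (j+1) := by
    intro j
    induction j with
    | zero => intro _; exact hγ
    | succ j ih =>
      intro hj
      have hγj := ih (by omega)
      obtain ⟨g, hg⟩ := exists_Sym hγj
      have hcomm : g * b = b * g := by
        have h1 := hg.mul hb
        have h2 := hb.mul hg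
        rw [add_comm k] at h2
        have h3 := (h1.sub h2).mem_iff.1 (Fil_anti (by omega) hc)
        exact sub_eq_zero.1 h3
      have hgk := hg.pow k
      have hbj := hb.pow (j+1)
      rw [mul_comm k] at hbj
      obtain ⟨s, hs⟩ := prop_of_commute hgk.h2 hbj.h2 (pow_ne_zero _ hb0)
        (Commute.pow_pow hcomm _ _).eq
      have h4 : γ ^ k - s • β ^ (j+1) ∈ Fil X ((j+1)*k+1) := by
        rw [(hgk.sub (hbj.smul s)).mem_iff, hs, sub_self]
      have h5 := gmap_Fil ρ h4
      rw [map_sub, map_smul, map_pow, map_pow, hρβ] at h5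
      have h6 : (gmap ρ γ)^k ∈ Fil X ((j+1)*k+1) := by
        refine Fil_anti ?_ (pow_mem_Fil (Fil_anti (show j+2 ≤ N by omega) hργ) k)
        nlinarith
      have h7 := Submodule.sub_mem _ h6 h5
      rw [sub_sub_cancel] at h7
      have h8 := (hbj.smul s).mem_iff.1 h7
      rw [h8] at hs
      have h9 : g = 0 := pow_eq_zero_iff (by omega) |>.1 hs
      exact hg.mem_iff.2 h9
  rcases Nat.eq_zero_or_pos (N - k) with h | h
  · rw [h]; exact mem_Fil_zero _
  · have := key (N - k - 1) (by omega)
    rwa [show N - k - 1 + 1 = N - k by omega] at this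

section hab
variable [DecidableEq X]

/-- exponent vector -/
noncomputable def hab (e : FreeGroup X) : X → ℚ :=
  (FreeGroup.lift (fun j => Multiplicative.ofAdd (Pi.single j 1 : X → ℚ)) e).toAdd

lemma hab_mul (a b : FreeGroup X) : hab (a * b) = hab a + hab b := by
  simp [hab]

lemma hab_one : hab (1 : FreeGroup X) = 0 := by simp [hab]

lemma hab_inv (a : FreeGroup X) : hab (a⁻¹) = - hab a := by simp [hab]

lemma hab_of (i : X) : hab (FreeGroup.of i) = Pi.single i 1 := by simp [hab]

noncomputable def plin (X : Type*) [Fintype X] : (X → ℚ) →ₗ[ℚ] PA X where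
  toFun v := ∑ i, v i • vr i
  map_add' u v := by simp [add_smul, Finset.sum_add_distrib]
  map_smul' c v := by simp [mul_smul, Finset.smul_sum]

lemma plin_single [Fintype X] (i : X) : plin X (Pi.single i 1) = vr i := by
  simp [plin, Pi.single_apply, ite_smul]

lemma plin_mem [Fintype X] (v : X → ℚ) : plin X v ∈ P1 X :=
  Submodule.sum_mem _ fun i _ => Submodule.smul_mem _ _ (vr_mem i)

lemma Sym_el [Fintype X] (e : FreeGroup X) : Sym 1 (el e - 1) (plin X (hab e)) := by
  have hm : ∀ e : FreeGroup X, el e - 1 ∈ Fil X 1 := fun e => by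
    rw [Fil_one]; exact el_sub_one_mem e
  have h3 : el e - 1 - theta X (plin X (hab e)) ∈ Fil X 2 := by
    induction e using FreeGroup.induction_on with
    | C1 => rw [hab_one]; simp
    | of i => rw [hab_of, plin_single, theta_vr, sub_self]; exact Submodule.zero_mem _
    | inv_of i hi =>
      have h : el (FreeGroup.of i)⁻¹ - 1 - theta X (plin X (hab (FreeGroup.of i)⁻¹)) =
          -(el (FreeGroup.of i) - 1 - theta X (plin X (hab (FreeGroup.of i))))
          - (el (FreeGroup.of i) - 1) * (el (FreeGroup.of i)⁻¹ - 1) := by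
        have : el (FreeGroup.of i) * el (FreeGroup.of i)⁻¹ = 1 := by
          rw [← map_mul, mul_inv_cancel, map_one]
        rw [hab_inv, map_neg, map_neg, sub_mul, mul_sub, this]; noncomm_ring
      rw [h]
      exact Submodule.sub_mem _ (Submodule.neg_mem _ hi) (mul_mem_Fil (hm _) (hm _))
    | mul x y hx hy =>
      have h : el (x * y) - 1 - theta X (plin X (hab (x * y))) =
          (el x - 1 - theta X (plin X (hab x))) + (el y - 1 - theta X (plin X (hab y)))
            + (el x - 1) * (el y - 1) := by
        rw [map_mul, hab_mul, map_add, map_add]; noncomm_ring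
      rw [h]
      exact Submodule.add_mem _ (Submodule.add_mem _ hx hy) (mul_mem_Fil (hm _) (hm _))
  exact ⟨hm e, by rw [pow_one]; exact plin_mem _, h3⟩

lemma el_sub_one_mem_two [Fintype X] {e : FreeGroup X} (h : hab e = 0) : el e - 1 ∈ Fil X 2 := by
  rw [(Sym_el e).mem_iff, h, map_zero]

/-- Lemma J -/
lemma injective_of_hab [Fintype X] [Fintype Y] [DecidableEq Y] [Nontrivial Y]
    (ψ : FreeGroup Y →* FreeGroup X)
    (hli : LinearIndependent ℚ (fun y => hab (ψ (FreeGroup.of y)))) : Function.Injective ψ := by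
  have hinj : Function.Injective (Fintype.linearCombination ℚ (fun y => hab (ψ (FreeGroup.of y)))) :=
    LinearIndependent.fintypeLinearCombination_injective hli
  obtain ⟨L, hL⟩ := LinearMap.exists_leftInverse_of_injective
    (Fintype.linearCombination ℚ (fun y => hab (ψ (FreeGroup.of y)))) (LinearMap.ker_eq_bot.2 hinj)
  have hLy : ∀ y, L (hab (ψ (FreeGroup.of y))) = Pi.single y 1 := by
    intro y
    have := DFunLike.congr_fun hL (Pi.single y 1)
    simpa [Fintype.linearCombination_apply, Pi.single_apply, ite_smul] using this
  let T : PA Y →ₐ[ℚ] PA X := alift fun y => plin X (hab (ψ (FreeGroup.of y)))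
  let S : PA X →ₐ[ℚ] PA Y := alift fun i => plin Y (L (Pi.single i 1))
  have hSlin : ∀ v, S (plin X v) = plin Y (L v) := by
    intro v
    have : S.toLinearMap ∘ₗ plin X = plin Y ∘ₗ L := by
      apply LinearMap.pi_ext'
      intro i
      ext1
      change S (plin X (Pi.single i 1)) = plin Y (L (Pi.single i 1))
      rw [plin_single, alift_vr]
    exact DFunLike.congr_fun this v
  have hST : ∀ p, S (T p) = p := by
    intro p
    have : S.comp T = AlgHom.id ℚ _ := by
      apply alift_hom_ext
      intro y
      rw [AlgHom.comp_apply, alift_vr, hSlin, hLy, plin_single]; rfl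
    exact DFunLike.congr_fun this p
  have hSym1 : ∀ p ∈ P1 Y, Sym 1 (gmap ψ (theta Y p)) (T p) := by
    intro p hp
    refine Submodule.span_induction (p := fun p _ => Sym 1 (gmap ψ (theta Y p)) (T p)) ?_ ?_ ?_ ?_ hp
    · rintro _ ⟨y, rfl⟩
      have : Sym 1 (gmap ψ (theta Y (vr y))) (T (vr y)) := by
        rw [theta_vr, alift_vr, map_sub, gmap_el, map_one]
        exact Sym_el _
      exact this
    · simpa using (Sym_el (1 : FreeGroup X)).smul 0
    · intro x y _ _ hx hy
      have := hx.sub (hy.smul (-1))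
      simpa using this
    · intro c x _ hx
      have := hx.smul c
      simpa using this
  have hSymN : ∀ N, ∀ p ∈ P1 Y ^ N, Sym N (gmap ψ (theta Y p)) (T p) := by
    intro N
    induction N with
    | zero =>
      intro p hp
      rw [pow_zero] at hp
      obtain ⟨c, rfl⟩ := Submodule.mem_one.1 hp
      rw [AlgHom.commutes, AlgHom.commutes, AlgHom.commutes, Algebra.algebraMap_eq_smul_one,
        Algebra.algebraMap_eq_smul_one]
      exact Sym.one.smul c
    | succ N ih =>
      intro p hp
      rw [pow_succ] at hp
      refine Submodule.mul_induction_on hp ?_ ?_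
      · intro m hm n hn
        rw [map_mul, map_mul, map_mul]
        exact (ih m hm).mul (hSym1 n hn)
      · intro x y hx hy
        have := hx.sub (hy.smul (-1))
        simpa using this
  rw [injective_iff_map_eq_one]
  intro y hy
  by_contra hne
  obtain ⟨k, hk, hk'⟩ := exists_ord (r := el y - 1) (by
    by_contra! h
    exact hne (eq_one_of_mem_Fil h))
  obtain ⟨p, hp⟩ := exists_Sym hk
  apply hk'
  rw [hp.mem_iff]
  have h1 := hSymN k p hp.h2
  have h2 := gmap_Fil ψ hp.h3
  rw [map_sub, map_sub, gmap_el, hy, map_one, map_one, sub_self, zero_sub] at h2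
  have h3 := h1.mem_iff.1 (by simpa using h2)
  rw [← hST p, h3, map_zero]

end hab
end KP

namespace KP
variable {X Y : Type*}

lemma exists_root_poly (m : ℕ) (hm : 1 ≤ m) (N : ℕ) : ∃ p : Polynomial ℚ,
    Polynomial.X ∣ p - 1 ∧ Polynomial.X ^ (N+1) ∣ p ^ m - (1 + Polynomial.X) := by
  induction N with
  | zero => exact ⟨1, by simp, by simp⟩
  | succ N ih =>
    obtain ⟨p, ⟨a, ha⟩, q, hq⟩ := ih
    obtain ⟨k, hk⟩ := Polynomial.powAddExpansion p
      (Polynomial.C (-(q.eval 0) / m) * Polynomial.X ^ (N+1)) m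
    refine ⟨p + Polynomial.C (-(q.eval 0) / m) * Polynomial.X ^ (N+1), ?_, ?_⟩
    · refine ⟨a + Polynomial.C (-(q.eval 0) / m) * Polynomial.X ^ N, ?_⟩
      rw [mul_add, ← ha]; ring
    · have hp0 : p.eval 0 = 1 := by
        have := congrArg (Polynomial.eval 0) ha
        simp at this
        linarith
      have hm0 : (m : ℚ) ≠ 0 := by exact_mod_cast (by omega : m ≠ 0)
      have hd : Polynomial.X ∣ q + (m : Polynomial ℚ) * p ^ (m-1) * Polynomial.C (-(q.eval 0) / m) := by
        rw [Polynomial.X_dvd_iff, Polynomial.coeff_zero_eq_eval_zero]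
        simp [hp0]
        field_simp; ring
      obtain ⟨b, hb⟩ := hd
      have e : (p + Polynomial.C (-(q.eval 0) / m) * Polynomial.X ^ (N+1)) ^ m - (1 + Polynomial.X)
          = Polynomial.X ^ (N+1) * (q + (m : Polynomial ℚ) * p ^ (m-1) * Polynomial.C (-(q.eval 0) / m))
            + Polynomial.X ^ (N+1+1) * (k * Polynomial.C (-(q.eval 0) / m)^2 * Polynomial.X ^ N) := by
        rw [hk]
        have : p ^ m = (1 + Polynomial.X) + Polynomial.X ^ (N + 1) * q := by rw [← hq]; ring
        rw [this]; ring
      rw [e, hb]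
      refine dvd_add ⟨b, by ring⟩ (dvd_mul_right _ _)

lemma exists_inv_poly (p : Polynomial ℚ) (hp : Polynomial.X ∣ p - 1) (N : ℕ) :
    ∃ p' : Polynomial ℚ, Polynomial.X ^ N ∣ p * p' - 1 := by
  obtain ⟨a, ha⟩ := hp
  have h1 : IsCoprime p Polynomial.X := ⟨1, -a, by rw [one_mul]; linear_combination ha⟩
  obtain ⟨u, v, huv⟩ := h1.pow_right (n := N)
  exact ⟨u, -v, by linear_combination huv⟩

lemma aeval_mem {κ : GR X} (hκ : κ ∈ Fil X 1) {N : ℕ} {q : Polynomial ℚ}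
    (h : Polynomial.X ^ N ∣ q) : Polynomial.aeval κ q ∈ Fil X N := by
  obtain ⟨a, rfl⟩ := h
  rw [map_mul, map_pow, Polynomial.aeval_X]
  apply mul_mem_Fil_right
  have := pow_mem_Fil hκ N
  rwa [one_mul] at this

/-- the congruence modulo `Fil N` -/
def cN (X : Type*) (N : ℕ) : RingCon (GR X) where
  r a b := a - b ∈ Fil X N
  iseqv := ⟨fun a => by rw [sub_self]; exact Submodule.zero_mem _,
    fun {a b} h => by have := Submodule.neg_mem _ h; rwa [neg_sub] at this,
    fun {a b c} h h' => by have := Submodule.add_mem _ h h'; rwa [sub_add_sub_cancel] at this⟩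
  add' {a b c d} h h' := by
    have := Submodule.add_mem _ h h'
    rwa [sub_add_sub_comm] at this
  mul' {a b c d} h h' := by
    have := Submodule.add_mem _ (mul_mem_Fil_right c h) (mul_mem_Fil_left b h')
    rw [sub_mul, mul_sub] at this
    simpa using this

noncomputable def piN (X : Type*) (N : ℕ) : GR X →+* (cN X N).Quotient := (cN X N).mk'

lemma piN_eq {N : ℕ} {a b : GR X} : piN X N a = piN X N b ↔ a - b ∈ Fil X N :=
  (cN X N).eq

lemma piN_eq_zero {N : ℕ} {a : GR X} : piN X N a = 0 ↔ a ∈ Fil X N := by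
  rw [← map_zero (piN X N), piN_eq, sub_zero]

lemma filter_lemma (T : Module.End ℚ (GR X)) (h1 : ∀ j, ∀ r ∈ Fil X j, T r - r ∈ Fil X (j+1))
    {m N : ℕ} (hm : 1 ≤ m) (h2 : ∀ r, (T ^ m) r - r ∈ Fil X N) (r : GR X) : T r - r ∈ Fil X N := by
  have key : ∀ j, j ≤ N → ∀ r, T r - r ∈ Fil X j := by
    intro j
    induction j with
    | zero => intro _ r; exact mem_Fil_zero _
    | succ j ih =>
      intro hj r
      have ih' := ih (by omega)
      have h3 : ∀ k : ℕ, (T ^ k) r - r - (k : ℚ) • (T r - r) ∈ Fil X (j+1) := by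
        intro k
        induction k with
        | zero => simp
        | succ k ihk =>
          have e : (T ^ (k+1)) r - r - ((k+1 : ℕ) : ℚ) • (T r - r) =
            (T ((T ^ k) r - r) - ((T ^ k) r - r)) + ((T ^ k) r - r - (k : ℚ) • (T r - r)) := by
            rw [pow_succ', Module.End.mul_apply, map_sub]
            push_cast
            module
          rw [e]
          refine Submodule.add_mem _ (h1 j _ ?_) ihk
          have := Submodule.add_mem _ (Fil_anti (Nat.le_succ j) ihk)
            (Submodule.smul_mem _ (k : ℚ) (ih' r))
          rwa [sub_add_cancel] at this
      have h4 := Submodule.sub_mem _ (Fil_anti hj (h2 r)) (h3 m)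
      rw [sub_sub_cancel] at h4
      have hm0 : (m : ℚ) ≠ 0 := by exact_mod_cast (by omega : m ≠ 0)
      exact (Submodule.smul_mem_iff _ hm0).1 h4
  exact key N le_rfl r

/-- malnormality of retracts -/
lemma retract_malnormal [Nontrivial X] (ρ : FreeGroup X →* FreeGroup X) (hρ : ∀ e, ρ (ρ e) = ρ e)
    {y g : FreeGroup X} (hy : ρ y = y) (hy1 : y ≠ 1) (hg : ρ (g * y * g⁻¹) = g * y * g⁻¹) :
    ρ g = g := by
  obtain ⟨k, hk, hk'⟩ := exists_ord (r := el y - 1) (by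
    by_contra! h
    exact hy1 (eq_one_of_mem_Fil h))
  have hk1 : 1 ≤ k := by
    by_contra h
    have : k = 0 := by omega
    subst this
    apply hk'
    rw [zero_add, Fil_one]; exact el_sub_one_mem y
  have hc : (ρ g)⁻¹ * g * y = y * ((ρ g)⁻¹ * g) := by
    rw [map_mul, map_mul, map_inv, hy] at hg
    calc (ρ g)⁻¹ * g * y = (ρ g)⁻¹ * (g * y * g⁻¹) * g := by group
      _ = y * ((ρ g)⁻¹ * g) := by rw [← hg]; group
  have h1 : (ρ g)⁻¹ * g = 1 := by
    apply eq_one_of_mem_Fil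
    intro N
    have := comm_lemma ρ (β := el y - 1) (γ := el ((ρ g)⁻¹ * g) - 1) (k := k) (N := N + k) hk1
      (by rw [map_sub, gmap_el, hy, map_one]) hk hk' (by rw [Fil_one]; exact el_sub_one_mem _)
      (by
        have e : (el ((ρ g)⁻¹ * g) - 1) * (el y - 1) - (el y - 1) * (el ((ρ g)⁻¹ * g) - 1) =
          el ((ρ g)⁻¹ * g) * el y - el y * el ((ρ g)⁻¹ * g) := by noncomm_ring
        rw [e, ← map_mul, ← map_mul, hc, sub_self]; exact Submodule.zero_mem _)
      (by
        rw [map_sub, gmap_el, map_mul, map_inv, hρ, inv_mul_cancel, map_one, map_one, sub_self]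
        exact Submodule.zero_mem _)
    rwa [Nat.add_sub_cancel] at this
  exact inv_mul_eq_one.1 h1

lemma gmap_sub_mem [Fintype X] [DecidableEq X] (φ : FreeGroup X →* FreeGroup X)
    (hφ : ∀ e, hab (φ e) = hab e) : ∀ j, ∀ r ∈ Fil X j, gmap φ r - r ∈ Fil X (j+1) := by
  have h1 : ∀ r ∈ aug X, gmap φ r - r ∈ Fil X 2 := by
    intro r hr
    refine Submodule.span_induction (p := fun r _ => gmap φ r - r ∈ Fil X 2) ?_ ?_ ?_ ?_ (aug_le_span hr)
    · rintro _ ⟨e, rfl⟩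
      dsimp only
      have e1 : gmap φ (el e - 1) - (el e - 1) = (el (φ e * e⁻¹) - 1) * el e := by
        rw [map_sub, gmap_el, map_one, sub_mul, ← map_mul, inv_mul_cancel_right]; noncomm_ring
      rw [e1]
      apply mul_mem_Fil_right
      apply el_sub_one_mem_two
      rw [hab_mul, hab_inv, hφ, add_neg_cancel]
    · simp
    · intro x y _ _ hx hy
      have := Submodule.add_mem _ hx hy
      rwa [sub_add_sub_comm, ← map_add] at this
    · intro c x _ hx
      rw [map_smul, ← smul_sub]; exact Submodule.smul_mem _ _ hx
  intro j
  induction j with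
  | zero =>
    intro r _
    have hr' : r - algebraMap ℚ (GR X) (eps X r) ∈ aug X := by
      rw [mem_aug, map_sub, AlgHom.commutes]; simp
    have := h1 _ hr'
    rw [map_sub, AlgHom.commutes] at this
    have h := Fil_anti (show 0 + 1 ≤ 2 by omega) this
    simpa using h
  | succ j ih =>
    intro r hr
    refine Submodule.mul_induction_on hr ?_ ?_
    · intro m hm n hn
      have e : gmap φ (m * n) - m * n = (gmap φ m - m) * gmap φ n + m * (gmap φ n - n) := by
        rw [map_mul]; noncomm_ring
      rw [e]
      refine Submodule.add_mem _ ?_ ?_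
      · have := mul_mem_Fil (h1 m hm) (gmap_Fil φ hn)
        rwa [show 2 + j = j + 1 + 1 by omega] at this
      · rw [← Fil_one] at hm
        have := mul_mem_Fil hm (ih n hn)
        rwa [show 1 + (j + 1) = j + 1 + 1 by omega] at this
    · intro x y hx hy
      have := Submodule.add_mem _ hx hy
      rwa [sub_add_sub_comm, ← map_add] at this

/-- D-lemma -/
lemma torelli_lemma [Fintype X] [DecidableEq X] [Nontrivial X] (ρ φ : FreeGroup X →* FreeGroup X)
    (hρ : ∀ e, ρ (ρ e) = ρ e) (hφ : ∀ e, hab (φ e) = hab e) (f : FreeGroup X) (m : ℕ) (hm : 1 ≤ m)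
    (hφm : ∀ e, φ^[m] e = f * e * f⁻¹) (hf : φ f = f)
    {y : FreeGroup X} (hy : ρ y = y) (hy1 : y ≠ 1) (hφy : ρ (φ y) = φ y)
    (u : FreeGroup X) (hu : ρ u = u) : ρ (φ u) = φ u := by
  obtain ⟨k, hk, hk'⟩ := exists_ord (r := el y - 1) (by
    by_contra! h
    exact hy1 (eq_one_of_mem_Fil h))
  have hk1 : 1 ≤ k := by
    by_contra h
    have : k = 0 := by omega
    subst this
    apply hk'
    rw [zero_add, Fil_one]; exact el_sub_one_mem y
  apply eq_of_mem_Fil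
  intro N0
  -- work modulo `Fil N`
  obtain ⟨N, hN⟩ : ∃ N, N = N0 + k + 1 := ⟨_, rfl⟩
  obtain ⟨p, hp1, hp2⟩ := exists_root_poly m hm N
  obtain ⟨p', hp'⟩ := exists_inv_poly p hp1 N
  replace hp2 := (pow_dvd_pow Polynomial.X (Nat.le_succ N)).trans hp2
  have hκ : ∀ e : FreeGroup X, el e - 1 ∈ Fil X 1 := fun e => by rw [Fil_one]; exact el_sub_one_mem e
  set κ : GR X := el f - 1 with hκdef
  set w : GR X := Polynomial.aeval κ p with hw
  set w' : GR X := Polynomial.aeval κ p' with hw'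
  have hκ1 : κ ∈ Fil X 1 := hκ f
  have hφκ : gmap φ κ = κ := by rw [hκdef, map_sub, gmap_el, hf, map_one]
  have hφw : gmap φ w = w := by rw [hw, ← Polynomial.aeval_algHom_apply, hφκ]
  have hφw' : gmap φ w' = w' := by rw [hw', ← Polynomial.aeval_algHom_apply, hφκ]
  have hww' : piN X N (w * w') = 1 := by
    rw [← map_one (piN X N), piN_eq]
    have := aeval_mem hκ1 hp'
    rwa [map_sub, map_mul, map_one] at this
  have hw'w : piN X N (w' * w) = 1 := by
    have e : w' * w = w * w' := by rw [hw, hw', ← map_mul, ← map_mul, mul_comm]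
    rw [e, hww']
  have hwm : piN X N (w ^ m) = piN X N (el f) := by
    rw [piN_eq]
    have := aeval_mem hκ1 hp2
    rw [map_sub, map_pow, map_add, map_one, Polynomial.aeval_X] at this
    rwa [hκdef, add_sub_cancel] at this
  have hw1 : w - 1 ∈ Fil X 1 := by
    have := aeval_mem (N := 1) hκ1 (by rwa [pow_one] : Polynomial.X ^ 1 ∣ p - 1)
    rwa [map_sub, map_one] at this
  have hN1 : 1 ≤ N := by omega
  have hw'w1 : w' * w - 1 ∈ Fil X 1 := by
    rw [← map_one (piN X N), piN_eq] at hw'w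
    exact Fil_anti hN1 hw'w
  let T : Module.End ℚ (GR X) :=
    (LinearMap.mulLeft ℚ w') ∘ₗ (LinearMap.mulRight ℚ w) ∘ₗ (gmap φ).toLinearMap
  have hT : ∀ r, T r = w' * (gmap φ r * w) := fun r => rfl
  have hTpow : ∀ (n : ℕ) (r : GR X), (T ^ n) r = w' ^ n * ((gmap φ)^[n] r * w ^ n) := by
    intro n
    induction n with
    | zero => intro r; simp
    | succ n ih =>
      intro r
      rw [pow_succ', Module.End.mul_apply, ih, hT, map_mul, map_mul, map_pow, map_pow, hφw, hφw',
        Function.iterate_succ_apply', pow_succ', pow_succ]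
      simp only [mul_assoc]
  have hiter : ∀ r, (gmap φ)^[m] r = el f * r * el f⁻¹ := by
    have h0 : ∀ (n : ℕ) (e : FreeGroup X), (gmap φ)^[n] (el e) = el (φ^[n] e) := by
      intro n e
      induction n with
      | zero => rfl
      | succ n ih => rw [Function.iterate_succ_apply', ih, gmap_el, Function.iterate_succ_apply']
    intro r
    have e1 : (gmap φ)^[m] r = ((gmap φ).toLinearMap ^ m) r := by
      rw [Module.End.pow_apply]; rfl
    have e2 : el f * r * el f⁻¹ = ((LinearMap.mulRight ℚ (el f⁻¹)) ∘ₗ (LinearMap.mulLeft ℚ (el f))) r := rfl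
    induction r using MonoidAlgebra.induction_linear with
    | zero => rw [e1]; simp
    | add a b ha hb => 
      rw [Module.End.pow_apply, AlgHom.coe_toLinearMap] at *
      have ha' := ha rfl rfl
      have hb' := hb rfl rfl
      rw [iterate_map_add, ha', hb']; noncomm_ring
    | single a c =>
      have h1 : (MonoidAlgebra.single a c : GR X) = c • el a := by
        simp [el, MonoidAlgebra.of]
      rw [e1, h1, map_smul, Module.End.pow_apply, AlgHom.coe_toLinearMap, h0, hφm, map_mul, map_mul]
      simp
  have hTid : ∀ r, T r - r ∈ Fil X N := by
    apply filter_lemma T _ hm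
    · intro r
      rw [← piN_eq, hTpow, hiter]
      have a1 : piN X N (w' ^ m) * piN X N (el f) = 1 := by
        rw [← hwm, map_pow, map_pow, ← Commute.mul_pow, ← map_mul, hw'w, one_pow]
        exact (map_mul _ _ _).symm.trans (hw'w.trans (hww'.symm.trans (map_mul _ _ _)))
      have a2 : piN X N (el f⁻¹) * piN X N (w ^ m) = 1 := by
        rw [hwm, ← map_mul, ← map_mul, inv_mul_cancel, map_one, map_one]
      rw [map_mul, map_mul, map_mul, map_mul]
      calc piN X N (w' ^ m) * (piN X N (el f) * piN X N r * piN X N (el f⁻¹) * piN X N (w ^ m))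
          = (piN X N (w' ^ m) * piN X N (el f)) * piN X N r * (piN X N (el f⁻¹) * piN X N (w ^ m)) := by
            simp only [mul_assoc]
        _ = piN X N r := by rw [a1, a2, one_mul, mul_one]
    · intro j r hr
      have h1 := gmap_sub_mem φ hφ j r hr
      have e : T r - r = w' * (gmap φ r - r) * w + (w' * r * (w - 1) - w' * (w - 1) * r)
          + (w' * w - 1) * r := by
        rw [hT]; noncomm_ring
      rw [e]
      refine Submodule.add_mem _ (Submodule.add_mem _ ?_ (Submodule.sub_mem _ ?_ ?_)) ?_
      · exact mul_mem_Fil_right _ (mul_mem_Fil_left _ h1)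
      · exact mul_mem_Fil (mul_mem_Fil_left _ hr) hw1
      · rw [mul_assoc, add_comm j]; exact mul_mem_Fil_left _ (mul_mem_Fil hw1 hr)
      · rw [add_comm j]; exact mul_mem_Fil hw'w1 hr
  have hmain : ∀ r, piN X N (gmap φ r * w) = piN X N (w * r) := by
    intro r
    have := piN_eq.2 (hTid r)
    rw [hT] at this
    calc piN X N (gmap φ r * w) = piN X N (w * w') * piN X N (gmap φ r * w) := by rw [hww', one_mul]
      _ = piN X N w * piN X N (w' * (gmap φ r * w)) := by
          rw [map_mul (piN X N) w w', map_mul (piN X N) w' (gmap φ r * w), mul_assoc]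
      _ = _ := by rw [this, map_mul]
  -- apply the retraction
  have hρN : ∀ {n : ℕ} {a b : GR X}, piN X n a = piN X n b → piN X n (gmap ρ a) = piN X n (gmap ρ b) := by
    intro n a b h
    rw [piN_eq] at *
    rw [← map_sub]; exact gmap_Fil ρ h
  set v := gmap ρ w with hv
  set v' := gmap ρ w' with hv'
  have hρel : ∀ e : FreeGroup X, ρ e = e → gmap ρ (el e) = el e := fun e he => by rw [gmap_el, he]
  have hvv' : piN X N v * piN X N v' = 1 := by
    have := hρN (a := w * w') (b := 1) (by rw [hww', map_one])
    rwa [map_mul, map_mul, map_one, map_one] at this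
  have hv'v : piN X N v' * piN X N v = 1 := by
    have := hρN (a := w' * w) (b := 1) (by rw [hw'w, map_one])
    rwa [map_mul, map_mul, map_one, map_one] at this
  have hρρ : ∀ r, gmap ρ (gmap ρ r) = gmap ρ r := by
    intro r
    have : (gmap ρ).comp (gmap ρ) = gmap ρ := by
      apply (MonoidAlgebra.lift ℚ _ _).symm.injective
      ext1 i
      change gmap ρ (gmap ρ (el (FreeGroup.of i))) = gmap ρ (el (FreeGroup.of i))
      rw [gmap_el, gmap_el, hρ]
    exact DFunLike.congr_fun this r
  have hwy : piN X N (el (φ y)) * piN X N w = piN X N w * piN X N (el y) := by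
    have := hmain (el y)
    rwa [gmap_el, map_mul, map_mul] at this
  have hvy : piN X N (el (φ y)) * piN X N v = piN X N v * piN X N (el y) := by
    have := hρN (hmain (el y))
    rwa [gmap_el, map_mul (gmap ρ), map_mul (piN X N), hρel _ hφy, map_mul (gmap ρ) w, map_mul (piN X N), hρel _ hy] at this
  have hcy : piN X N (v' * w * el y) = piN X N (el y * (v' * w)) := by
    have e1 : piN X N v' * piN X N (el (φ y)) = piN X N (el y) * piN X N v' := by
      calc piN X N v' * piN X N (el (φ y)) = piN X N v' * (piN X N (el (φ y)) * piN X N v) * piN X N v' := by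
            rw [mul_assoc, mul_assoc, hvv', mul_one]
        _ = (piN X N v' * piN X N v) * piN X N (el y) * piN X N v' := by rw [hvy]; simp only [mul_assoc]
        _ = _ := by rw [hv'v, one_mul]
    rw [map_mul, map_mul, map_mul, map_mul, mul_assoc, ← hwy, ← mul_assoc, e1, mul_assoc]
  have hv1 : v - 1 ∈ Fil X 1 := by
    have := gmap_Fil ρ hw1
    rwa [map_sub, map_one] at this
  have hv'v1 : v' * v - 1 ∈ Fil X 1 := by
    have := gmap_Fil ρ hw'w1
    rwa [map_sub, map_one, map_mul] at this
  have hγ := comm_lemma ρ (β := el y - 1) (γ := v' * w - 1) (k := k) (N := N) hk1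
      (by rw [map_sub, gmap_el, hy, map_one]) hk hk'
      (by
        have e : v' * w - 1 = v' * (w - 1) - v' * (v - 1) + (v' * v - 1) := by noncomm_ring
        rw [e]
        exact Submodule.add_mem _ (Submodule.sub_mem _ (mul_mem_Fil_left _ hw1)
          (mul_mem_Fil_left _ hv1)) hv'v1)
      (by
        have e : (v' * w - 1) * (el y - 1) - (el y - 1) * (v' * w - 1) =
          v' * w * el y - el y * (v' * w) := by noncomm_ring
        rw [e, ← piN_eq]; exact hcy)
      (by
        rw [map_sub, map_mul, map_one, hv', hρρ, ← map_mul, ← map_one (gmap ρ), ← map_sub]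
        apply gmap_Fil
        rw [← piN_eq, hw'w, map_one])
  -- conclusion modulo `Fil N0`
  have hle : N0 ≤ N - k := by omega
  have hle' : N0 ≤ N := by omega
  have lift0 : ∀ {a b : GR X}, piN X N a = piN X N b → piN X N0 a = piN X N0 b := by
    intro a b h
    rw [piN_eq] at *
    exact Fil_anti hle' h
  have hγ0 : piN X N0 (v' * w) = 1 := by
    rw [← map_one (piN X N0), piN_eq]; exact Fil_anti hle hγ
  have hvv0 : piN X N0 (v * v') = 1 := by
    rw [← map_one (piN X N0)]
    apply lift0
    rw [map_mul, hvv', map_one]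
  have hwv : piN X N0 w = piN X N0 v := by
    calc piN X N0 w = piN X N0 (v * v') * piN X N0 w := by rw [hvv0, one_mul]
      _ = piN X N0 v * piN X N0 (v' * w) := by rw [map_mul, map_mul, mul_assoc]
      _ = _ := by rw [hγ0, mul_one]
  have hwu : piN X N0 (el (φ u)) * piN X N0 w = piN X N0 w * piN X N0 (el u) := by
    have := lift0 (hmain (el u))
    rwa [gmap_el, map_mul, map_mul] at this
  have hvu : piN X N0 (el (ρ (φ u))) * piN X N0 v = piN X N0 v * piN X N0 (el u) := by
    have := lift0 (hρN (hmain (el u)))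
    rwa [gmap_el, map_mul (gmap ρ), map_mul (piN X N0), gmap_el, map_mul (gmap ρ) w, map_mul (piN X N0), hρel _ hu] at this
  rw [← piN_eq]
  calc piN X N0 (el (ρ (φ u))) = piN X N0 (el (ρ (φ u))) * piN X N0 v * piN X N0 v' := by
        rw [mul_assoc, ← map_mul (piN X N0) v, hvv0, mul_one]
    _ = piN X N0 (el (φ u)) * piN X N0 v * piN X N0 v' := by
        rw [hvu, ← hwv, ← hwu]
    _ = _ := by rw [mul_assoc, ← map_mul (piN X N0) v, hvv0, mul_one]

end KP

namespace KP

/-! ### Induced maps on rational abelianizations -/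
section ind
variable {X Y Z : Type*} [Fintype X] [DecidableEq X] [Fintype Y] [DecidableEq Y]
  [Fintype Z] [DecidableEq Z]

lemma hab_ext {W : Type*} [AddCommGroup W] [Module ℚ W] {f g : (X → ℚ) →ₗ[ℚ] W}
    (h : ∀ e : FreeGroup X, f (hab e) = g (hab e)) : f = g := by
  apply LinearMap.pi_ext'
  intro i
  ext
  have := h (FreeGroup.of i)
  rw [hab_of] at this
  simpa using this

lemma hab_univ {W : Type*} [AddCommGroup W] [Module ℚ W] (h : FreeGroup X → W)
    (hm : ∀ a b, h (a * b) = h a + h b) :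
    ∃ L : (X → ℚ) →ₗ[ℚ] W, ∀ e, L (hab e) = h e := by
  have h1 : h 1 = 0 := by simpa using hm 1 1
  have hinv : ∀ a, h a⁻¹ = - h a := fun a => by
    have := hm a⁻¹ a
    rw [inv_mul_cancel, h1] at this
    exact (neg_eq_of_add_eq_zero_left this.symm).symm
  refine ⟨Fintype.linearCombination ℚ (fun x => h (FreeGroup.of x)), fun e => ?_⟩
  induction e using FreeGroup.induction_on with
  | C1 => rw [hab_one, map_zero, h1]
  | of i => rw [hab_of]; simp [Fintype.linearCombination_apply_single]
  | inv_of i ih => rw [hab_inv, map_neg, hinv, ih]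
  | mul a b ha hb => rw [hab_mul, map_add, hm, ha, hb]

/-- induced map on rational abelianizations -/
noncomputable def indL (ψ : FreeGroup X →* FreeGroup Y) : (X → ℚ) →ₗ[ℚ] (Y → ℚ) :=
  (hab_univ (fun e => hab (ψ e)) (fun a b => by rw [map_mul, hab_mul])).choose

lemma indL_hab (ψ : FreeGroup X →* FreeGroup Y) (e : FreeGroup X) :
    indL ψ (hab e) = hab (ψ e) :=
  (hab_univ (fun e => hab (ψ e)) (fun a b => by rw [map_mul, hab_mul])).choose_spec e

lemma hab_conj (a b : FreeGroup X) : hab (a * b * a⁻¹) = hab b := by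
  rw [hab_mul, hab_mul, hab_inv]; abel

lemma hab_pow (a : FreeGroup X) (n : ℕ) : hab (a ^ n) = (n : ℚ) • hab a := by
  induction n with
  | zero => simp [hab_one]
  | succ n ih => rw [pow_succ, hab_mul, ih, Nat.cast_succ, add_smul, one_smul]

end ind

/-! ### Cocycles -/
section cross
variable {X Ω P : Type*} [Group P]

lemma cross (π : FreeGroup X →* Equiv.Perm Ω) (p : X → Ω → P) :
    ∃ w : FreeGroup X → Ω → P, (∀ i ω, w (FreeGroup.of i) ω = p i ω) ∧
      ∀ f g ω, w (f * g) ω = w f (π g ω) * w g ω := by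
  let Φ0 : X → Equiv.Perm (P × Ω) := fun i =>
    { toFun := fun x => (p i x.2 * x.1, π (FreeGroup.of i) x.2)
      invFun := fun x => ((p i ((π (FreeGroup.of i)).symm x.2))⁻¹ * x.1, (π (FreeGroup.of i)).symm x.2)
      left_inv := fun x => by simp
      right_inv := fun x => by simp }
  let Φ : FreeGroup X →* Equiv.Perm (P × Ω) := FreeGroup.lift Φ0
  have key : ∀ f c ω, Φ f (c, ω) = ((Φ f (1, ω)).1 * c, π f ω) := by
    intro f
    induction f using FreeGroup.induction_on with
    | C1 => intro c ω; simp
    | of i => intro c ω; simp [Φ, Φ0]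
    | inv_of i ih =>
      intro c ω
      simp only [Φ, map_inv, FreeGroup.lift_apply_of]
      change ((p i ((π (FreeGroup.of i)).symm ω))⁻¹ * c, (π (FreeGroup.of i)).symm ω) =
        ((p i ((π (FreeGroup.of i)).symm ω))⁻¹ * 1 * c, (π (FreeGroup.of i)).symm ω)
      rw [mul_one]
    | mul a b ha hb =>
      intro c ω
      rw [map_mul, map_mul, Equiv.Perm.mul_apply, Equiv.Perm.mul_apply, hb c, ha, hb 1, ha (_ * 1)]
      simp [mul_assoc]
  refine ⟨fun f ω => (Φ f (1, ω)).1, fun i ω => ?_, fun f g ω => ?_⟩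
  · simp [Φ, Φ0]
  · change (Φ (f * g) (1, ω)).1 = _
    rw [map_mul, Equiv.Perm.mul_apply, key g, key f, mul_one]

end cross

/-! ### Exponent sums -/
section zab
variable {Y : Type*} [Fintype Y] [DecidableEq Y]

/-- integral exponent sums -/
noncomputable def zab (e : FreeGroup Y) : Y → ℤ :=
  (FreeGroup.lift (fun i => Multiplicative.ofAdd (Pi.single i 1 : Y → ℤ)) e).toAdd

lemma zab_mul (a b : FreeGroup Y) : zab (a * b) = zab a + zab b := by simp [zab]
lemma zab_one : zab (1 : FreeGroup Y) = 0 := by simp [zab]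
lemma zab_inv (a : FreeGroup Y) : zab (a⁻¹) = - zab a := by simp [zab]
lemma zab_of (i : Y) : zab (FreeGroup.of i) = Pi.single i 1 := by simp [zab]

lemma hab_eq_zab (e : FreeGroup Y) (j : Y) : hab e j = (zab e j : ℚ) := by
  induction e using FreeGroup.induction_on with
  | C1 => simp [hab_one, zab_one]
  | of i => rw [hab_of, zab_of]; by_cases h : j = i <;> simp [Pi.single_apply, h]
  | inv_of i ih => rw [hab_inv, zab_inv]; simp [ih]
  | mul a b ha hb => rw [hab_mul, zab_mul]; simp [ha, hb]

/-- mod `q` exponent sums -/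
noncomputable def zeta (Y : Type*) [DecidableEq Y] (q : ℕ) :
    FreeGroup Y →* Multiplicative (Y → ZMod q) :=
  FreeGroup.lift (fun i => Multiplicative.ofAdd (Pi.single i 1 : Y → ZMod q))

lemma zeta_apply (q : ℕ) (e : FreeGroup Y) (j : Y) : (zeta Y q e).toAdd j = (zab e j : ZMod q) := by
  induction e using FreeGroup.induction_on with
  | C1 => simp [zab_one]
  | of i => rw [zab_of]; by_cases h : j = i <;> simp [zeta, Pi.single_apply, h]
  | inv_of i ih => rw [zab_inv, map_inv]; simp [ih]
  | mul a b ha hb => rw [zab_mul, map_mul]; simp [ha, hb]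

/-- the kernel of reduction mod `q` of the abelianization -/
noncomputable def Kq (Y : Type*) [DecidableEq Y] (q : ℕ) : Subgroup (FreeGroup Y) := (zeta Y q).ker

instance (Y : Type*) [DecidableEq Y] (q : ℕ) : (Kq Y q).Normal := by unfold Kq; infer_instance

lemma mem_Kq {q : ℕ} {e : FreeGroup Y} : e ∈ Kq Y q ↔ ∀ j, (zab e j : ZMod q) = 0 := by
  rw [Kq, MonoidHom.mem_ker]
  constructor
  · intro h j; rw [← zeta_apply, h]; rfl
  · intro h
    apply Multiplicative.toAdd.injective
    funext j; rw [zeta_apply, h]; rfl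

lemma mem_Kq_iff {q : ℕ} {e : FreeGroup Y} :
    e ∈ Kq Y q ↔ ∀ h : FreeGroup Y →* Multiplicative (ZMod q), h e = 1 := by
  constructor
  · intro he h
    have : ∀ e : FreeGroup Y, (h e).toAdd = ∑ j, (zab e j : ZMod q) * (h (FreeGroup.of j)).toAdd := by
      intro e
      induction e using FreeGroup.induction_on with
      | C1 => simp [zab_one]
      | of i => simp [zab_of, Pi.single_apply]
      | inv_of i ih => rw [map_inv, toAdd_inv, ih, zab_inv]; simp
      | mul a b ha hb => rw [map_mul, toAdd_mul, ha, hb, zab_mul]; simp [add_mul, Finset.sum_add_distrib]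
    apply Multiplicative.toAdd.injective
    rw [this]
    rw [mem_Kq] at he
    simp [he]
  · intro h
    rw [mem_Kq]
    intro j
    have := h ((AddMonoidHom.toMultiplicative (Pi.evalAddMonoidHom (fun _ : Y => ZMod q) j)).comp (zeta Y q))
    rw [← zeta_apply]
    exact congrArg Multiplicative.toAdd this

lemma Kq_map (q : ℕ) (γ : FreeGroup Y →* FreeGroup Y) {e : FreeGroup Y} (he : e ∈ Kq Y q) :
    γ e ∈ Kq Y q := by
  rw [mem_Kq_iff] at *
  intro h
  exact he (h.comp γ)

instance (q : ℕ) [NeZero q] : (Kq Y q).FiniteIndex := by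
  unfold Kq
  haveI : Finite (Multiplicative (Y → ZMod q)) := inferInstanceAs (Finite (Y → ZMod q))
  infer_instance

lemma pow_mem_Kq (q : ℕ) (e : FreeGroup Y) : e ^ q ∈ Kq Y q := by
  rw [Kq, MonoidHom.mem_ker, map_pow]
  apply Multiplicative.toAdd.injective
  funext j
  simp

lemma faith (q : ℕ) (hq : 2 ≤ q) [Nontrivial Y] (b : FreeGroup Y)
    (hb : ∀ h : Kq Y q → ℚ, (∀ x y, h (x * y) = h x + h y) →
      ∀ e : Kq Y q, h ⟨b * e * b⁻¹, (inferInstance : (Kq Y q).Normal).conj_mem _ e.2 b⟩ = h e) :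
    b ∈ Kq Y q := by
  haveI : Fact (1 < q) := ⟨hq⟩
  obtain ⟨k, j, hkj⟩ := exists_pair_ne Y
  let π : FreeGroup Y →* Equiv.Perm (Y → ZMod q) :=
    { toFun := fun f => Equiv.addLeft (zeta Y q f).toAdd
      map_one' := by ext; simp
      map_mul' := fun f g => by ext; simp [add_assoc] }
  have hπ : ∀ f ω, π f ω = (zeta Y q f).toAdd + ω := fun f ω => rfl
  obtain ⟨w, hw, hwm⟩ := cross (P := Multiplicative ℚ) π
    (fun i ω => Multiplicative.ofAdd (if i = k ∧ ω = 0 then 1 else 0))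
  let v : FreeGroup Y → (Y → ZMod q) → ℚ := fun f ω => (w f ω).toAdd
  have hv : ∀ i ω, v (FreeGroup.of i) ω = if i = k ∧ ω = 0 then 1 else 0 := fun i ω => by
    simp [v, hw]
  have hvm : ∀ f g ω, v (f * g) ω = v f (π g ω) + v g ω := fun f g ω => by simp [v, hwm]
  have hv1 : ∀ ω, v 1 ω = 0 := fun ω => by simpa using hvm 1 1 ω
  have hvi : ∀ f ω, v f⁻¹ ω = - v f (π f⁻¹ ω) := fun f ω => by
    have := hvm f f⁻¹ ω
    rw [mul_inv_cancel, hv1] at this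
    linarith
  have hzof : ∀ i, (zeta Y q (FreeGroup.of i)).toAdd = Pi.single i 1 := fun i => by simp [zeta]
  have hzinv : ∀ i, (zeta Y q (FreeGroup.of i)⁻¹).toAdd = - Pi.single i 1 := fun i => by
    rw [map_inv]; exact congrArg Neg.neg (hzof i)
  have hπK : ∀ f ∈ Kq Y q, ∀ ω, π f ω = ω := by
    intro f hf ω
    rw [hπ, (MonoidHom.mem_ker.1 hf : zeta Y q f = 1)]; simp
  set e : FreeGroup Y := FreeGroup.of k * FreeGroup.of j * (FreeGroup.of k)⁻¹ * (FreeGroup.of j)⁻¹ with he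
  have heK : e ∈ Kq Y q := by
    rw [Kq, MonoidHom.mem_ker, he]; simp only [map_mul, map_inv]
    rw [mul_comm (zeta Y q (FreeGroup.of k))]; group
  have hve : ∀ ω, v e ω = (if ω = Pi.single k 1 then 1 else 0) -
      (if ω = Pi.single k 1 + Pi.single j 1 then 1 else 0) := by
    intro ω
    rw [he, hvm, hvm, hvm, hvi, hvi]
    simp only [hv, hπ, hzinv, hzof, hkj.symm, false_and, if_false, true_and]
    have h1 : (Pi.single j 1 + (-Pi.single k 1 + (-Pi.single j 1 + ω)) = (0 : Y → ZMod q)) ↔ ω = Pi.single k 1 := by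
      constructor
      · intro h; rw [← sub_eq_zero, ← h]; abel
      · rintro rfl; abel
    have h2 : (-Pi.single k 1 + (-Pi.single j 1 + ω) = (0 : Y → ZMod q)) ↔ ω = Pi.single k 1 + Pi.single j 1 := by
      constructor
      · intro h; rw [← sub_eq_zero, ← h]; abel
      · rintro rfl; abel
    simp only [h1, h2]; ring
  have hfin := hb (fun x => v x (Pi.single k 1)) (fun x y => by
    rw [Subgroup.coe_mul, hvm, hπK _ y.2]) ⟨e, heK⟩
  simp only at hfin
  rw [hvm, hvm, hvi, hπK e heK] at hfin
  have hne : (Pi.single k 1 : Y → ZMod q) ≠ Pi.single k 1 + Pi.single j 1 := by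
    intro h
    have := congrFun h j
    simp at this
  rw [hve (Pi.single k 1), if_pos rfl, if_neg hne] at hfin
  have h3 : v e (π b⁻¹ (Pi.single k 1)) = 1 := by linarith
  rw [hve, hπ] at h3
  split_ifs at h3 with h4 h5 h5
  · norm_num at h3
  · have : zeta Y q b = 1 := by
      apply Multiplicative.toAdd.injective
      have : (zeta Y q b⁻¹).toAdd = 0 := by simpa using h4
      simpa using this
    exact this
  · norm_num at h3
  · norm_num at h3

end zab
end KP

namespace KP

section lemC
variable {V : Type*} [AddCommGroup V] [Module ℚ V] [FiniteDimensional ℚ V]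

lemma lemmaC (q : ℕ) [Fact q.Prime] (τ : Module.End ℚ V) (hτ : τ ^ q = 1)
    (hd : Module.finrank ℚ V < q - 1) : τ = 1 := by
  have hq : q.Prime := Fact.out
  have hintg : IsIntegral ℚ τ := Algebra.IsIntegral.isIntegral τ
  have h1 : minpoly ℚ τ ∣ Polynomial.cyclotomic q ℚ * (Polynomial.X - 1) := by
    rw [Polynomial.cyclotomic_prime_mul_X_sub_one]
    apply minpoly.dvd
    simp [hτ]
  have h2 : IsCoprime (minpoly ℚ τ) (Polynomial.cyclotomic q ℚ) := by
    rw [isCoprime_comm, (Polynomial.cyclotomic.irreducible_rat hq.pos).coprime_iff_not_dvd]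
    intro h
    have h3 := Polynomial.natDegree_le_of_dvd h (minpoly.ne_zero hintg)
    rw [Polynomial.natDegree_cyclotomic, Nat.totient_prime hq] at h3
    have h4 := Polynomial.natDegree_le_of_dvd (LinearMap.minpoly_dvd_charpoly τ)
      (LinearMap.charpoly_monic τ).ne_zero
    rw [LinearMap.charpoly_natDegree] at h4
    omega
  obtain ⟨r, hr⟩ := h2.dvd_of_dvd_mul_left h1
  have := congrArg (Polynomial.aeval τ) hr
  rw [map_mul, minpoly.aeval, zero_mul] at this
  simpa [sub_eq_zero] using this

/-- Lemma C on an invariant subspace -/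
lemma lemmaC' (q : ℕ) [Fact q.Prime] (τ : Module.End ℚ V) (hτ : τ ^ q = 1)
    (R : Submodule ℚ V) (hR : ∀ x ∈ R, τ x ∈ R) (hd : Module.finrank ℚ R < q - 1) :
    ∀ x ∈ R, τ x = x := by
  have h := lemmaC q (τ.restrict hR) (by
    rw [Module.End.pow_restrict]
    ext x
    simp [LinearMap.restrict_apply, hτ]) hd
  intro x hx
  have := congrArg Subtype.val (DFunLike.congr_fun h ⟨x, hx⟩)
  simpa using this

lemma eq_one_of_rank (q : ℕ) [Fact q.Prime] (τ : Module.End ℚ V) (hτ : τ ^ q = 1)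
    (hd : Module.finrank ℚ (LinearMap.range (τ - 1)) < q - 1) : τ = 1 := by
  have hq : q.Prime := Fact.out
  have h1 := lemmaC' q τ hτ (LinearMap.range (τ - 1)) (by
    rintro x ⟨y, rfl⟩
    exact ⟨τ y, by simp⟩) hd
  set n := τ - 1 with hn
  have h2 : n * n = 0 := by
    ext x
    have := h1 (n x) ⟨x, rfl⟩
    change n (n x) = 0
    nth_rw 1 [hn]
    simp [this]
  have h3 : ∀ k : ℕ, τ ^ k = 1 + (k : ℚ) • n := by
    intro k
    induction k with
    | zero => simp
    | succ k ih =>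
      have : τ = 1 + n := by rw [hn]; abel
      rw [pow_succ, ih]
      rw [this]
      rw [mul_add, add_mul 1 _ n, smul_mul_assoc _ n n, h2]
      push_cast
      rw [add_smul]
      simp; abel
  have h4 := h3 q
  rw [hτ, left_eq_add] at h4
  have : n = 0 := by
    rcases smul_eq_zero.1 h4 with h | h
    · exact absurd h (by exact_mod_cast hq.ne_zero)
    · exact h
  rw [hn] at this
  exact sub_eq_zero.1 this

end lemC

section transfer

lemma exists_transfer {G A : Type*} [Group G] [CommGroup A] (H : Subgroup G) [H.Normal]
    [H.FiniteIndex] (ϕ : H →* A) :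
    ∃ (T : G →* A), ∀ e : H,
      T e = (letI := H.fintypeQuotientOfFiniteIndex; ∏ c : G ⧸ H, ϕ ⟨c.out⁻¹ * e * c.out,
        by simpa using (inferInstance : H.Normal).conj_mem _ e.2 c.out⁻¹⟩) := by
  refine ⟨MonoidHom.transfer ϕ, fun e => ?_⟩
  let T : H.LeftTransversal := ⟨Set.range (Quotient.out : G ⧸ H → G), Subgroup.isComplement_range_left (fun c => Quotient.out_eq' c)⟩
  rw [MonoidHom.transfer_def ϕ T]
  unfold Subgroup.leftTransversals.diff
  apply Finset.prod_congr rfl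
  intro c _
  congr 1
  ext
  have hc : (e : G)⁻¹ • c = c := by
    induction c using QuotientGroup.induction_on with
    | H z =>
      change ((e⁻¹ * z : G) : G ⧸ H) = (z : G ⧸ H)
      rw [QuotientGroup.eq]
      have := (inferInstance : H.Normal).conj_mem _ e.2 z⁻¹
      simpa [mul_assoc] using this
  simp only
  rw [Subgroup.smul_apply_eq_smul_apply_inv_smul, hc]
  have h2 : ((T.2.leftQuotientEquiv c : T.1) : G) = c.out :=
    Subgroup.IsComplement.leftQuotientEquiv_apply (fun c => Quotient.out_eq' c) c
  rw [h2]; simp [mul_assoc]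

end transfer
end KP

namespace KP
section rank
variable {X Y : Type*} [Fintype X] [DecidableEq X] [Fintype Y] [DecidableEq Y] {q : ℕ}

/-- restriction of an endomorphism to `Kq` -/
noncomputable def resK (q : ℕ) (γ : FreeGroup Y →* FreeGroup Y) : Kq Y q →* Kq Y q :=
  (γ.comp (Kq Y q).subtype).codRestrict (Kq Y q) (fun e => Kq_map q γ e.2)

lemma resK_coe (γ : FreeGroup Y →* FreeGroup Y) (e : Kq Y q) : (resK q γ e : FreeGroup Y) = γ e := rfl

/-- action of endomorphisms on the rational abelianization of `Kq` -/
noncomputable def actE (i : Kq Y q ≃* FreeGroup X) (γ : FreeGroup Y →* FreeGroup Y) :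
    Module.End ℚ (X → ℚ) :=
  indL (i.toMonoidHom.comp ((resK q γ).comp i.symm.toMonoidHom))

lemma actE_ab (i : Kq Y q ≃* FreeGroup X) (γ : FreeGroup Y →* FreeGroup Y) (e : Kq Y q) :
    actE i γ (hab (i e)) = hab (i (resK q γ e)) := by
  rw [actE, indL_hab]; simp

lemma endE_ext (i : Kq Y q ≃* FreeGroup X) {W : Type*} [AddCommGroup W] [Module ℚ W]
    {f g : (X → ℚ) →ₗ[ℚ] W} (h : ∀ e : Kq Y q, f (hab (i e)) = g (hab (i e))) : f = g := by
  apply hab_ext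
  intro e
  have := h (i.symm e)
  simpa using this

lemma actE_mul (i : Kq Y q ≃* FreeGroup X) (γ δ : FreeGroup Y →* FreeGroup Y) :
    actE i (γ.comp δ) = actE i γ * actE i δ := by
  apply endE_ext i
  intro e
  rw [Module.End.mul_apply, actE_ab, actE_ab, actE_ab]
  rfl

/-- conjugation -/
def cj (b : FreeGroup Y) : FreeGroup Y →* FreeGroup Y := (MulAut.conj b).toMonoidHom

lemma cj_apply (b e : FreeGroup Y) : cj b e = b * e * b⁻¹ := rfl

lemma cj_mul (a b : FreeGroup Y) : cj (a * b) = (cj a).comp (cj b) := by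
  ext x
  simp only [MonoidHom.comp_apply, cj_apply]
  group

lemma actE_cj_mem (i : Kq Y q ≃* FreeGroup X) {b : FreeGroup Y} (hb : b ∈ Kq Y q) :
    actE i (cj b) = 1 := by
  apply endE_ext i
  intro e
  rw [actE_ab]
  have : resK q (cj b) e = ⟨b, hb⟩ * e * ⟨b, hb⟩⁻¹ := by
    ext; rfl
  rw [this, map_mul, map_mul, map_inv, hab_conj]; rfl

lemma actE_cj_mul (i : Kq Y q ≃* FreeGroup X) (a b : FreeGroup Y) :
    actE i (cj (a * b)) = actE i (cj a) * actE i (cj b) := by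
  rw [cj_mul, actE_mul]

lemma actE_cj_pow (i : Kq Y q ≃* FreeGroup X) (b : FreeGroup Y) : actE i (cj b) ^ q = 1 := by
  have : ∀ n : ℕ, actE i (cj b) ^ n = actE i (cj (b ^ n)) := by
    intro n
    induction n with
    | zero => rw [pow_zero, pow_zero, actE_cj_mem i (one_mem _)]
    | succ n ih => rw [pow_succ, ih, pow_succ, actE_cj_mul]
  rw [this, actE_cj_mem i (pow_mem_Kq q b)]

lemma actE_faith [Nontrivial Y] (hq : 2 ≤ q) (i : Kq Y q ≃* FreeGroup X) {b : FreeGroup Y}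
    (h : actE i (cj b) = 1) : b ∈ Kq Y q := by
  apply faith q hq
  intro f hf e
  obtain ⟨L, hL⟩ := hab_univ (fun x : FreeGroup X => f (i.symm x)) (fun a b => by rw [map_mul, hf])
  have hL' : ∀ e, f e = L (hab (i e)) := fun e => by rw [hL]; simp
  have h2 := actE_ab i (cj b) e
  rw [h] at h2
  rw [hL', hL']
  exact congrArg L h2.symm

lemma card_ge [Fact q.Prime] [Nontrivial Y] (i : Kq Y q ≃* FreeGroup X) :
    q - 1 ≤ Fintype.card X := by
  by_contra hlt
  have hq : q.Prime := Fact.out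
  obtain ⟨y⟩ := (inferInstance : Nonempty Y)
  have h1 := lemmaC q (actE i (cj (FreeGroup.of y))) (actE_cj_pow i _) (by
    rw [Module.finrank_fintype_fun_eq_card]; omega)
  have h2 := actE_faith hq.two_le i h1
  rw [mem_Kq] at h2
  have h3 := h2 y
  rw [zab_of] at h3
  haveI : Fact (1 < q) := ⟨hq.one_lt⟩
  simp at h3

lemma finrank_range_add_le {V : Type*} [AddCommGroup V] [Module ℚ V] [FiniteDimensional ℚ V]
    (f g : Module.End ℚ V) : Module.finrank ℚ (LinearMap.range (f - g)) ≤
      Module.finrank ℚ (LinearMap.range f) + Module.finrank ℚ (LinearMap.range g) := by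
  refine le_trans (Submodule.finrank_mono ?_) (Submodule.finrank_add_le_finrank_add_finrank _ _)
  rintro x ⟨y, rfl⟩
  exact Submodule.sub_mem_sup ⟨y, rfl⟩ ⟨y, rfl⟩

theorem rank_lemma [Fact q.Prime] (hq7 : 7 ≤ q) (hY : 3 ≤ Fintype.card Y)
    (i : Kq Y q ≃* FreeGroup X) (γ : FreeGroup Y ≃* FreeGroup Y)
    (hbd : ∀ k j, |zab (γ (FreeGroup.of k)) j - zab (FreeGroup.of k) j| < q)
    (lam : ℚ)
    (hrk : Module.finrank ℚ (LinearMap.range (actE i γ.toMonoidHom - lam • 1)) ≤ 2) :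
    actE i γ.toMonoidHom = 1 := by
  have hq : q.Prime := Fact.out
  haveI : NeZero q := ⟨hq.ne_zero⟩
  haveI : Nontrivial Y := Fintype.one_lt_card_iff_nontrivial.1 (by omega)
  set g := actE i γ.toMonoidHom with hg
  -- automorphisms act invertibly
  have hginv : g * actE i γ.symm.toMonoidHom = 1 := by
    rw [hg, ← actE_mul]
    apply endE_ext i
    intro e
    rw [actE_ab]
    change _ = hab (i e)
    congr 2
    ext; simp [resK_coe]
  have hcinv : ∀ b, actE i (cj b) * actE i (cj b⁻¹) = 1 := fun b => by
    rw [← actE_cj_mul, mul_inv_cancel, actE_cj_mem i (one_mem _)]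
  have hcinv' : ∀ b, actE i (cj b⁻¹) * actE i (cj b) = 1 := fun b => by
    rw [← actE_cj_mul, inv_mul_cancel, actE_cj_mem i (one_mem _)]
  -- commutators lie in Kq
  have hcomm : ∀ b, γ b * b⁻¹ ∈ Kq Y q := by
    intro b
    apply actE_faith hq.two_le i
    apply eq_one_of_rank q _ (actE_cj_pow i _)
    set B := actE i (cj b) with hB
    set C := actE i (cj (γ b * b⁻¹)) with hC
    have h1 : C * B * g = g * B := by
      rw [hC, hB, hg, ← actE_cj_mul, ← actE_mul, ← actE_mul]
      congr 1
      ext x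
      simp [cj_apply]
    have h2 : C - 1 = ((g - lam • 1) * B - B * (g - lam • 1)) *
        (actE i γ.symm.toMonoidHom * actE i (cj b⁻¹)) := by
      have e1 : (g - lam • 1) * B - B * (g - lam • 1) = (C - 1) * (B * g) := by
        rw [sub_mul, sub_mul, mul_sub, ← mul_assoc, h1]; simp
      rw [e1, mul_assoc (C - 1), mul_assoc B, ← mul_assoc g, hginv, one_mul, hcinv, mul_one]
    have h3 : LinearMap.range (C - 1) ≤ LinearMap.range ((g - lam • 1) * B - B * (g - lam • 1)) := by
      rw [h2]; exact LinearMap.range_comp_le_range _ _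
    have h4 := Submodule.finrank_mono h3
    have h5 := finrank_range_add_le ((g - lam • 1) * B) (B * (g - lam • 1))
    have h6 : Module.finrank ℚ (LinearMap.range ((g - lam • 1) * B)) ≤ 2 :=
      le_trans (Submodule.finrank_mono (LinearMap.range_comp_le_range _ _)) hrk
    have h7 : Module.finrank ℚ (LinearMap.range (B * (g - lam • 1))) ≤ 2 := by
      refine le_trans ?_ hrk
      change Module.finrank ℚ (LinearMap.range (B ∘ₗ (g - lam • 1))) ≤ _
      rw [LinearMap.range_comp]
      exact Submodule.finrank_map_le _ _
    omega
  -- γ acts trivially on the abelianization of Γ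
  have htriv : ∀ f, hab (γ f) = hab f := by
    have h1 : indL γ.toMonoidHom = LinearMap.id := by
      apply LinearMap.pi_ext'
      intro k
      ext j
      have h2 := mem_Kq.1 (hcomm (FreeGroup.of k)) j
      rw [zab_mul, zab_inv, ZMod.intCast_zmod_eq_zero_iff_dvd] at h2
      have h3 := Int.eq_zero_of_abs_lt_dvd h2 (by simpa [sub_eq_add_neg] using hbd k j)
      have h4 : zab (γ (FreeGroup.of k)) j = zab (FreeGroup.of k) j := by
        simp only [Pi.add_apply, Pi.neg_apply] at h3; linarith
      have h5 : indL γ.toMonoidHom (Pi.single k 1) = hab (γ (FreeGroup.of k)) := by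
        rw [← hab_of, indL_hab]; rfl
      simp only [LinearMap.comp_apply, LinearMap.coe_single, LinearMap.id_apply]
      rw [h5, hab_eq_zab, h4, ← hab_eq_zab, hab_of]
    intro f
    have := indL_hab γ.toMonoidHom f
    rw [h1] at this
    exact this.symm
  -- the surjection H_E → H_F
  let J : (X → ℚ) →ₗ[ℚ] (Y → ℚ) := indL ((Kq Y q).subtype.comp i.symm.toMonoidHom)
  have hJ : ∀ e : Kq Y q, J (hab (i e)) = hab (e : FreeGroup Y) := fun e => by
    simp only [J]
    rw [indL_hab]; simp
  have hJsurj : LinearMap.range J = ⊤ := by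
    rw [eq_top_iff, ← (Pi.basisFun ℚ Y).span_eq, Submodule.span_le]
    rintro _ ⟨y, rfl⟩
    refine ⟨(q : ℚ)⁻¹ • hab (i ⟨FreeGroup.of y ^ q, pow_mem_Kq q _⟩), ?_⟩
    rw [map_smul, hJ, hab_pow, hab_of, smul_smul, inv_mul_cancel₀ (by exact_mod_cast hq.ne_zero), one_smul]
    simp
  have hJg : J ∘ₗ g = J := by
    apply endE_ext i
    intro e
    rw [LinearMap.comp_apply, hg, actE_ab, hJ, hJ, resK_coe]
    exact htriv _
  have hlam : lam = 1 := by
    by_contra hl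
    have h1 : J ∘ₗ (g - lam • 1) = (1 - lam) • J := by
      ext x
      have := DFunLike.congr_fun hJg (Pi.single x 1)
      simp only [LinearMap.comp_apply] at this
      simp [this, sub_mul]
    have h2 : LinearMap.range (J ∘ₗ (g - lam • 1)) = ⊤ := by
      rw [h1, LinearMap.range_smul _ _ (sub_ne_zero.2 (Ne.symm hl)), hJsurj]
    have h3 : Module.finrank ℚ (LinearMap.range (J ∘ₗ (g - lam • 1))) ≤ 2 := by
      rw [LinearMap.range_comp]
      exact (Submodule.finrank_map_le _ _).trans hrk
    rw [h2, finrank_top, Module.finrank_fintype_fun_eq_card] at h3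
    omega
  rw [hlam, one_smul] at hrk
  -- Kq-cosets act trivially on the range of g - 1
  have hR : ∀ b, ∀ x ∈ LinearMap.range (g - 1), actE i (cj b) x = x := by
    intro b
    apply lemmaC' q _ (actE_cj_pow i b)
    · rintro x ⟨y, rfl⟩
      refine ⟨actE i (cj b) y, ?_⟩
      have h1 : g * actE i (cj b) = actE i (cj b) * g := by
        have h2 : actE i (cj (γ b)) = actE i (cj b) := by
          have : γ b = (γ b * b⁻¹) * b := by group
          rw [this, actE_cj_mul, actE_cj_mem i (hcomm b), one_mul]
        nth_rw 2 [← h2]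
        rw [hg, ← actE_mul, ← actE_mul]
        congr 1
        ext x
        simp [cj_apply]
      have := DFunLike.congr_fun h1 y
      simp only [Module.End.mul_apply] at this
      simp [this]
    · omega
  -- transfer
  letI := (Kq Y q).fintypeQuotientOfFiniteIndex
  obtain ⟨T, hT⟩ := exists_transfer (A := Multiplicative (X → ℚ)) (Kq Y q)
    { toFun := fun e => Multiplicative.ofAdd (hab (i e))
      map_one' := by rw [map_one, hab_one]; rfl
      map_mul' := fun a b => by rw [map_mul, hab_mul]; rfl }
  have hT2 : ∀ e : Kq Y q, (T e).toAdd =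
      (∑ c : FreeGroup Y ⧸ Kq Y q, actE i (cj c.out⁻¹)) (hab (i e)) := by
    intro e
    rw [hT]
    rw [toAdd_prod, LinearMap.sum_apply]
    apply Finset.sum_congr rfl
    intro c _
    rw [actE_ab]
    simp only [MonoidHom.coe_mk, OneHom.coe_mk, toAdd_ofAdd]
    congr 2
    ext
    simp [resK_coe, cj_apply]
  obtain ⟨L, hL⟩ := hab_univ (fun e => (T e).toAdd) (fun a b => by rw [map_mul]; rfl)
  have hN0 : (∑ c : FreeGroup Y ⧸ Kq Y q, actE i (cj c.out⁻¹)) * (g - 1) = 0 := by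
    apply endE_ext i
    intro e
    have h1 := hT2 e
    have h2 := hT2 (resK q γ.toMonoidHom e)
    rw [← actE_ab, ← hg] at h2
    have h3 : (T (resK q γ.toMonoidHom e : FreeGroup Y)).toAdd = (T (e : FreeGroup Y)).toAdd := by
      have a1 := hL (resK q γ.toMonoidHom e)
      have a2 := hL e
      rw [← a1, ← a2, resK_coe]
      exact congrArg L (htriv _)
    rw [Module.End.mul_apply, LinearMap.sub_apply, map_sub, ← h2, h3, h1]
    simp
  have hN1 : (∑ c : FreeGroup Y ⧸ Kq Y q, actE i (cj c.out⁻¹)) * (g - 1) =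
      (Fintype.card (FreeGroup Y ⧸ Kq Y q) : ℚ) • (g - 1) := by
    refine LinearMap.ext fun y => ?_
    simp only [LinearMap.comp_apply, Module.End.mul_apply, LinearMap.sum_apply]
    rw [Finset.sum_congr rfl (fun c _ => hR c.out⁻¹ _ ⟨_, rfl⟩)]
    rw [Finset.sum_const, Finset.card_univ, LinearMap.smul_apply, Nat.cast_smul_eq_nsmul]
  rw [hN0] at hN1
  rcases smul_eq_zero.1 hN1.symm with h | h
  · exact absurd h (by exact_mod_cast Fintype.card_ne_zero)
  · exact sub_eq_zero.1 h

end rank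
end KP

namespace KP
section hall
variable {X : Type*}

/-- A finite permutation representation adapted to a finitely generated subgroup of infinite index. -/
lemma hall_rep (H : Subgroup (FreeGroup X)) (hfg : H.FG) (hinf : ¬ H.FiniteIndex) :
    ∃ (Ω : Set (FreeGroup X ⧸ H)) (_ : Finite Ω) (π : FreeGroup X →* Equiv.Perm Ω) (ω₀ : Ω)
      (i0 : X) (p1 : FreeGroup X),
      ∀ (Ω' P : Type _) [Group P] (π' : FreeGroup X →* Equiv.Perm Ω') (κ : Ω' → Ω)
        (_ : ∀ f s, κ (π' f s) = π f (κ s)) (w : FreeGroup X → Ω' → P)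
        (_ : ∀ f g s, w (f * g) s = w f (π' g s) * w g s)
        (_ : ∀ i s, ¬ (i = i0 ∧ κ s = π p1 ω₀) → w (FreeGroup.of i) s = 1),
        ∀ h ∈ H, ∀ s, κ s = ω₀ → κ (π' h s) = ω₀ ∧ w h s = 1 := by
  classical
  obtain ⟨S, hS⟩ := hfg
  let cs : List (X × Bool) → FreeGroup X ⧸ H := fun t => ((FreeGroup.mk t : FreeGroup X) : FreeGroup X ⧸ H)
  let Y : Set (FreeGroup X ⧸ H) :=
    (fun t => cs t) '' ({[]} ∪ ⋃ s ∈ S, {t | t ∈ (FreeGroup.toWord s).tails})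
  have hYfin : Y.Finite := by
    apply Set.Finite.image
    apply Set.Finite.union (Set.finite_singleton _)
    apply Set.Finite.biUnion S.finite_toSet
    intro s _
    exact List.finite_toSet _
  haveI : Finite Y := hYfin
  letI : Fintype Y := Fintype.ofFinite Y
  have hb : cs [] ∈ Y := ⟨[], Or.inl rfl, rfl⟩
  -- partial injections
  let e : ∀ i : X, {y : Y // FreeGroup.of i • (y : FreeGroup X ⧸ H) ∈ Y} ≃
      {y : Y // (FreeGroup.of i)⁻¹ • (y : FreeGroup X ⧸ H) ∈ Y} := fun i =>
    { toFun := fun y => ⟨⟨_, y.2⟩, by rw [inv_smul_smul]; exact y.1.2⟩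
      invFun := fun y => ⟨⟨_, y.2⟩, by rw [smul_inv_smul]; exact y.1.2⟩
      left_inv := fun y => by ext; simp
      right_inv := fun y => by ext; simp }
  let π : FreeGroup X →* Equiv.Perm Y := FreeGroup.lift fun i => (e i).extendSubtype
  have hπ : ∀ i (y : Y) (hy : FreeGroup.of i • (y : FreeGroup X ⧸ H) ∈ Y),
      π (FreeGroup.of i) y = ⟨_, hy⟩ := by
    intro i y hy
    simp only [π, FreeGroup.lift_apply_of]
    rw [Equiv.extendSubtype_apply_of_mem (e i) y hy]
    rfl
  let ω₀ : Y := ⟨cs [], hb⟩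
  -- a missing edge
  obtain ⟨y0, i0, hy0⟩ : ∃ (y : Y) (i : X), FreeGroup.of i • (y : FreeGroup X ⧸ H) ∉ Y := by
    by_contra hcon
    push Not at hcon
    apply hinf
    have hinv : ∀ f : FreeGroup X, ∀ y ∈ Y, f • y ∈ Y := by
      intro f
      induction f using FreeGroup.induction_on with
      | C1 => intro y hy; rwa [one_smul]
      | of i => intro y hy; exact hcon ⟨y, hy⟩ i
      | inv_of i ih =>
        intro y hy
        have hinj : Function.Injective (fun y : Y => (⟨_, hcon y i⟩ : Y)) := by
          intro a b hab
          have := congrArg Subtype.val hab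
          exact Subtype.ext (smul_left_cancel _ this)
        obtain ⟨z, hz⟩ := Finite.surjective_of_injective hinj ⟨y, hy⟩
        have hz' : FreeGroup.of i • (z : FreeGroup X ⧸ H) = y := congrArg Subtype.val hz
        rw [← hz', inv_smul_smul]; exact z.2
      | mul a b ha hb => intro y hy; rw [mul_smul]; exact ha _ (hb _ hy)
    have huniv : Y = Set.univ := by
      rw [Set.eq_univ_iff_forall]
      intro c
      induction c using QuotientGroup.induction_on with
      | H z =>
        have := hinv z _ hb
        have h2 : z • cs [] = (z : FreeGroup X ⧸ H) := by
          change ((z * FreeGroup.mk [] : FreeGroup X) : FreeGroup X ⧸ H) = _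
          rw [← FreeGroup.one_eq_mk, mul_one]
        rwa [h2] at this
    rw [huniv] at hYfin
    haveI : Finite (FreeGroup X ⧸ H) := Set.finite_univ_iff.1 hYfin
    exact Subgroup.finiteIndex_of_finite_quotient
  -- following paths
  have hcons : ∀ (i : X) (b : Bool) (t : List (X × Bool)),
      FreeGroup.mk ((i, b) :: t) = (if b then FreeGroup.of i else (FreeGroup.of i)⁻¹) * FreeGroup.mk t := by
    intro i b t
    cases b
    · simp [FreeGroup.of, FreeGroup.inv_mk, FreeGroup.mul_mk, FreeGroup.invRev]
    · simp [FreeGroup.of, FreeGroup.mul_mk]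
  have hpath : ∀ t : List (X × Bool), (∀ u ∈ t.tails, cs u ∈ Y) →
      ((π (FreeGroup.mk t) ω₀ : Y) : FreeGroup X ⧸ H) = cs t ∧
      ∀ (Ω' P : Type _) [Group P] (π' : FreeGroup X →* Equiv.Perm Ω') (κ : Ω' → Y)
        (_ : ∀ f s, κ (π' f s) = π f (κ s)) (w : FreeGroup X → Ω' → P)
        (_ : ∀ f g s, w (f * g) s = w f (π' g s) * w g s)
        (_ : ∀ i s, ¬ (i = i0 ∧ κ s = y0) → w (FreeGroup.of i) s = 1),
        ∀ s, κ s = ω₀ → w (FreeGroup.mk t) s = 1 := by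
    intro t
    induction t with
    | nil =>
      intro _
      rw [← FreeGroup.one_eq_mk]
      refine ⟨by simp [ω₀], ?_⟩
      intro Ω' P _ π' κ hκ w hw hw1 s hs
      have := hw 1 1 s
      simpa using this
    | cons a t ih =>
      intro hu
      obtain ⟨i, b⟩ := a
      have hu' : ∀ u ∈ t.tails, cs u ∈ Y := fun u hh => hu u (by simp at hh ⊢; exact Or.inr hh)
      obtain ⟨ih1, ih2⟩ := ih hu'
      have ht1 : cs ((i,b)::t) ∈ Y := hu _ (by simp)
      have hcs : cs ((i,b)::t) = (if b then FreeGroup.of i else (FreeGroup.of i)⁻¹) • cs t := by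
        simp only [cs]
        rw [hcons]; rfl
      rw [hcs] at ht1
      rw [hcons]
      cases b with
      | true =>
        simp only [if_true] at *
        have hst : FreeGroup.of i • ((π (FreeGroup.mk t) ω₀ : Y) : FreeGroup X ⧸ H) ∈ Y := by
          rw [ih1]; exact ht1
        refine ⟨?_, ?_⟩
        · rw [map_mul, Equiv.Perm.mul_apply, hπ i _ hst, hcs]
          exact congrArg (fun c => FreeGroup.of i • c) ih1
        · intro Ω' P _ π' κ hκ w hw hw1 s hs
          rw [hw, ih2 Ω' P π' κ hκ w hw hw1 s hs, mul_one]
          apply hw1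
          rintro ⟨rfl, h2⟩
          rw [hκ, hs] at h2
          rw [h2] at hst
          exact hy0 hst
      | false =>
        simp only [Bool.false_eq_true, if_false] at *
        set z : Y := ⟨_, ht1⟩ with hz
        have hst : FreeGroup.of i • (z : FreeGroup X ⧸ H) ∈ Y := by
          rw [hz, smul_inv_smul]; exact hu' t (by cases t <;> simp)
        have h1 : π (FreeGroup.of i) z = π (FreeGroup.mk t) ω₀ := by
          rw [hπ i z hst]
          ext
          rw [ih1]; simp [hz]
        have h3 : π (FreeGroup.of i)⁻¹ (π (FreeGroup.mk t) ω₀) = z := by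
          rw [← h1, map_inv]; simp
        refine ⟨?_, ?_⟩
        · rw [map_mul, Equiv.Perm.mul_apply, h3, hcs]
        · intro Ω' P _ π' κ hκ w hw hw1 s hs
          rw [hw, ih2 Ω' P π' κ hκ w hw hw1 s hs, mul_one]
          set r := π' (FreeGroup.mk t) s with hr
          have h4 : κ (π' (FreeGroup.of i)⁻¹ r) = z := by
            rw [hκ, hr, hκ, hs, h3]
          have h5 : w (FreeGroup.of i) (π' (FreeGroup.of i)⁻¹ r) = 1 := by
            apply hw1
            rintro ⟨rfl, h6⟩
            rw [h4] at h6
            rw [h6] at hst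
            exact hy0 hst
          have h6 := hw (FreeGroup.of i) (FreeGroup.of i)⁻¹ r
          rw [h5, one_mul, mul_inv_cancel] at h6
          rw [← h6]
          have := hw 1 1 r
          simpa using this
  -- reach y0
  have hreach : ∃ p1, π p1 ω₀ = y0 := by
    obtain ⟨y, t, ht, rfl⟩ := y0
    refine ⟨FreeGroup.mk t, Subtype.ext (hpath t ?_).1⟩
    intro u hu
    rcases ht with ht | ht
    · rw [Set.mem_singleton_iff] at ht
      subst ht
      simp at hu
      rw [hu]; exact hb
    · simp only [Set.mem_iUnion, Set.mem_ofPred_eq] at ht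
      obtain ⟨s, hs, ht⟩ := ht
      refine ⟨u, Or.inr ?_, rfl⟩
      simp only [Set.mem_iUnion, Set.mem_ofPred_eq]
      refine ⟨s, hs, ?_⟩
      rw [List.mem_tails] at *
      exact hu.trans ht
  obtain ⟨p1, hp1⟩ := hreach
  refine ⟨Y, inferInstance, π, ω₀, i0, p1, ?_⟩
  intro Ω' P _ π' κ hκ w hw hw1
  rw [hp1] at hw1
  have hw11 : ∀ s, w 1 s = 1 := fun s => by
    have := hw 1 1 s
    simpa using this
  intro h hh
  rw [← hS] at hh
  have key : π h ω₀ = ω₀ ∧ ∀ s, κ s = ω₀ → w h s = 1 := by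
    induction hh using Subgroup.closure_induction with
    | mem x hx =>
      have ht : ∀ u ∈ (FreeGroup.toWord x).tails, cs u ∈ Y := by
        intro u hu
        refine ⟨u, Or.inr ?_, rfl⟩
        simp only [Set.mem_iUnion, Set.mem_ofPred_eq]
        exact ⟨x, hx, hu⟩
      obtain ⟨a1, a2⟩ := hpath _ ht
      rw [FreeGroup.mk_toWord] at a1 a2
      refine ⟨Subtype.ext ?_, fun s hs => a2 Ω' P π' κ hκ w hw hw1 s hs⟩
      rw [a1]
      change ((FreeGroup.mk (FreeGroup.toWord x) : FreeGroup X) : FreeGroup X ⧸ H) = ((FreeGroup.mk [] : FreeGroup X) : FreeGroup X ⧸ H)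
      rw [FreeGroup.mk_toWord, ← FreeGroup.one_eq_mk, eq_comm, QuotientGroup.eq, inv_one, one_mul, ← hS]
      exact Subgroup.subset_closure hx
    | one => exact ⟨by simp, fun s _ => hw11 s⟩
    | mul a b _ _ ha hb =>
      refine ⟨by rw [map_mul, Equiv.Perm.mul_apply, hb.1, ha.1], fun s hs => ?_⟩
      rw [hw, hb.2 s hs, ha.2 _ (by rw [hκ, hs, hb.1]), one_mul]
    | inv a _ ha =>
      have h1 : π a⁻¹ ω₀ = ω₀ := by
        rw [map_inv, Equiv.Perm.inv_eq_iff_eq, ha.1]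
      refine ⟨h1, fun s hs => ?_⟩
      have := hw a a⁻¹ s
      rw [ha.2 _ (by rw [hκ, hs, h1]), mul_inv_cancel, hw11, one_mul] at this
      exact this.symm
  intro s hs
  exact ⟨by rw [hκ, hs, key.1], key.2 s hs⟩

end hall
end KP

namespace KP
section step8
variable {X : Type*}

theorem step8 (H : Subgroup (FreeGroup X)) (hfg : H.FG) (hinf : ¬ H.FiniteIndex) :
    ∃ (K₀ : Subgroup (FreeGroup X)) (c : FreeGroup X), K₀.FiniteIndex ∧
      ∀ (E : Subgroup (FreeGroup X)) [E.Normal] [E.FiniteIndex], E ≤ K₀ →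
      ∀ b ∈ K₀, (∀ k : ℤ, b * c ^ k ∉ E) →
      ∃ τ : E →* FreeGroup (Fin 2), (∀ e : E, (e : FreeGroup X) ∈ H → τ e = 1) ∧
        ∃ (e1 e2 : E) (m1 m2 : ℚ), m1 ≠ 0 ∧ m2 ≠ 0 ∧
          hab (τ e1) = Pi.single 0 m1 ∧ hab (τ e2) = Pi.single 1 m2 := by
  classical
  obtain ⟨Ω, hΩ, π, ω₀, i0, p1, hkey⟩ := hall_rep H hfg hinf
  haveI := hΩ
  refine ⟨π.ker, p1⁻¹ * FreeGroup.of i0 * p1, inferInstance, ?_⟩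
  intro E hEn hEf hEK b hbK hb
  let π' : FreeGroup X →* Equiv.Perm (FreeGroup X ⧸ E) := MulAction.toPermHom _ _
  have hπ' : ∀ f s, π' f s = f • s := fun f s => rfl
  let κ : FreeGroup X ⧸ E → Ω := Quotient.lift (fun f => π f ω₀) (by
    intro a b hab
    have h1 : a⁻¹ * b ∈ E := QuotientGroup.leftRel_apply.1 hab
    have h2 : π (a⁻¹ * b) = 1 := hEK h1
    have h3 : b = a * (a⁻¹ * b) := by group
    show π a ω₀ = π b ω₀
    rw [h3, map_mul, h2, mul_one])
  have hκ0 : ∀ f : FreeGroup X, κ (f : FreeGroup X ⧸ E) = π f ω₀ := fun f => rfl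
  have hκ : ∀ f s, κ (π' f s) = π f (κ s) := by
    intro f s
    induction s using QuotientGroup.induction_on with
    | H z =>
      change κ ((f * z : FreeGroup X) : FreeGroup X ⧸ E) = _
      rw [hκ0, hκ0, map_mul, Equiv.Perm.mul_apply]
  set x := FreeGroup.of i0 with hx
  let s1 : FreeGroup X ⧸ E := (p1 : FreeGroup X)
  let s2 : FreeGroup X ⧸ E := ((p1 * b : FreeGroup X))
  -- separation of orbits
  have hc : ∀ k : ℕ, (p1⁻¹ * x * p1) ^ k = p1⁻¹ * x ^ k * p1 := fun k => by
    have := conj_pow (i := k) (a := p1⁻¹) (b := x)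
    simpa using this
  have hs12 : ∀ k : ℕ, x ^ k • s1 ≠ s2 := by
    intro k h
    have h1 : ((x ^ k * p1 : FreeGroup X) : FreeGroup X ⧸ E) = ((p1 * b : FreeGroup X) : FreeGroup X ⧸ E) := h
    rw [eq_comm, QuotientGroup.eq] at h1
    apply hb (-k)
    have h2 := E.inv_mem h1
    have h3 := hEn.conj_mem _ h2 b
    rw [zpow_neg, zpow_natCast, hc]
    convert h3 using 1
    group
  have hs21 : ∀ k : ℕ, x ^ k • s2 ≠ s1 := by
    intro k h
    have h1 : ((x ^ k * (p1 * b) : FreeGroup X) : FreeGroup X ⧸ E) = ((p1 : FreeGroup X) : FreeGroup X ⧸ E) := h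
    rw [eq_comm, QuotientGroup.eq] at h1
    apply hb k
    have h3 := hEn.conj_mem _ h1 b
    rw [zpow_natCast, hc]
    convert h3 using 1
    group
  obtain ⟨w, hw0, hwm⟩ := cross (P := FreeGroup (Fin 2)) π'
    (fun i s => if i = i0 ∧ s = s1 then FreeGroup.of 0 else if i = i0 ∧ s = s2 then FreeGroup.of 1 else 1)
  have hlab : ∀ i s, ¬ (i = i0 ∧ κ s = π p1 ω₀) → w (FreeGroup.of i) s = 1 := by
    intro i s h
    rw [hw0, if_neg, if_neg]
    · rintro ⟨rfl, rfl⟩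
      apply h
      refine ⟨rfl, ?_⟩
      rw [hκ0, map_mul, Equiv.Perm.mul_apply, (MonoidHom.mem_ker.1 hbK : π b = 1)]; rfl
    · rintro ⟨rfl, rfl⟩
      exact h ⟨rfl, rfl⟩
  have hkill := hkey (FreeGroup X ⧸ E) (FreeGroup (Fin 2)) π' κ hκ w hwm hlab
  have hEs : ∀ e ∈ E, ∀ s, π' e s = s := by
    intro e he s
    induction s using QuotientGroup.induction_on with
    | H z =>
      change ((e * z : FreeGroup X) : FreeGroup X ⧸ E) = (z : FreeGroup X ⧸ E)
      rw [eq_comm, QuotientGroup.eq]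
      have := hEn.conj_mem _ he z⁻¹
      simpa [mul_assoc] using this
  let s0 : FreeGroup X ⧸ E := ((1 : FreeGroup X))
  have hw1 : ∀ s, w 1 s = 1 := fun s => by
    have := hwm 1 1 s
    simpa using this
  let τ : E →* FreeGroup (Fin 2) :=
    { toFun := fun e => w e s0
      map_one' := hw1 _
      map_mul' := fun a b => by rw [Subgroup.coe_mul, hwm, hEs _ b.2] }
  have hτ : ∀ e : E, τ e = w e s0 := fun e => rfl
  have hN : ∃ N : ℕ, 1 ≤ N ∧ x ^ N ∈ E :=
    ⟨E.index, Nat.one_le_iff_ne_zero.2 hEf.index_ne_zero, Subgroup.pow_index_mem E x⟩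
  obtain ⟨N, hN1, hNE⟩ := hN
  -- values
  have hconj : ∀ p : FreeGroup X, hab (w (p⁻¹ * x ^ N * p) s0) = hab (w (x ^ N) (p : FreeGroup X ⧸ E)) := by
    intro p
    have hp : π' p s0 = (p : FreeGroup X ⧸ E) := by
      change ((p * 1 : FreeGroup X) : FreeGroup X ⧸ E) = _
      rw [mul_one]
    rw [hwm, hwm, hp, hEs _ hNE]
    have h1 := hwm p p⁻¹ (p : FreeGroup X ⧸ E)
    have h2 : π' p⁻¹ (p : FreeGroup X ⧸ E) = s0 := by
      change ((p⁻¹ * p : FreeGroup X) : FreeGroup X ⧸ E) = _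
      rw [inv_mul_cancel]
    rw [h2, mul_inv_cancel, hw1] at h1
    have h3 : w p⁻¹ (p : FreeGroup X ⧸ E) = (w p s0)⁻¹ := (inv_eq_of_mul_eq_one_right h1.symm).symm
    rw [h3, hab_mul, hab_mul, hab_inv]; abel
  have hpow : ∀ (n : ℕ) (s : FreeGroup X ⧸ E), hab (w (x ^ n) s) =
      ∑ j ∈ Finset.range n, hab (w x (x ^ j • s)) := by
    intro n s
    induction n with
    | zero => simp [hw1, hab_one]
    | succ n ih => rw [pow_succ', hwm, hab_mul, ih, Finset.sum_range_succ, hπ', add_comm]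
  have hval1 : ∀ j : ℕ, hab (w x (x ^ j • s1)) = if x ^ j • s1 = s1 then Pi.single 0 1 else 0 := by
    intro j
    rw [hx, hw0, ← hx]
    by_cases h : x ^ j • s1 = s1
    · rw [if_pos ⟨rfl, h⟩, if_pos h, hab_of]
    · rw [if_neg (fun h' => h h'.2), if_neg (fun h' => hs12 j h'.2), if_neg h, hab_one]
  have hs12' : s1 ≠ s2 := by simpa using hs12 0
  have hval2 : ∀ j : ℕ, hab (w x (x ^ j • s2)) = if x ^ j • s2 = s2 then Pi.single 1 1 else 0 := by
    intro j
    rw [hx, hw0, ← hx]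
    rw [if_neg (fun h' => hs21 j h'.2)]
    by_cases h : x ^ j • s2 = s2
    · rw [if_pos ⟨rfl, h⟩, if_pos h, hab_of]
    · rw [if_neg (fun h' => h h'.2), if_neg h, hab_one]
  have hsum : ∀ (s : FreeGroup X ⧸ E) (t : Fin 2), ∃ m : ℚ, m ≠ 0 ∧
      ∑ j ∈ Finset.range N, (if x ^ j • s = s then (Pi.single t 1 : Fin 2 → ℚ) else 0) = Pi.single t m := by
    intro s t
    refine ⟨((Finset.range N).filter (fun j => x ^ j • s = s)).card, ?_, ?_⟩
    · have : 0 ∈ (Finset.range N).filter (fun j => x ^ j • s = s) := by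
        simp; omega
      have := Finset.card_pos.2 ⟨0, this⟩
      exact_mod_cast this.ne'
    · rw [← Finset.sum_filter, Finset.sum_const]
      ext u
      simp [Pi.single_apply]
  obtain ⟨m1, hm1, hm1'⟩ := hsum s1 0
  obtain ⟨m2, hm2, hm2'⟩ := hsum s2 1
  have hmem : ∀ p : FreeGroup X, p⁻¹ * x ^ N * p ∈ E := fun p => by
    simpa using hEn.conj_mem _ hNE p⁻¹
  refine ⟨τ, fun e he => (hkill e he s0 ?_).2, ⟨_, hmem p1⟩, ⟨_, hmem (p1 * b)⟩, m1, m2, hm1, hm2, ?_, ?_⟩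
  · rw [hκ0, map_one]; rfl
  · rw [hτ, hconj p1, hpow, ← hm1']
    exact Finset.sum_congr rfl fun j _ => hval1 j
  · rw [hτ, hconj (p1 * b), hpow, ← hm2']
    exact Finset.sum_congr rfl fun j _ => hval2 j

end step8
end KP

namespace KP
section generic

/-- polynomial functions -/
def IsPoly {σ : Type*} (f : (σ → ℚ) → ℚ) : Prop := ∃ p : MvPolynomial σ ℚ, ∀ v, f v = MvPolynomial.eval v p

section
variable {σ : Type*}
lemma IsPoly.const (c : ℚ) : IsPoly (fun _ : σ → ℚ => c) := ⟨MvPolynomial.C c, fun v => by simp⟩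
lemma IsPoly.var (i : σ) : IsPoly (fun v : σ → ℚ => v i) := ⟨MvPolynomial.X i, fun v => by simp⟩
lemma IsPoly.add {f g : (σ → ℚ) → ℚ} (hf : IsPoly f) (hg : IsPoly g) : IsPoly (fun v => f v + g v) := by
  obtain ⟨p, hp⟩ := hf
  obtain ⟨q, hq⟩ := hg
  exact ⟨p + q, fun v => by simp [hp, hq]⟩
lemma IsPoly.mul {f g : (σ → ℚ) → ℚ} (hf : IsPoly f) (hg : IsPoly g) : IsPoly (fun v => f v * g v) := by
  obtain ⟨p, hp⟩ := hf
  obtain ⟨q, hq⟩ := hg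
  exact ⟨p * q, fun v => by simp [hp, hq]⟩
lemma IsPoly.sum {ι : Type*} (s : Finset ι) {f : ι → (σ → ℚ) → ℚ} (hf : ∀ i, IsPoly (f i)) :
    IsPoly (fun v => ∑ i ∈ s, f i v) := by
  choose p hp using hf
  exact ⟨∑ i ∈ s, p i, fun v => by simp [hp]⟩
lemma IsPoly.prod {ι : Type*} (s : Finset ι) {f : ι → (σ → ℚ) → ℚ} (hf : ∀ i, IsPoly (f i)) :
    IsPoly (fun v => ∏ i ∈ s, f i v) := by
  choose p hp using hf
  exact ⟨∏ i ∈ s, p i, fun v => by simp [hp]⟩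
lemma IsPoly.lin {X : Type*} [Fintype X] [DecidableEq X] {A : (σ → ℚ) → X → ℚ}
    (hA : ∀ x, IsPoly (fun v => A v x)) (L : (X → ℚ) →ₗ[ℚ] ℚ) : IsPoly (fun v => L (A v)) := by
  have : (fun v => L (A v)) = fun v => ∑ x, A v x * L (Pi.single x 1) := by
    funext v
    conv_lhs => rw [pi_eq_sum_univ' (A v)]
    rw [map_sum]
    apply Finset.sum_congr rfl
    intro x _
    rw [map_smul, smul_eq_mul]
  rw [this]
  exact IsPoly.sum _ fun x => (hA x).mul (IsPoly.const _)
lemma IsPoly.det {n : Type*} [Fintype n] [DecidableEq n] {A : (σ → ℚ) → Matrix n n ℚ}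
    (hA : ∀ i j, IsPoly (fun v => A v i j)) : IsPoly (fun v => (A v).det) := by
  simp only [Matrix.det_apply']
  exact IsPoly.sum _ fun s => (IsPoly.const _).mul (IsPoly.prod _ fun i => hA _ _)

lemma exists_int_point {ι : Type*} [Fintype ι] {f : ι → (σ → ℚ) → ℚ} (hf : ∀ i, IsPoly (f i))
    (hne : ∀ i, ∃ v, f i v ≠ 0) : ∃ v : σ → ℤ, ∀ i, f i (fun s => (v s : ℚ)) ≠ 0 := by
  choose p hp using hf
  by_contra hcon
  push Not at hcon
  have h0 : ∏ i, p i = 0 := by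
    apply MvPolynomial.funext_set (fun _ => Set.range (Int.cast : ℤ → ℚ))
      (fun _ => Set.infinite_range_of_injective Int.cast_injective)
    intro x hx
    choose v hv using fun s => hx s (Set.mem_univ s)
    have hv' : (fun s => (v s : ℚ)) = x := funext hv
    obtain ⟨i, hi⟩ := hcon v
    rw [hv', hp] at hi
    rw [map_prod, map_zero]
    exact Finset.prod_eq_zero (Finset.mem_univ i) hi
  obtain ⟨i, _, hi⟩ := Finset.prod_eq_zero_iff.1 h0
  obtain ⟨v, hv⟩ := hne i
  rw [hp, hi, map_zero] at hv
  exact hv rfl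
end

variable {X : Type*} [Fintype X] [DecidableEq X]

/-- Zariski-open `GL₂`-invariant conditions on pairs of vectors. -/
structure GoodC (C : (X → ℚ) → (X → ℚ) → Prop) : Prop where
  inv : ∀ a b (p q r s : ℚ), p * s - q * r ≠ 0 → C a b → C (p • a + q • b) (r • a + s • b)
  poly : ∀ a0 b0, C a0 b0 → ∃ D : (X → ℚ) → (X → ℚ) → ℚ, D a0 b0 ≠ 0 ∧ (∀ a b, D a b ≠ 0 → C a b) ∧
    ∀ A B : (Fin 2 × X → ℚ) → X → ℚ, (∀ x, IsPoly (fun v => A v x)) → (∀ x, IsPoly (fun v => B v x)) →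
      IsPoly (fun v => D (A v) (B v))
  ex : ∃ a b, C a b

lemma GoodC.of_family {κ W : Type*} [Fintype κ] [DecidableEq κ] [AddCommGroup W] [Module ℚ W]
    (g : κ → (X → ℚ) →ₗ[ℚ] W)
    (hex : ∃ a b, LinearIndependent ℚ (fun t : κ × Fin 2 => g t.1 (![a, b] t.2))) :
    GoodC (fun a b => LinearIndependent ℚ (fun t : κ × Fin 2 => g t.1 (![a, b] t.2))) where
  ex := hex
  inv := by
    intro a b p q r s hdet h
    rw [Fintype.linearIndependent_iff] at h ⊢
    intro c hc
    have h1 := h (fun t => if t.2 = 0 then c (t.1, 0) * p + c (t.1, 1) * r else c (t.1, 0) * q + c (t.1, 1) * s) (by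
      rw [← hc, Fintype.sum_prod_type, Fintype.sum_prod_type]
      apply Finset.sum_congr rfl
      intro t _
      simp only [Fin.sum_univ_two, Matrix.cons_val_zero, Matrix.cons_val_one, map_add, map_smul]
      simp only [if_true, Fin.one_eq_zero_iff, OfNat.ofNat_ne_one, if_false]
      module)
    have h2 : ∀ t, c (t, 0) = 0 ∧ c (t, 1) = 0 := by
      intro t
      have e0 := h1 (t, 0)
      have e1 := h1 (t, 1)
      simp at e0 e1
      constructor
      · have : c (t, 0) * (p * s - q * r) = 0 := by linear_combination s * e0 - r * e1
        exact (mul_eq_zero.1 this).resolve_right hdet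
      · have : c (t, 1) * (p * s - q * r) = 0 := by linear_combination p * e1 - q * e0
        exact (mul_eq_zero.1 this).resolve_right hdet
    rintro ⟨t, u⟩
    fin_cases u
    · exact (h2 t).1
    · exact (h2 t).2
  poly := by
    intro a0 b0 h
    have hinj : LinearMap.ker (Fintype.linearCombination ℚ (fun t : κ × Fin 2 => g t.1 (![a0, b0] t.2))) = ⊥ :=
      LinearMap.ker_eq_bot.2 (LinearIndependent.fintypeLinearCombination_injective h)
    obtain ⟨T, hT⟩ := LinearMap.exists_leftInverse_of_injective _ hinj
    have hT' : ∀ t : κ × Fin 2, T (g t.1 (![a0, b0] t.2)) = Pi.single t 1 := by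
      intro t
      have := DFunLike.congr_fun hT (Pi.single t 1)
      simpa [Fintype.linearCombination_apply_single] using this
    refine ⟨fun a b => (Matrix.of fun t u => T (g t.1 (![a, b] t.2)) u : Matrix (κ × Fin 2) (κ × Fin 2) ℚ).det, ?_, ?_, ?_⟩
    · have : (Matrix.of fun t u => T (g t.1 (![a0, b0] t.2)) u : Matrix (κ × Fin 2) (κ × Fin 2) ℚ) = 1 := by
        ext t u
        rw [Matrix.of_apply, hT', Matrix.one_apply, Pi.single_apply]
        simp [eq_comm]
      change Matrix.det _ ≠ 0
      rw [this]; simp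
    · intro a b hD
      have := Matrix.linearIndependent_rows_of_det_ne_zero hD
      exact LinearIndependent.of_comp T this
    · intro A B hA hB
      apply IsPoly.det
      rintro ⟨t, ε⟩ u
      fin_cases ε
      · exact IsPoly.lin hA (LinearMap.proj u ∘ₗ T ∘ₗ g t)
      · exact IsPoly.lin hB (LinearMap.proj u ∘ₗ T ∘ₗ g t)

theorem generic {ι : Type*} [Fintype ι] (C : ι → (X → ℚ) → (X → ℚ) → Prop) (hC : ∀ i, GoodC (C i))
    (i0 i1 : X) (hi : i0 ≠ i1) :
    ∃ c d : X → ℤ, c i0 = 1 ∧ c i1 = 0 ∧ d i0 = 0 ∧ d i1 = 1 ∧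
      ∀ i, C i (fun x => (c x : ℚ)) (fun x => (d x : ℚ)) := by
  let chA : (Fin 2 × X → ℚ) → X → ℚ := fun v x => if x = i0 then 1 else if x = i1 then 0 else v (0, x)
  let chB : (Fin 2 × X → ℚ) → X → ℚ := fun v x => if x = i0 then 0 else if x = i1 then 1 else v (1, x)
  have hchA : ∀ x, IsPoly (fun v => chA v x) := by
    intro x
    by_cases h : x = i0
    · simp only [chA, h, if_true]; exact IsPoly.const _
    · by_cases h' : x = i1
      · simp only [chA, h, h', hi.symm, if_true, if_false]; exact IsPoly.const _
      · simp only [chA, h, h', if_false]; exact IsPoly.var _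
  have hchB : ∀ x, IsPoly (fun v => chB v x) := by
    intro x
    by_cases h : x = i0
    · simp only [chB, h, if_true]; exact IsPoly.const _
    · by_cases h' : x = i1
      · simp only [chB, h, h', hi.symm, if_true, if_false]; exact IsPoly.const _
      · simp only [chB, h, h', if_false]; exact IsPoly.var _
  -- each condition has a point in the chart
  have hpt : ∀ i, ∃ v, C i (chA v) (chB v) := by
    intro i
    obtain ⟨a0, b0, h0⟩ := (hC i).ex
    obtain ⟨D, hD0, hD1, hD2⟩ := (hC i).poly a0 b0 h0
    let F : Bool → (Fin 2 × X → ℚ) → ℚ := fun β v =>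
      if β then D (fun x => v (0, x)) (fun x => v (1, x))
      else v (0, i0) * v (1, i1) + (-1) * (v (0, i1) * v (1, i0))
    obtain ⟨z, hz⟩ := exists_int_point (f := F) (by
      intro β
      cases β
      · simp only [F, Bool.false_eq_true, if_false]
        exact ((IsPoly.var _).mul (IsPoly.var _)).add ((IsPoly.const _).mul ((IsPoly.var _).mul (IsPoly.var _)))
      · simp only [F, if_true]
        exact hD2 _ _ (fun x => IsPoly.var _) (fun x => IsPoly.var _)) (by
      intro β
      cases β
      · refine ⟨fun t => if t = (0, i0) then 1 else if t = (1, i1) then 1 else 0, ?_⟩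
        simp [F, hi.symm]
      · refine ⟨fun t => ![a0, b0] t.1 t.2, ?_⟩
        simpa [F] using hD0)
    set a : X → ℚ := fun x => (z (0, x) : ℚ) with ha
    set b : X → ℚ := fun x => (z (1, x) : ℚ) with hb
    have hCab : C i a b := hD1 _ _ (by simpa [F] using hz true)
    have hm : a i0 * b i1 - a i1 * b i0 ≠ 0 := by
      have := hz false
      simp only [F, Bool.false_eq_true, if_false] at this
      intro h
      apply this
      simp only [ha, hb] at h
      linarith
    set m := a i0 * b i1 - a i1 * b i0 with hmdef
    have hC2 := (hC i).inv a b (b i1 / m) (- a i1 / m) (- b i0 / m) (a i0 / m) (by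
      have : b i1 / m * (a i0 / m) - -a i1 / m * (-b i0 / m) = m / (m * m) := by
        field_simp
        rw [hmdef]; ring
      rw [this]
      exact div_ne_zero hm (mul_ne_zero hm hm)) hCab
    set a' := (b i1 / m) • a + (- a i1 / m) • b with ha'
    set b' := (- b i0 / m) • a + (a i0 / m) • b with hb'
    refine ⟨fun t => ![a', b'] t.1 t.2, ?_⟩
    have e1 : chA (fun t => ![a', b'] t.1 t.2) = a' := by
      funext x
      simp only [chA]
      split_ifs with h h'
      · rw [h, ha']; simp only [Pi.add_apply, Pi.smul_apply, smul_eq_mul]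
        field_simp; rw [hmdef]; ring
      · rw [h', ha']; simp only [Pi.add_apply, Pi.smul_apply, smul_eq_mul]
        field_simp; ring
      · rfl
    have e2 : chB (fun t => ![a', b'] t.1 t.2) = b' := by
      funext x
      simp only [chB]
      split_ifs with h h'
      · rw [h, hb']; simp only [Pi.add_apply, Pi.smul_apply, smul_eq_mul]
        field_simp; ring
      · rw [h', hb']; simp only [Pi.add_apply, Pi.smul_apply, smul_eq_mul]
        field_simp; rw [hmdef]; ring
      · rfl
    rw [e1, e2]; exact hC2
  choose v hv using hpt
  have hD := fun i => (hC i).poly _ _ (hv i)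
  choose D hD0 hD1 hD2 using hD
  obtain ⟨z, hz⟩ := exists_int_point (f := fun i v => D i (chA v) (chB v))
    (fun i => hD2 i _ _ hchA hchB) (fun i => ⟨v i, hD0 i⟩)
  refine ⟨fun x => if x = i0 then 1 else if x = i1 then 0 else z (0, x),
    fun x => if x = i0 then 0 else if x = i1 then 1 else z (1, x),
    by simp, by simp [hi.symm], by simp, by simp [hi.symm], fun i => ?_⟩
  have := hD1 i _ _ (hz i)
  convert this using 1
  · funext x; change _ = (if x = i0 then (1:ℚ) else if x = i1 then 0 else (z (0,x):ℚ)); split_ifs <;> simp_all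
  · funext x; change _ = (if x = i0 then (0:ℚ) else if x = i1 then 1 else (z (1,x):ℚ)); split_ifs <;> simp_all

end generic

section witness
variable {V : Type*} [AddCommGroup V] [Module ℚ V] [FiniteDimensional ℚ V]

lemma witnessA (g : Module.End ℚ V) (hd : 4 ≤ Module.finrank ℚ V)
    (hg : ∀ lam : ℚ, ¬ Module.finrank ℚ (LinearMap.range (g - lam • 1)) ≤ 2) :
    ∃ a b, LinearIndependent ℚ (fun t : Fin 2 × Fin 2 => (![1, g] t.1 : Module.End ℚ V) (![a, b] t.2)) := by
  obtain ⟨a, ha⟩ : ∃ a, LinearIndependent ℚ ![a, g a] := by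
    by_contra hcon
    push Not at hcon
    obtain ⟨lam, hl⟩ := LinearMap.exists_eq_smul_id_of_forall_notLinearIndependent hcon
    apply hg lam
    have h0 : g - lam • 1 = 0 := by rw [hl]; exact sub_self _
    rw [h0, LinearMap.range_zero, finrank_bot]; omega
  set E := Submodule.span ℚ (Set.range ![a, g a]) with hE
  have hEd : Module.finrank ℚ E ≤ 2 := by
    have := finrank_range_le_card (R := ℚ) ![a, g a]
    simpa [Set.finrank] using this
  have hQ : 2 ≤ Module.finrank ℚ (V ⧸ E) := by
    have := Submodule.finrank_quotient_add_finrank E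
    omega
  obtain ⟨b, hb⟩ : ∃ b, LinearIndependent ℚ ![E.mkQ b, E.mkQ (g b)] := by
    by_contra hcon
    push Not at hcon
    -- the kernel is preserved
    have hker : ∀ b ∈ E, E.mkQ (g b) = 0 := by
      intro b hb
      by_contra hne
      obtain ⟨y, hy⟩ : ∃ y : V ⧸ E, y ∉ Submodule.span ℚ {E.mkQ (g b)} := by
        by_contra hall
        push Not at hall
        have h1 : Submodule.span ℚ {E.mkQ (g b)} = ⊤ := eq_top_iff.2 fun y _ => hall y
        have h2 := finrank_span_singleton (K := ℚ) hne
        rw [h1, finrank_top] at h2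
        omega
      obtain ⟨v, rfl⟩ := Submodule.mkQ_surjective E y
      have hv0 : E.mkQ v ≠ 0 := fun h => hy (by rw [h]; exact zero_mem _)
      have hb0 : E.mkQ b = 0 := by simpa using hb
      have h1 := hcon v
      have h2 := hcon (v + b)
      rw [map_add, map_add, hb0, add_zero, map_add] at h2
      rw [LinearIndependent.pair_iff' hv0] at h1 h2
      push Not at h1 h2
      obtain ⟨s, hs⟩ := h1
      obtain ⟨t, ht⟩ := h2
      have h3 : (t - s) • E.mkQ v = E.mkQ (g b) := by rw [sub_smul, ht, hs]; abel
      have hts : t - s ≠ 0 := by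
        intro h
        rw [h, zero_smul] at h3
        exact hne h3.symm
      apply hy
      rw [Submodule.mem_span_singleton]
      exact ⟨(t - s)⁻¹, by rw [← h3, smul_smul, inv_mul_cancel₀ hts, one_smul]⟩
    let γ : Module.End ℚ (V ⧸ E) := E.liftQ (E.mkQ ∘ₗ g) (fun b hb => hker b hb)
    obtain ⟨lam, hl⟩ := LinearMap.exists_eq_smul_id_of_forall_notLinearIndependent (f := γ) (by
      intro y
      obtain ⟨v, rfl⟩ := Submodule.mkQ_surjective E y
      exact hcon v)
    apply hg lam
    refine le_trans (Submodule.finrank_mono ?_) hEd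
    rintro x ⟨y, rfl⟩
    have h1 : γ (E.mkQ y) = E.mkQ (g y) := rfl
    rw [hl] at h1
    have h2 : E.mkQ ((g - lam • 1) y) = 0 := by
      rw [LinearMap.sub_apply, map_sub, ← h1]; simp
    exact (Submodule.Quotient.mk_eq_zero E).1 h2
  refine ⟨a, b, ?_⟩
  rw [Fintype.linearIndependent_iff]
  intro c hc
  rw [Fintype.sum_prod_type] at hc
  simp only [Fin.sum_univ_two, Matrix.cons_val_zero, Matrix.cons_val_one, Module.End.one_apply] at hc
  have hmem : ∀ i, ![a, g a] i ∈ E := fun i => Submodule.subset_span ⟨i, rfl⟩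
  have ha0 : E.mkQ a = 0 := by simpa using hmem 0
  have ha1 : E.mkQ (g a) = 0 := by simpa using hmem 1
  have h1 := congrArg E.mkQ hc
  simp only [map_add, map_smul, ha0, ha1, smul_zero, zero_add, map_zero] at h1
  have h2 := (LinearIndependent.pair_iff.1 hb) _ _ h1
  rw [h2.1, h2.2] at hc
  simp only [zero_smul, add_zero] at hc
  have h3 := (LinearIndependent.pair_iff.1 ha) _ _ hc
  rintro ⟨t, u⟩
  fin_cases t <;> fin_cases u
  · exact h3.1
  · exact h2.1
  · exact h3.2
  · exact h2.2

lemma witnessB (ℓ : V →ₗ[ℚ] (Fin 2 → ℚ)) (e1 e2 : V) (m1 m2 : ℚ) (h1 : m1 ≠ 0) (h2 : m2 ≠ 0)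
    (he1 : ℓ e1 = Pi.single 0 m1) (he2 : ℓ e2 = Pi.single 1 m2) :
    ∃ a b, LinearIndependent ℚ (fun t : Fin 1 × Fin 2 => ((fun _ => ℓ) t.1 : V →ₗ[ℚ] (Fin 2 → ℚ)) (![a, b] t.2)) := by
  refine ⟨e1, e2, ?_⟩
  rw [Fintype.linearIndependent_iff]
  intro c hc
  rw [Fintype.sum_prod_type] at hc
  simp only [Fin.sum_univ_two, Finset.univ_unique, Finset.sum_singleton, Matrix.cons_val_zero,
    Matrix.cons_val_one, he1, he2] at hc
  have c0 := congrFun hc 0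
  have c1 := congrFun hc 1
  simp [h1, h2] at c0 c1
  rintro ⟨t, u⟩
  fin_cases t; fin_cases u
  · exact c0
  · exact c1

end witness
end KP

namespace KP
section cE
variable {M : Type*} [Group M] {E : Subgroup M} [E.Normal] {X : Type*}

/-- conjugation action of `M` on a free normal subgroup -/
def cE (i : E ≃* FreeGroup X) (g : M) : FreeGroup X →* FreeGroup X :=
  i.toMonoidHom.comp ((MulAut.conjNormal g).toMonoidHom.comp i.symm.toMonoidHom)

/-- inclusion of the free group -/
def thE (i : E ≃* FreeGroup X) : FreeGroup X →* M := E.subtype.comp i.symm.toMonoidHom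

lemma thE_inj (i : E ≃* FreeGroup X) : Function.Injective (thE i) :=
  E.subtype_injective.comp i.symm.injective

lemma thE_mem (i : E ≃* FreeGroup X) (e) : thE i e ∈ E := (i.symm e).2

lemma thE_i (i : E ≃* FreeGroup X) (e : E) : thE i (i e) = e := by
  change ((i.symm (i e) : E) : M) = e
  rw [i.symm_apply_apply]

lemma thE_cE (i : E ≃* FreeGroup X) (g : M) (e) : thE i (cE i g e) = g * thE i e * g⁻¹ := by
  change ((i.symm (i (MulAut.conjNormal g (i.symm e))) : E) : M) = g * (i.symm e : E) * g⁻¹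
  rw [i.symm_apply_apply, MulAut.conjNormal_apply]

lemma cE_mul (i : E ≃* FreeGroup X) (g h : M) (e) : cE i (g * h) e = cE i g (cE i h e) := by
  apply thE_inj i
  simp only [thE_cE]; group

lemma cE_mem (i : E ≃* FreeGroup X) (f : FreeGroup X) (e) : cE i (thE i f) e = f * e * f⁻¹ := by
  apply thE_inj i
  simp only [thE_cE, map_mul, map_inv]

lemma cE_pow (i : E ≃* FreeGroup X) (g : M) (m : ℕ) (e) : (cE i g)^[m] e = cE i (g ^ m) e := by
  induction m generalizing e with
  | zero =>
    apply thE_inj i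
    simp [thE_cE]
  | succ k ih =>
    rw [Function.iterate_succ_apply, ih, pow_succ, cE_mul]

lemma cE_injective (i : E ≃* FreeGroup X) (g : M) : Function.Injective (cE i g) := by
  intro a b h
  have h := congrArg (thE i) h
  rw [thE_cE, thE_cE] at h
  apply thE_inj i
  simpa using h

end cE

lemma finite_of_inf_trivial {M : Type*} [Group M] (E W : Subgroup M) [E.FiniteIndex]
    (h : ∀ x ∈ W, x ∈ E → x = 1) : (W : Set M).Finite := by
  have : Finite (M ⧸ E) := inferInstance
  apply Set.Finite.of_finite_image (f := fun x : M => (x : M ⧸ E)) (Set.toFinite _)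
  intro a ha b hb hab
  have h1 : a⁻¹ * b ∈ E := QuotientGroup.eq.1 hab
  have := h _ (W.mul_mem (W.inv_mem ha) hb) h1
  exact inv_mul_eq_one.1 this

lemma fg_of_finiteIndex_fg {G : Type*} [Group G] (H : Subgroup G) [H.FiniteIndex] (hH : H.FG) :
    Group.FG G := by
  have : Finite (G ⧸ H) := inferInstance
  rw [Group.fg_def]
  have h1 : (Subgroup.closure (Set.range (fun x : G ⧸ H => x.out))).FG :=
    (Subgroup.fg_iff _).2 ⟨_, rfl, Set.finite_range _⟩
  have h2 := hH.sup h1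
  convert h2
  symm
  rw [eq_top_iff]
  intro g _
  obtain ⟨h, hh⟩ := QuotientGroup.mk_out_eq_mul H g
  have : g = (Quotient.out (g : G ⧸ H)) * (h : G)⁻¹ := by rw [hh]; group
  rw [this]
  apply Subgroup.mul_mem
  · exact Subgroup.mem_sup_right (Subgroup.subset_closure ⟨_, rfl⟩)
  · exact Subgroup.mem_sup_left (H.inv_mem h.2)

section word
variable {X : Type*} [Fintype X] [DecidableEq X]

lemma hab_zpow' (a : FreeGroup X) (n : ℤ) : hab (a ^ n) = (n : ℚ) • hab a := by
  cases n with
  | ofNat k => simpa using hab_pow a k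
  | negSucc k =>
    rw [zpow_negSucc, hab_inv, hab_pow]
    push_cast
    rw [← neg_smul]

lemma exists_word (c : X → ℤ) (s : Finset X) : ∃ w : FreeGroup X,
    (∀ π : FreeGroup X →* FreeGroup (Fin 2), (∀ x ∈ s, π (FreeGroup.of x) = 1) → π w = 1) ∧
    hab w = ∑ x ∈ s, (c x : ℚ) • (Pi.single x 1 : X → ℚ) := by
  induction s using Finset.induction_on with
  | empty => exact ⟨1, by simp, by simp [hab_one]⟩
  | insert y s hy ih =>
    obtain ⟨w, h1, h2⟩ := ih
    refine ⟨FreeGroup.of y ^ c y * w, ?_, ?_⟩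
    · intro π hπ
      rw [map_mul, map_zpow, hπ y (Finset.mem_insert_self _ _), one_zpow, one_mul]
      exact h1 π fun x hx => hπ x (Finset.mem_insert_of_mem hx)
    · rw [hab_mul, h2, Finset.sum_insert hy, hab_zpow', hab_of]

lemma exists_word' (c : X → ℤ) (i0 i1 j : X) (hi : i0 ≠ i1) (hj : j = i0 ∨ j = i1) (hcj : c j = 1)
    (hc : ∀ x, (x = i0 ∨ x = i1) → x ≠ j → c x = 0) :
    ∃ a : FreeGroup X, (∀ π : FreeGroup X →* FreeGroup (Fin 2),
      (∀ x, x ≠ i0 → x ≠ i1 → π (FreeGroup.of x) = 1) → π a = π (FreeGroup.of j)) ∧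
    hab a = fun x => (c x : ℚ) := by
  obtain ⟨w, h1, h2⟩ := exists_word c (Finset.univ.filter fun x => x ≠ i0 ∧ x ≠ i1)
  refine ⟨FreeGroup.of j * w, ?_, ?_⟩
  · intro π hπ
    rw [map_mul, h1 π (fun x hx => hπ x (Finset.mem_filter.1 hx).2.1 (Finset.mem_filter.1 hx).2.2), mul_one]
  · rw [hab_mul, h2, hab_of]
    funext x
    simp only [Pi.add_apply, Finset.sum_apply, Pi.smul_apply, smul_eq_mul, Pi.single_apply, mul_ite,
      mul_one, mul_zero, Finset.sum_ite_eq, Finset.mem_filter, Finset.mem_univ, true_and]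
    by_cases hxj : x = j
    · subst hxj
      rw [if_pos rfl, hcj, if_neg (by tauto)]; simp
    · rw [if_neg hxj]
      by_cases hx : x = i0 ∨ x = i1
      · rw [if_neg (by tauto), hc x hx hxj]; simp
      · rw [if_pos (by tauto)]; simp
end word

section assembly
variable {M : Type*} [Group M] {E : Subgroup M} [E.Normal] [E.FiniteIndex] {X : Type*} [Fintype X] [DecidableEq X]

lemma cE_coset (i : E ≃* FreeGroup X) {W : Type*} [Fintype W] [DecidableEq W]
    (σ : FreeGroup X →* FreeGroup W) (g : M) (e) :
    hab (σ (cE i (Quotient.out (g : M ⧸ E)) e)) = hab (σ (cE i g e)) := by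
  obtain ⟨h, hh⟩ := QuotientGroup.mk_out_eq_mul E g
  rw [hh, cE_mul, ← thE_i i h, cE_mem]
  simp only [map_mul, map_inv, hab_conj]

theorem assembly (hX : 3 ≤ Fintype.card X) (i : E ≃* FreeGroup X) (n : ℕ) (Ml : Fin n → Subgroup M)
    (H1 : ∀ g : M, (∀ e, hab (cE i g e) = hab e) ∨
      ∃ a b, LinearIndependent ℚ (fun t : Fin 2 × Fin 2 =>
        (![1, indL (cE i g)] t.1 : Module.End ℚ (X → ℚ)) (![a, b] t.2)))
    (H2 : ∀ l, ∃ τ : E →* FreeGroup (Fin 2), (∀ e : E, (e : M) ∈ Ml l → τ e = 1) ∧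
      ∃ (e1 e2 : E) (m1 m2 : ℚ), m1 ≠ 0 ∧ m2 ≠ 0 ∧ hab (τ e1) = Pi.single 0 m1 ∧
        hab (τ e2) = Pi.single 1 m2) :
    ∃ V : Subgroup M, V ≠ ⊤ ∧
      (V.FG ∧ VirtuallyNonabelianFree V ∧ AlmostMalnormal V) ∧
      (∀ (l : Fin n) (m : M), ((conjSub m V ⊓ Ml l : Subgroup M) : Set M).Finite) := by
  classical
  have : Finite (M ⧸ E) := inferInstance
  obtain ⟨i0, i1, i2, h01, h02, h12⟩ := Fintype.two_lt_card_iff.1 hX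
  have hXn : Nontrivial X := ⟨i0, i1, h01⟩
  choose τ hτ e1 e2 m1 m2 hm1 hm2 he1 he2 using H2
  let P : M → Prop := fun g => ∀ e, hab (cE i g e) = hab e
  let σ : Fin n → FreeGroup X →* FreeGroup (Fin 2) := fun l => (τ l).comp i.symm.toMonoidHom
  let ι := {p : M ⧸ E // ¬ P p.out} ⊕ (Fin n × (M ⧸ E))
  have : Finite ι := inferInstance
  have : Fintype ι := Fintype.ofFinite ι
  let C : ι → (X → ℚ) → (X → ℚ) → Prop := fun t => match t with
    | Sum.inl p => fun a b => LinearIndependent ℚ (fun t : Fin 2 × Fin 2 =>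
        (![1, indL (cE i p.1.out)] t.1 : Module.End ℚ (X → ℚ)) (![a, b] t.2))
    | Sum.inr p => fun a b => LinearIndependent ℚ (fun t : Fin 1 × Fin 2 =>
        ((fun _ => indL ((σ p.1).comp (cE i p.2.out))) t.1 : (X → ℚ) →ₗ[ℚ] (Fin 2 → ℚ)) (![a, b] t.2))
  have hC : ∀ t, GoodC (C t) := by
    rintro (p | p)
    · exact GoodC.of_family (fun s : Fin 2 => (![1, indL (cE i p.1.out)] s : Module.End ℚ (X → ℚ)))
        ((H1 p.1.out).resolve_left p.2)
    · refine GoodC.of_family (fun s : Fin 1 => indL ((σ p.1).comp (cE i p.2.out))) ?_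
      have key : ∀ e : E, indL ((σ p.1).comp (cE i p.2.out)) (hab (cE i (p.2.out)⁻¹ (i e))) = hab (τ p.1 e) := by
        intro e
        rw [indL_hab]
        change hab (τ p.1 (i.symm (cE i _ (cE i _ (i e))))) = _
        rw [← cE_mul]
        congr 2
        apply i.injective
        rw [i.apply_symm_apply]
        apply thE_inj i
        simp [thE_cE]
      refine witnessB _ (hab (cE i (p.2.out)⁻¹ (i (e1 p.1)))) (hab (cE i (p.2.out)⁻¹ (i (e2 p.1))))
        (m1 p.1) (m2 p.1) (hm1 _) (hm2 _) ?_ ?_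
      · rw [key, he1]
      · rw [key, he2]
  obtain ⟨c, d, hc0, hc1, hd0, hd1, hcd⟩ := generic C hC i0 i1 h01
  obtain ⟨a, ha, hac⟩ := exists_word' c i0 i1 i0 h01 (Or.inl rfl) hc0 (by
    rintro x (rfl | rfl) h
    · exact absurd rfl h
    · exact hc1)
  obtain ⟨b, hb, hbd⟩ := exists_word' d i0 i1 i1 h01 (Or.inr rfl) hd1 (by
    rintro x (rfl | rfl) h
    · exact hd0
    · exact absurd rfl h)
  let ψ : FreeGroup (Fin 2) →* FreeGroup X := FreeGroup.lift ![a, b]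
  let π : FreeGroup X →* FreeGroup (Fin 2) := FreeGroup.lift fun x =>
    if x = i0 then FreeGroup.of 0 else if x = i1 then FreeGroup.of 1 else 1
  have hπ2 : ∀ x, x ≠ i0 → x ≠ i1 → π (FreeGroup.of x) = 1 := by
    intro x h h'
    simp [π, h, h']
  have hπψ : ∀ w, π (ψ w) = w := by
    intro w
    have : π.comp ψ = MonoidHom.id _ := by
      ext t
      fin_cases t
      · change π (FreeGroup.lift ![a, b] (FreeGroup.of 0)) = FreeGroup.of 0
        rw [FreeGroup.lift_apply_of]
        change π a = _
        rw [ha π hπ2]; simp [π]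
      · change π (FreeGroup.lift ![a, b] (FreeGroup.of 1)) = FreeGroup.of 1
        rw [FreeGroup.lift_apply_of]
        change π b = _
        rw [hb π hπ2]; simp [π, h01.symm]
    exact DFunLike.congr_fun this w
  have hψh : ∀ t, hab (ψ (FreeGroup.of t)) = ![fun x => (c x : ℚ), fun x => (d x : ℚ)] t := by
    intro t
    rw [show ψ (FreeGroup.of t) = ![a, b] t from FreeGroup.lift_apply_of]
    fin_cases t
    · exact hac
    · exact hbd
  let ρ : FreeGroup X →* FreeGroup X := ψ.comp π
  have hρψ : ∀ w, ρ (ψ w) = ψ w := fun w => by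
    change ψ (π (ψ w)) = _
    rw [hπψ]
  have hρ : ∀ e, ρ (ρ e) = ρ e := fun e => hρψ _
  have hψi : Function.Injective ψ := Function.LeftInverse.injective hπψ
  -- the dichotomy
  have dich : ∀ g : M, (∀ u, ρ u = u → ρ (cE i g u) = cE i g u) ∨
      (∀ u, ρ u = u → ρ (cE i g u) = cE i g u → u = 1) := by
    intro g
    by_cases hP : P (Quotient.out (g : M ⧸ E))
    · by_cases hex : ∀ u, ρ u = u → ρ (cE i g u) = cE i g u → u = 1
      · exact Or.inr hex
      · left
        push Not at hex
        obtain ⟨y, hy, hy', hy1⟩ := hex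
        have hgm : g ^ E.index ∈ E := Subgroup.pow_index_mem E g
        refine torelli_lemma ρ (cE i g) hρ ?_ (i ⟨_, hgm⟩) E.index
          (Nat.one_le_iff_ne_zero.2 Subgroup.FiniteIndex.index_ne_zero) ?_ ?_ hy hy1 hy'
        · intro e
          have := cE_coset i (MonoidHom.id _) g e
          simp only [MonoidHom.id_apply] at this
          rw [← this]; exact hP e
        · intro e
          rw [cE_pow, ← cE_mem i (i ⟨_, hgm⟩), thE_i]
        · apply thE_inj i
          rw [thE_cE, thE_i]
          change g * g ^ E.index * g⁻¹ = g ^ E.index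
          rw [← pow_succ', pow_succ]; group
    · right
      intro u hu hu'
      have hLI : LinearIndependent ℚ (fun t : Fin 2 × Fin 2 =>
          (![1, indL (cE i (Quotient.out (g : M ⧸ E)))] t.1 : Module.End ℚ (X → ℚ))
            (![fun x => (c x : ℚ), fun x => (d x : ℚ)] t.2)) := hcd (Sum.inl ⟨_, hP⟩)
      let Ψ : FreeGroup (Fin 2 × Fin 2) →* FreeGroup X := FreeGroup.lift fun t =>
        if t.1 = 0 then ψ (FreeGroup.of t.2) else cE i g (ψ (FreeGroup.of t.2))
      have hΨ : Function.Injective Ψ := by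
        apply injective_of_hab
        convert hLI using 2 with t
        obtain ⟨s, t⟩ := t
        rw [show Ψ (FreeGroup.of (s, t)) = _ from FreeGroup.lift_apply_of]
        fin_cases s
        · exact hψh t
        · change hab (cE i g (ψ (FreeGroup.of t))) = indL (cE i (Quotient.out (g : M ⧸ E))) (![fun x => (c x : ℚ), fun x => (d x : ℚ)] t)
          rw [← hψh, indL_hab]
          exact (cE_coset i (MonoidHom.id _) g _).symm
      have hj0 : ∀ w, Ψ (FreeGroup.map (fun t => ((0 : Fin 2), t)) w) = ψ w := by
        intro w
        have : Ψ.comp (FreeGroup.map (fun t => ((0 : Fin 2), t))) = ψ := by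
          ext t; simp [Ψ]
        exact DFunLike.congr_fun this w
      have hj1 : ∀ w, Ψ (FreeGroup.map (fun t => ((1 : Fin 2), t)) w) = cE i g (ψ w) := by
        intro w
        have : Ψ.comp (FreeGroup.map (fun t => ((1 : Fin 2), t))) = (cE i g).comp ψ := by
          ext t; simp [Ψ]
        exact DFunLike.congr_fun this w
      have hu2 : ψ (π u) = u := hu
      have hu3 : ψ (π (cE i g u)) = cE i g u := hu'
      have heq : FreeGroup.map (fun t => ((0 : Fin 2), t)) (π (cE i g u)) =
          FreeGroup.map (fun t => ((1 : Fin 2), t)) (π u) := by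
        apply hΨ
        rw [hj0, hj1, hu2, hu3]
      let κ : FreeGroup (Fin 2 × Fin 2) →* FreeGroup (Fin 2) := FreeGroup.lift fun t =>
        if t.1 = 0 then 1 else FreeGroup.of t.2
      have hk0 : ∀ w, κ (FreeGroup.map (fun t => ((0 : Fin 2), t)) w) = 1 := by
        intro w
        have : κ.comp (FreeGroup.map (fun t => ((0 : Fin 2), t))) = 1 := by
          ext t; simp [κ]
        exact DFunLike.congr_fun this w
      have hk1 : ∀ w, κ (FreeGroup.map (fun t => ((1 : Fin 2), t)) w) = w := by
        intro w
        have : κ.comp (FreeGroup.map (fun t => ((1 : Fin 2), t))) = MonoidHom.id _ := by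
          ext t; simp [κ]
        exact DFunLike.congr_fun this w
      have h5 := congrArg κ heq
      rw [hk0, hk1] at h5
      rw [← hu2, ← h5, map_one]
  have hB : ∀ l g w, τ l (i.symm (cE i g (ψ w))) = 1 → w = 1 := by
    intro l g
    have hLI : LinearIndependent ℚ (fun t : Fin 1 × Fin 2 =>
        ((fun _ => indL ((σ l).comp (cE i (Quotient.out (g : M ⧸ E))))) t.1 : (X → ℚ) →ₗ[ℚ] (Fin 2 → ℚ))
          (![fun x => (c x : ℚ), fun x => (d x : ℚ)] t.2)) := hcd (Sum.inr (l, (g : M ⧸ E)))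
    have hLI2 := hLI.comp (fun t : Fin 2 => ((0 : Fin 1), t)) (fun s t h => (Prod.mk.inj h).2)
    have hinj : Function.Injective (((σ l).comp (cE i g)).comp ψ) := by
      apply injective_of_hab
      convert hLI2 using 2 with t
      change _ = indL ((σ l).comp (cE i (Quotient.out (g : M ⧸ E)))) (![fun x => (c x : ℚ), fun x => (d x : ℚ)] t)
      rw [← hψh, indL_hab]
      exact (cE_coset i (σ l) g _).symm
    intro w hw
    apply hinj
    rw [map_one]; exact hw
  -- the subgroup U and V
  let θ : FreeGroup (Fin 2) →* M := (thE i).comp ψ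
  have hθi : Function.Injective θ := (thE_inj i).comp hψi
  let U : Subgroup M := θ.range
  have hUE : U ≤ E := by
    rintro _ ⟨w, rfl⟩
    exact thE_mem i _
  have hUmem : ∀ f, thE i f ∈ U ↔ ρ f = f := by
    intro f
    constructor
    · rintro ⟨w, hw⟩
      have : ψ w = f := thE_inj i hw
      rw [← this]; exact hρψ w
    · intro h
      exact ⟨π f, congrArg (thE i) h⟩
  have dichU : ∀ g : M, (∀ u ∈ U, g * u * g⁻¹ ∈ U) ∨ (∀ u ∈ U, g * u * g⁻¹ ∈ U → u = 1) := by
    intro g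
    rcases dich g with h | h
    · left
      rintro _ ⟨w, rfl⟩
      change g * thE i (ψ w) * g⁻¹ ∈ U
      rw [← thE_cE, hUmem]
      exact h _ (hρψ w)
    · right
      rintro _ ⟨w, rfl⟩ h2
      change g * thE i (ψ w) * g⁻¹ ∈ U at h2
      rw [← thE_cE, hUmem] at h2
      change thE i (ψ w) = 1
      rw [h _ (hρψ w) h2, map_one]
  let V : Subgroup M := Subgroup.normalizer (U : Set M)
  have hUV : U ≤ V := Subgroup.le_normalizer
  have hy1 : ψ (FreeGroup.of 0) ≠ 1 := by
    intro h
    have := hψi (h.trans (map_one ψ).symm)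
    exact FreeGroup.of_ne_one _ this
  have hVE : ∀ x ∈ V, x ∈ E → x ∈ U := by
    intro x hxV hxE
    have h1 := (Subgroup.mem_normalizer_iff.1 hxV (thE i (ψ (FreeGroup.of 0)))).1 ⟨_, rfl⟩
    have hxx : x = thE i (i ⟨x, hxE⟩) := (thE_i i ⟨x, hxE⟩).symm
    generalize i ⟨x, hxE⟩ = f at hxx
    subst hxx
    rw [← map_inv, ← map_mul, ← map_mul, hUmem] at h1
    rw [hUmem]
    exact retract_malnormal ρ hρ (hρψ _) hy1 h1
  have hVg : ∀ g, g ∉ V → ∀ u ∈ U, g * u * g⁻¹ ∈ U → u = 1 := by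
    intro g hg u hu hgu
    by_contra hu1
    apply hg
    have h1 : ∀ u ∈ U, g * u * g⁻¹ ∈ U := (dichU g).resolve_right fun h => hu1 (h u hu hgu)
    have h2 : ∀ u ∈ U, g⁻¹ * u * g⁻¹⁻¹ ∈ U := (dichU g⁻¹).resolve_right fun h => by
      have := h _ hgu (by convert hu using 1; group)
      apply hu1
      have h3 : u = g⁻¹ * (g * u * g⁻¹) * g := by group
      rw [h3, this]; group
    rw [Subgroup.mem_normalizer_iff]
    intro x
    refine ⟨h1 x, fun hx => ?_⟩
    convert h2 _ hx using 1
    group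
  have hfin : (U.subgroupOf V).FiniteIndex := by
    have h1 : (E.subgroupOf V).FiniteIndex := inferInstance
    refine Subgroup.finiteIndex_of_le (H := E.subgroupOf V) ?_
    intro x hx
    exact hVE _ x.2 hx
  have hUfree : Nonempty (U.subgroupOf V ≃* FreeGroup (Fin 2)) :=
    ⟨(Subgroup.subgroupOfEquivOfLe hUV).trans (MonoidHom.ofInjective hθi).symm⟩
  refine ⟨V, ?_, ⟨?_, ?_, ?_⟩, ?_⟩
  · intro htop
    have h1 : thE i (FreeGroup.of i2) ∈ U := hVE _ (by rw [htop]; trivial) (thE_mem i _)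
    rw [hUmem] at h1
    have h2 : π (FreeGroup.of i2) = 1 := hπ2 _ h02.symm h12.symm
    have h3 : ρ (FreeGroup.of i2) = 1 := by
      change ψ (π _) = 1
      rw [h2, map_one]
    rw [h3] at h1
    exact FreeGroup.of_ne_one _ h1.symm
  · rw [← Group.fg_iff_subgroup_fg]
    apply fg_of_finiteIndex_fg (U.subgroupOf V)
    rw [← Group.fg_iff_subgroup_fg]
    obtain ⟨j⟩ := hUfree
    exact Group.fg_of_surjective (f := j.symm.toMonoidHom) j.symm.surjective
  · exact ⟨U.subgroupOf V, hfin, 2, le_rfl, hUfree⟩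
  · intro g hg
    apply finite_of_inf_trivial E
    rintro x ⟨hx, v, hv, hvx⟩ hxE
    have hvx' : g * v * g⁻¹ = x := hvx
    have hvE : v ∈ E := by
      have : v = g⁻¹ * x * g⁻¹⁻¹ := by rw [← hvx']; group
      rw [this]; exact Subgroup.Normal.conj_mem inferInstance _ hxE _
    have := hVg g hg v (hVE v hv hvE) (by rw [hvx']; exact hVE x hx hxE)
    rw [← hvx', this]; group
  · intro l m
    apply finite_of_inf_trivial E
    rintro x ⟨⟨v, hv, hvx⟩, hxl⟩ hxE
    have hvx' : m * v * m⁻¹ = x := hvx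
    have hvE : v ∈ E := by
      have : v = m⁻¹ * x * m⁻¹⁻¹ := by rw [← hvx']; group
      rw [this]; exact Subgroup.Normal.conj_mem inferInstance _ hxE _
    obtain ⟨w, hw⟩ := hVE v hv hvE
    have hw' : thE i (ψ w) = v := hw
    have hx2 : thE i (cE i m (ψ w)) = x := by rw [thE_cE, hw', hvx']
    have h1 := hτ l (i.symm (cE i m (ψ w))) (by
      change thE i (cE i m (ψ w)) ∈ Ml l
      rw [hx2]; exact hxl)
    have h2 := hB l m w h1
    rw [← hvx', ← hw', h2]; simp
end assembly
end KP

namespace KP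

lemma finite_of_fg_freeGroup (α : Type*) (h : Group.FG (FreeGroup α)) : Finite α := by
  classical
  have supp : ∀ w : FreeGroup α, ∃ T : Finset α, w ∈ Subgroup.closure (FreeGroup.of '' (T : Set α)) := by
    intro w
    induction w using FreeGroup.induction_on with
    | C1 => exact ⟨∅, Subgroup.one_mem _⟩
    | of x => exact ⟨{x}, Subgroup.subset_closure ⟨x, by simp, rfl⟩⟩
    | inv_of x hx =>
      obtain ⟨T, hT⟩ := hx
      exact ⟨T, Subgroup.inv_mem _ hT⟩
    | mul x y hx hy =>
      obtain ⟨T, hT⟩ := hx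
      obtain ⟨T', hT'⟩ := hy
      refine ⟨T ∪ T', Subgroup.mul_mem _ ?_ ?_⟩
      · exact Subgroup.closure_mono (Set.image_mono (by simp)) hT
      · exact Subgroup.closure_mono (Set.image_mono (by simp)) hT'
  choose T hT using supp
  obtain ⟨S, hS, hSf⟩ := Group.fg_iff.1 h
  let A : Finset α := hSf.toFinset.biUnion T
  have h1 : Subgroup.closure (FreeGroup.of '' (A : Set α)) = ⊤ := by
    rw [eq_top_iff, ← hS, Subgroup.closure_le]
    intro w hw
    refine Subgroup.closure_mono (Set.image_mono ?_) (hT w)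
    exact Finset.coe_subset.2 (Finset.subset_biUnion_of_mem T (hSf.mem_toFinset.2 hw))
  let κ : FreeGroup α →* FreeGroup α := FreeGroup.lift fun x => if x ∈ A then 1 else FreeGroup.of x
  have h2 : ∀ w, κ w = 1 := by
    intro w
    have hw : w ∈ Subgroup.closure (FreeGroup.of '' (A : Set α)) := by rw [h1]; trivial
    have hle : Subgroup.closure (FreeGroup.of '' (A : Set α)) ≤ κ.ker := by
      rw [Subgroup.closure_le]
      rintro _ ⟨x, hx, rfl⟩
      have hx' : x ∈ A := hx
      change κ (FreeGroup.of x) = 1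
      simp [κ, hx']
    exact hle hw
  have h3 : ∀ x, x ∈ A := by
    intro x
    by_contra hx
    have := h2 (FreeGroup.of x)
    simp [κ, hx] at this
  exact Set.finite_univ_iff.1 (A.finite_toSet.subset fun x _ => h3 x)

lemma exists_basis (G : Type*) [Group G] [IsFreeGroup G] (h : Group.FG G) :
    ∃ n, Nonempty (G ≃* FreeGroup (Fin n)) := by
  have h1 : Group.FG (FreeGroup (IsFreeGroup.Generators G)) :=
    Group.fg_of_surjective (f := (IsFreeGroup.toFreeGroup G).toMonoidHom) (IsFreeGroup.toFreeGroup G).surjective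
  have := finite_of_fg_freeGroup _ h1
  obtain ⟨n, ⟨e⟩⟩ := Finite.exists_equiv_fin (IsFreeGroup.Generators G)
  exact ⟨n, ⟨(IsFreeGroup.toFreeGroup G).trans (FreeGroup.freeGroupCongr e)⟩⟩

lemma free_finiteIndex (n : ℕ) (hn : 2 ≤ n) (H : Subgroup (FreeGroup (Fin n))) [H.FiniteIndex] :
    ∃ m, 2 ≤ m ∧ Nonempty (H ≃* FreeGroup (Fin m)) := by
  have hfree : IsFreeGroup H := subgroupIsFreeOfIsFree H
  obtain ⟨m, ⟨e⟩⟩ := exists_basis H inferInstance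
  refine ⟨m, ?_, ⟨e⟩⟩
  by_contra hm
  have hcomm : ∀ x y : FreeGroup (Fin m), x * y = y * x := by
    interval_cases m
    · intro x y; exact Subsingleton.elim _ _
    · intro x y
      have hz : ∀ x : FreeGroup (Fin 1), x ∈ Subgroup.zpowers (FreeGroup.of (0 : Fin 1)) := by
        intro x
        induction x using FreeGroup.induction_on with
        | C1 => exact Subgroup.one_mem _
        | of x =>
          rw [Subsingleton.elim x 0]; exact Subgroup.mem_zpowers _
        | inv_of x hx => exact Subgroup.inv_mem _ hx
        | mul x y hx hy => exact Subgroup.mul_mem _ hx hy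
      obtain ⟨a, rfl⟩ := hz x
      obtain ⟨b, rfl⟩ := hz y
      simp only []
      rw [← zpow_add, ← zpow_add, add_comm]
  have hind : H.index ≠ 0 := Subgroup.FiniteIndex.index_ne_zero
  let x : Fin 2 → Fin n := Fin.castLE hn
  have hx : Function.Injective x := Fin.castLE_injective hn
  choose k hk _ hkm using fun t => Subgroup.exists_pow_mem_of_index_ne_zero hind (FreeGroup.of (x t))
  let ψ : FreeGroup (Fin 2) →* FreeGroup (Fin n) := FreeGroup.lift fun t => FreeGroup.of (x t) ^ k t
  have hψt : ∀ t, ψ (FreeGroup.of t) = FreeGroup.of (x t) ^ k t := fun t => FreeGroup.lift_apply_of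
  have hψ : Function.Injective ψ := by
    apply injective_of_hab
    rw [Fintype.linearIndependent_iff]
    intro c hc t
    have h1 := congrFun hc (x t)
    simp only [hψt, hab_pow, hab_of, Finset.sum_apply, Pi.smul_apply, smul_eq_mul, Pi.zero_apply,
      Pi.single_apply, hx.eq_iff, mul_ite, mul_one, mul_zero, Finset.sum_ite_eq, Finset.mem_univ, if_true] at h1
    have := hk t
    have h2 : (k t : ℚ) ≠ 0 := by positivity
    exact (mul_eq_zero.1 h1).resolve_right h2
  have h3 : (⟨_, hkm 0⟩ : H) * ⟨_, hkm 1⟩ = ⟨_, hkm 1⟩ * ⟨_, hkm 0⟩ := by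
    apply e.injective
    rw [map_mul, map_mul, hcomm]
  have h4 := congrArg Subtype.val h3
  have h5 : ψ (FreeGroup.of 0 * FreeGroup.of 1) = ψ (FreeGroup.of 1 * FreeGroup.of 0) := by
    rw [map_mul, map_mul, hψt, hψt]; exact h4
  have h6 := hψ h5
  revert h6
  decide

section EM
variable {M : Type*} [Group M]

lemma free_sub {F H : Subgroup M} (hle : H ≤ F) [H.FiniteIndex] {n : ℕ} (hn : 2 ≤ n)
    (φ : F ≃* FreeGroup (Fin n)) : ∃ m, 2 ≤ m ∧ Nonempty (H ≃* FreeGroup (Fin m)) := by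
  have h1 : (H.subgroupOf F).FiniteIndex := inferInstance
  let H' := (H.subgroupOf F).map (φ : F →* FreeGroup (Fin n))
  have h2 : H'.FiniteIndex := ⟨by rw [Subgroup.index_map_equiv]; exact h1.index_ne_zero⟩
  obtain ⟨m, hm, ⟨e⟩⟩ := free_finiteIndex n hn H'
  exact ⟨m, hm, ⟨(Subgroup.subgroupOfEquivOfLe hle).symm.trans
    ((Subgroup.equivMapOfInjective _ _ φ.injective).trans e)⟩⟩

lemma finiteIndex_map_thE {F : Subgroup M} [F.FiniteIndex] {X : Type*} (φ : F ≃* FreeGroup X)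
    (K : Subgroup (FreeGroup X)) [K.FiniteIndex] : (K.map (thE φ)).FiniteIndex := by
  refine ⟨?_⟩
  have : K.map (thE φ) = (K.map (φ.symm : FreeGroup X →* F)).map F.subtype := by
    rw [Subgroup.map_map]; rfl
  rw [this, Subgroup.index_map_subtype, Subgroup.index_map_equiv]
  exact mul_ne_zero Subgroup.FiniteIndex.index_ne_zero Subgroup.FiniteIndex.index_ne_zero

lemma map_thE_le {F : Subgroup M} {X : Type*} (φ : F ≃* FreeGroup X)
    (K : Subgroup (FreeGroup X)) : K.map (thE φ) ≤ F := by
  rintro _ ⟨e, _, rfl⟩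
  exact (φ.symm e).2

lemma normal_map_thE {F : Subgroup M} [F.Normal] {Y : Type*} [Fintype Y] [DecidableEq Y]
    (φ : F ≃* FreeGroup Y) (q : ℕ) : ((Kq Y q).map (thE φ)).Normal := by
  refine ⟨?_⟩
  rintro _ ⟨e, he, rfl⟩ g
  exact ⟨cE φ g e, Kq_map q (cE φ g) he, thE_cE φ g e⟩

lemma zab_zpow {Y : Type*} [Fintype Y] [DecidableEq Y] (a : FreeGroup Y) (n : ℤ) (j : Y) :
    zab (a ^ n) j = n * zab a j := by
  have h := congrFun (hab_zpow' a n) j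
  rw [Pi.smul_apply, hab_eq_zab, hab_eq_zab, smul_eq_mul] at h
  exact_mod_cast h

lemma exists_b {F : Subgroup M} [F.Normal] {Y : Type*} [Fintype Y] [DecidableEq Y] [Nontrivial Y]
    (φ : F ≃* FreeGroup Y) (q : ℕ) [Fact q.Prime] (c : M) :
    ∃ b ∈ F, ∀ k : ℤ, b * c ^ k ∉ (Kq Y q).map (thE φ) := by
  by_contra hcon
  push Not at hcon
  obtain ⟨y0, y1, hy⟩ := exists_pair_ne Y
  have hN : ((Kq Y q).map (thE φ)).Normal := normal_map_thE φ q
  set E := (Kq Y q).map (thE φ) with hE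
  have hex : ∀ y : Y, ∃ u : ℤ, (thE φ (FreeGroup.of y) : M ⧸ E) = (c : M ⧸ E) ^ u := by
    intro y
    obtain ⟨k, hk⟩ := hcon (thE φ (FreeGroup.of y)) (φ.symm _).2
    refine ⟨-k, ?_⟩
    have : ((thE φ (FreeGroup.of y) * c ^ k : M) : M ⧸ E) = 1 := (QuotientGroup.eq_one_iff _).2 hk
    rw [QuotientGroup.mk_mul, QuotientGroup.mk_zpow] at this
    rw [zpow_neg]
    exact eq_inv_of_mul_eq_one_left this
  obtain ⟨u, hu⟩ := hex y0
  obtain ⟨v, hv⟩ := hex y1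
  obtain ⟨u', hu'⟩ := Int.gcd_dvd_left u v
  obtain ⟨v', hv'⟩ := Int.gcd_dvd_right u v
  have hg := Int.gcd_eq_gcd_ab u v
  set s := Int.gcdA u v
  set t := Int.gcdB u v
  set g : ℤ := (Int.gcd u v : ℤ)
  let d : FreeGroup Y := FreeGroup.of y0 ^ s * FreeGroup.of y1 ^ t
  have hd : (thE φ d : M ⧸ E) = (c : M ⧸ E) ^ g := by
    rw [hg, zpow_add, zpow_mul, zpow_mul, ← hu, ← hv]
    simp only [d, map_mul, map_zpow, QuotientGroup.mk_mul, QuotientGroup.mk_zpow]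
  have key : ∀ (y : Y) (w w' : ℤ), (thE φ (FreeGroup.of y) : M ⧸ E) = (c : M ⧸ E) ^ w → w = g * w' →
      ∀ j, ((zab ((FreeGroup.of y)⁻¹ * d ^ w') j : ℤ) : ZMod q) = 0 := by
    intro y w w' h1 h2
    apply mem_Kq.1
    have h3 : thE φ ((FreeGroup.of y)⁻¹ * d ^ w') ∈ E := by
      rw [← QuotientGroup.eq_one_iff, map_mul, map_inv, map_zpow, QuotientGroup.mk_mul,
        QuotientGroup.mk_inv, QuotientGroup.mk_zpow, h1, hd, ← zpow_mul, ← h2, inv_mul_cancel]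
    obtain ⟨e, he, hee⟩ := h3
    rw [← thE_inj φ hee]; exact he
  have k0 := key y0 u u' hu hu'
  have k1 := key y1 v v' hv hv'
  have hof : ∀ y j : Y, zab (FreeGroup.of y) j = if j = y then 1 else 0 := by
    intro y j
    rw [zab_of, Pi.single_apply]
  simp only [zab_mul, zab_inv, zab_zpow, d, Pi.add_apply, Pi.neg_apply, hof] at k0 k1
  have a00 := k0 y0
  have a01 := k0 y1
  have a11 := k1 y1
  simp [hy, hy.symm] at a00 a01 a11
  rcases a01 with h | h
  · rw [h] at a00; simp at a00
  · rw [h] at a11; simp at a11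

lemma exists_q {F : Subgroup M} [F.Normal] [F.FiniteIndex] {Y : Type*} [Fintype Y] [DecidableEq Y]
    (φ : F ≃* FreeGroup Y) : ∃ q : ℕ, q.Prime ∧ 7 ≤ q ∧
      ∀ (g : M) (k j : Y), |zab (cE φ g (FreeGroup.of k)) j - zab (FreeGroup.of k) j| < q := by
  have : Finite (M ⧸ F) := inferInstance
  let f : (M ⧸ F) × Y × Y → ℕ := fun t =>
    (zab (cE φ t.1.out (FreeGroup.of t.2.1)) t.2.2 - zab (FreeGroup.of t.2.1) t.2.2).natAbs
  obtain ⟨N, hN⟩ := (Set.finite_range f).bddAbove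
  obtain ⟨q, hq, hqp⟩ := Nat.exists_infinite_primes (N + 7)
  refine ⟨q, hqp, by omega, ?_⟩
  intro g k j
  have h1 : zab (cE φ g (FreeGroup.of k)) j = zab (cE φ (Quotient.out (g : M ⧸ F)) (FreeGroup.of k)) j := by
    have h := congrFun (cE_coset φ (MonoidHom.id _) g (FreeGroup.of k)) j
    simp only [MonoidHom.id_apply] at h
    rw [hab_eq_zab, hab_eq_zab] at h
    exact_mod_cast h.symm
  have h2 : f ((g : M ⧸ F), k, j) ≤ N := hN ⟨_, rfl⟩
  simp only [f] at h2
  rw [h1]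
  rw [Int.abs_eq_natAbs]
  omega

end EM

section main
variable {M : Type*} [Group M]

/-- the iso from the image subgroup -/
noncomputable def iE {F : Subgroup M} [F.Normal] {Y X : Type*} [Fintype Y] [DecidableEq Y] {q : ℕ}
    (φ : F ≃* FreeGroup Y) (i : Kq Y q ≃* FreeGroup X) : (Kq Y q).map (thE φ) ≃* FreeGroup X :=
  (Subgroup.equivMapOfInjective (Kq Y q) (thE φ) (thE_inj φ)).symm.trans i

lemma thE_iE {F : Subgroup M} [F.Normal] {Y X : Type*} [Fintype Y] [DecidableEq Y] {q : ℕ}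
    (φ : F ≃* FreeGroup Y) (i : Kq Y q ≃* FreeGroup X) (e : Kq Y q) :
    thE (iE φ i) (i e) = thE φ (e : FreeGroup Y) := by
  change (((Subgroup.equivMapOfInjective (Kq Y q) (thE φ) (thE_inj φ)) (i.symm (i e)) :
    (Kq Y q).map (thE φ)) : M) = _
  rw [i.symm_apply_apply, Subgroup.coe_equivMapOfInjective_apply]

theorem dichotomy {F : Subgroup M} [F.Normal] {Y X : Type*} [Fintype Y] [DecidableEq Y]
    [Fintype X] [DecidableEq X] {q : ℕ} [Fact q.Prime] (hq : 7 ≤ q) (hY : 3 ≤ Fintype.card Y)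
    (φ : F ≃* FreeGroup Y) (i : Kq Y q ≃* FreeGroup X) [((Kq Y q).map (thE φ)).Normal]
    (hbd : ∀ (g : M) (k j : Y), |zab (cE φ g (FreeGroup.of k)) j - zab (FreeGroup.of k) j| < q) (g : M) :
    (∀ e, hab (cE (iE φ i) g e) = hab e) ∨
      ∃ a b, LinearIndependent ℚ (fun t : Fin 2 × Fin 2 =>
        (![1, indL (cE (iE φ i) g)] t.1 : Module.End ℚ (X → ℚ)) (![a, b] t.2)) := by
  let γ : FreeGroup Y ≃* FreeGroup Y := φ.symm.trans ((MulAut.conjNormal g).trans φ)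
  have hγ : ∀ e, γ e = cE φ g e := fun e => rfl
  have hact : actE i γ.toMonoidHom = indL (cE (iE φ i) g) := by
    apply endE_ext i
    intro e
    rw [actE_ab, indL_hab]
    congr 1
    apply thE_inj (iE φ i)
    rw [thE_iE, thE_cE, thE_iE, resK_coe]
    exact thE_cE φ g e
  by_cases h1 : actE i γ.toMonoidHom = 1
  · left
    intro e
    rw [← indL_hab, ← hact, h1]; rfl
  · right
    have hn : Nontrivial Y := Fintype.one_lt_card_iff_nontrivial.1 (by omega)
    have hX := card_ge i
    refine witnessA _ ?_ ?_
    · rw [Module.finrank_fintype_fun_eq_card]; omega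
    · intro lam hl
      rw [← hact] at hl
      exact h1 (rank_lemma hq hY i γ (fun k j => hbd g k j) lam hl)

end main
end KP

namespace KP

lemma fg_comap_thE {M : Type*} [Group M] {F : Subgroup M} [F.Normal] [F.FiniteIndex] {X : Type*}
    (φ : F ≃* FreeGroup X) (L : Subgroup M) (hL : L.FG) : (L.comap (thE φ)).FG := by
  have h0 : Group.FG L := (Group.fg_iff_subgroup_fg L).2 hL
  have h1 : Group.FG (F.subgroupOf L) := inferInstance
  let f : F.subgroupOf L →* L.comap (thE φ) :=
    MonoidHom.mk' (fun x => ⟨φ ⟨((x : L) : M), x.2⟩, by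
      change thE φ (φ ⟨((x : L) : M), x.2⟩) ∈ L
      rw [thE_i]
      exact (x : L).2⟩) (fun a b => by
        apply Subtype.ext
        change φ _ = φ _ * φ _
        rw [← map_mul]; rfl)
  have hf : Function.Surjective f := by
    rintro ⟨y, hy⟩
    refine ⟨⟨⟨thE φ y, hy⟩, thE_mem φ y⟩, ?_⟩
    apply Subtype.ext
    change φ ⟨thE φ y, _⟩ = y
    apply thE_inj φ
    rw [thE_i]
  rw [← Group.fg_iff_subgroup_fg]
  exact Group.fg_of_surjective (f := f) hf

theorem kap_main {M : Type*} [Group M] (hMfg : Group.FG M)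
    (hMvf : VirtuallyNonabelianFree M)
    (n : ℕ) (Ml : Fin n → Subgroup M)
    (hfg : ∀ l, (Ml l).FG) (hinf : ∀ l, ¬ (Ml l).FiniteIndex) :
    ∃ V : Subgroup M, V ≠ ⊤ ∧
      (V.FG ∧ VirtuallyNonabelianFree V ∧ AlmostMalnormal V) ∧
      (∀ (l : Fin n) (m : M), ((conjSub m V ⊓ Ml l : Subgroup M) : Set M).Finite) := by
  classical
  obtain ⟨Fa, hFa, na, hna, ⟨φa⟩⟩ := hMvf
  obtain ⟨n0, hn0, ⟨φ0⟩⟩ := free_sub (Subgroup.normalCore_le Fa) hna φa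
  set F0 := Fa.normalCore with hF0
  have hF0n : F0.Normal := inferInstance
  have hF0f : F0.FiniteIndex := inferInstance
  -- step 8
  have hs8 := fun l => step8 ((Ml l).comap (thE φ0)) (fg_comap_thE φ0 _ (hfg l)) (by
    intro h
    apply hinf l
    have := finiteIndex_map_thE φ0 ((Ml l).comap (thE φ0))
    exact Subgroup.finiteIndex_of_le (Subgroup.map_comap_le (thE φ0) (Ml l)))
  choose K c hK hKE using hs8
  -- F1
  have hiI : (⨅ l, (K l).map (thE φ0)).FiniteIndex :=
    Subgroup.finiteIndex_iInf fun l => finiteIndex_map_thE φ0 (K l)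
  let F1 : Subgroup M := (F0 ⊓ ⨅ l, (K l).map (thE φ0)).normalCore
  have hF1n : F1.Normal := inferInstanceAs (Subgroup.normalCore _).Normal
  have hF1f : F1.FiniteIndex := inferInstanceAs (Subgroup.normalCore _).FiniteIndex
  have hF1le : F1 ≤ F0 ⊓ ⨅ l, (K l).map (thE φ0) := Subgroup.normalCore_le _
  obtain ⟨n1, hn1, ⟨φ1⟩⟩ := free_sub (hF1le.trans inf_le_left) hn0 φ0
  have hnt1 : Nontrivial (Fin n1) := Fin.nontrivial_iff_two_le.2 hn1
  have : Fact (Nat.Prime 7) := ⟨by norm_num⟩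
  -- F
  obtain ⟨n2, hn2, ⟨i2⟩⟩ := free_finiteIndex n1 hn1 (Kq (Fin n1) 7)
  let F : Subgroup M := (Kq (Fin n1) 7).map (thE φ1)
  have hFn : F.Normal := normal_map_thE φ1 7
  have hFf : F.FiniteIndex := finiteIndex_map_thE φ1 _
  have hFle : F ≤ F1 := map_thE_le φ1 _
  let φ : F ≃* FreeGroup (Fin n2) := iE φ1 i2
  have hn2' : 3 ≤ Fintype.card (Fin n2) := by
    have := card_ge i2
    omega
  have hnt2 : Nontrivial (Fin n2) := Fin.nontrivial_iff_two_le.2 hn2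
  -- E
  obtain ⟨q, hqp, hq7, hbd⟩ := exists_q φ
  have : Fact q.Prime := ⟨hqp⟩
  obtain ⟨n3, hn3, ⟨i3⟩⟩ := free_finiteIndex n2 hn2 (Kq (Fin n2) q)
  let E : Subgroup M := (Kq (Fin n2) q).map (thE φ)
  have hEn : E.Normal := normal_map_thE φ q
  have hEf : E.FiniteIndex := finiteIndex_map_thE φ _
  have hEle : E ≤ F := map_thE_le φ _
  have hX : 3 ≤ Fintype.card (Fin n3) := by
    have := card_ge i3
    omega
  refine assembly (E := E) hX (iE φ i3) n Ml (dichotomy hq7 hn2' φ i3 hbd) ?_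
  intro l
  have hFK : ∀ x, thE φ0 x ∈ F → x ∈ K l := by
    intro x hx
    have h1 := (hF1le (hFle hx)).2
    obtain ⟨y, hy, hyx⟩ := (Subgroup.mem_iInf.1 h1) l
    rw [← thE_inj φ0 hyx]; exact hy
  have hFF0 : F ≤ F0 := fun x hx => (hF1le (hFle hx)).1
  let E' : Subgroup (FreeGroup (Fin n0)) := E.comap (thE φ0)
  have hE'n : E'.Normal := inferInstanceAs (Subgroup.comap _ _).Normal
  have hE'f : E'.FiniteIndex := ⟨by
    rw [Subgroup.index_comap]
    exact Subgroup.FiniteIndex.index_ne_zero (H := E.subgroupOf (thE φ0).range)⟩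
  obtain ⟨b, hbF, hb⟩ := exists_b φ q (thE φ0 (c l))
  have hb0 : thE φ0 (φ0 ⟨b, hFF0 hbF⟩) = b := thE_i φ0 ⟨b, hFF0 hbF⟩
  obtain ⟨τ, hτ, e1, e2, m1, m2, hm1, hm2, he1, he2⟩ := hKE l E' (fun x hx => hFK x (hEle hx))
    (φ0 ⟨b, hFF0 hbF⟩) (hFK _ (by rw [hb0]; exact hbF)) (by
      intro k hk
      apply hb k
      have hk' : thE φ0 (φ0 ⟨b, hFF0 hbF⟩ * c l ^ k) ∈ E := hk
      rw [map_mul, map_zpow, hb0] at hk'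
      exact hk')
  let f : E →* E' :=
    MonoidHom.mk' (fun x => ⟨φ0 ⟨(x : M), hFF0 (hEle x.2)⟩, by
      change thE φ0 (φ0 ⟨(x : M), _⟩) ∈ E
      rw [thE_i]
      exact x.2⟩) (fun a b => by
        apply Subtype.ext
        change φ0 _ = φ0 _ * φ0 _
        rw [← map_mul]; rfl)
  have hf : ∀ e : E', f ⟨thE φ0 e, e.2⟩ = e := by
    intro e
    apply Subtype.ext
    apply thE_inj φ0
    change thE φ0 (φ0 ⟨thE φ0 e, _⟩) = _
    rw [thE_i]
  refine ⟨τ.comp f, ?_, ⟨thE φ0 e1, e1.2⟩, ⟨thE φ0 e2, e2.2⟩, m1, m2, hm1, hm2, ?_, ?_⟩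
  · intro e he
    apply hτ
    change thE φ0 (φ0 ⟨(e : M), _⟩) ∈ Ml l
    rw [thE_i]; exact he
  · rw [MonoidHom.comp_apply, hf, he1]
  · rw [MonoidHom.comp_apply, hf, he2]
end KP

/-- Theorem 4.1 (kap1): given a finitely generated, virtually non-abelian free
group `M` and finitely many finitely generated subgroups `M₁, …, Mₙ` of infinite
index in `M`, there is a proper subgroup `V` of `M` which is finitely generated,
virtually non-abelian free and almost malnormal in `M`, such that every
conjugate `mVm⁻¹` meets every `Mₗ` in a finite set. -/
theorem kap1 {M : Type*} [Group M] (hMfg : Group.FG M)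
    (hMvf : VirtuallyNonabelianFree M)
    (n : ℕ) (Ml : Fin n → Subgroup M)
    (hfg : ∀ l, (Ml l).FG) (hinf : ∀ l, ¬ (Ml l).FiniteIndex) :
    ∃ V : Subgroup M, V ≠ ⊤ ∧
      (V.FG ∧ VirtuallyNonabelianFree V ∧ AlmostMalnormal V) ∧
      (∀ (l : Fin n) (m : M), ((conjSub m V ⊓ Ml l : Subgroup M) : Set M).Finite) := by
  exact KP.kap_main hMfg hMvf n Ml hfg hinf
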